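/- The mean volume of a random tetrahedron in a regular octahedron of volume 1 equals 19297π²/3843840 − 6619/184320. -/

import Mathlib

open MeasureTheory

section

open MeasureTheory Set Filter Topology

theorem lintegral_Ioo_of_hasDerivAt {a b A B : ℝ} {F f : ℝ → ℝ} (hab : a < b)
    (hF : ∀ x ∈ Ioo a b, HasDerivAt F (f x) x) (hf : ∀ x ∈ Ioo a b, 0 ≤ f x)
    (hA : Tendsto F (𝓝[>] a) (𝓝 A)) (hB : Tendsto F (𝓝[<] b) (𝓝 B)) :
    0 ≤ B - A ∧ ∫⁻ x in Ioo a b, ENNReal.ofReal (f x) = ENNReal.ofReal (B - A) := by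
  have hc : ContinuousOn F (Ioo a b) := fun x hx => (hF x hx).continuousAt.continuousWithinAt
  have hint : IntegrableOn f (Ioc a b) := by
    refine intervalIntegral.integrableOn_deriv_of_nonneg
      (continuousOn_Icc_extendFrom_Ioo hc hA hB) (fun x hx => ?_) hf
    refine (hF x hx).congr_of_eventuallyEq ?_
    filter_upwards [Ioo_mem_nhds hx.1 hx.2] with y hy
    exact extendFrom_eq (by rw [closure_Ioo hab.ne]; exact Ioo_subset_Icc_self hy) (hc y hy)
  have h := intervalIntegral.integral_eq_sub_of_hasDerivAt_of_tendsto hab hF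
    ((intervalIntegrable_iff_integrableOn_Ioc_of_le hab.le).2 hint) hA hB
  rw [intervalIntegral.integral_of_le hab.le, integral_Ioc_eq_integral_Ioo] at h
  rw [← h]
  refine ⟨setIntegral_nonneg measurableSet_Ioo hf, ?_⟩
  rw [ofReal_integral_eq_lintegral_ofReal (hint.mono_set Ioo_subset_Ioc_self)]
  exact (ae_restrict_iff' measurableSet_Ioo).2 (Eventually.of_forall hf)

theorem lintegral_Ioo_of_hasDerivAt_Icc {a b : ℝ} {F f : ℝ → ℝ} (hab : a < b)
    (hF : ∀ x ∈ Icc a b, HasDerivAt F (f x) x) (hf : ∀ x ∈ Ioo a b, 0 ≤ f x) :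
    0 ≤ F b - F a ∧ ∫⁻ x in Ioo a b, ENNReal.ofReal (f x) = ENNReal.ofReal (F b - F a) :=
  lintegral_Ioo_of_hasDerivAt hab (fun x hx => hF x (Ioo_subset_Icc_self hx)) hf
    ((hF a (left_mem_Icc.2 hab.le)).continuousAt.tendsto.mono_left nhdsWithin_le_nhds)
    ((hF b (right_mem_Icc.2 hab.le)).continuousAt.tendsto.mono_left nhdsWithin_le_nhds)

theorem tendsto_pow_mul_log_zero (n : ℕ) :
    Tendsto (fun x : ℝ => x ^ (n + 1) * Real.log x) (𝓝[>] 0) (𝓝 0) := by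
  have h := tendsto_log_mul_rpow_nhdsGT_zero (r := (n + 1 : ℕ)) (by positivity)
  refine h.congr fun x => ?_
  rw [Real.rpow_natCast, mul_comm]

theorem hasSum_alternating_sq :
    HasSum (fun n : ℕ => 1 / (2 * n + 1 : ℝ) ^ 2 - 1 / (2 * n + 2 : ℝ) ^ 2) (Real.pi ^ 2 / 12) := by
  have h := hasSum_zeta_two
  have h1 : HasSum (fun n : ℕ => 1 / ((n + 1 : ℕ) : ℝ) ^ 2) (Real.pi ^ 2 / 6) := by
    rw [← hasSum_nat_add_iff' 1] at h
    simpa using h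
  have h2 : HasSum (fun n : ℕ => 1 / (2 * n + 2 : ℝ) ^ 2) (Real.pi ^ 2 / 24) := by
    have e : (fun n : ℕ => 1 / (2 * n + 2 : ℝ) ^ 2)
        = fun n : ℕ => 1 / 4 * (1 / ((n + 1 : ℕ) : ℝ) ^ 2) := by
      ext n
      push_cast
      rw [show (2 * n + 2 : ℝ) = 2 * (n + 1) by ring]
      have : (n + 1 : ℝ) ≠ 0 := by positivity
      field_simp
      norm_num
    rw [show Real.pi ^ 2 / 24 = 1 / 4 * (Real.pi ^ 2 / 6) by ring, e]
    exact h1.mul_left (1 / 4)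
  have h3 : Summable (fun n : ℕ => 1 / (2 * n + 1 : ℝ) ^ 2) := by
    have := h.summable.comp_injective (i := fun n : ℕ => 2 * n + 1) (fun a b => by simp)
    refine this.congr fun n => ?_
    simp
  have h4 := HasSum.even_add_odd (f := fun n : ℕ => 1 / ((n + 1 : ℕ) : ℝ) ^ 2)
    (by convert h3.hasSum using 3; push_cast; rfl) (m' := Real.pi ^ 2 / 24)
    (by convert h2 using 3; push_cast; ring)
  have h5 := h4.unique h1
  have h6 := h3.hasSum.sub h2
  rwa [show ∑' b : ℕ, 1 / (2 * b + 1 : ℝ) ^ 2 - Real.pi ^ 2 / 24 = Real.pi ^ 2 / 12 by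
    linarith] at h6

theorem hasDerivAt_pow_mul_log (k : ℕ) {x : ℝ} (hx : 0 < x) :
    HasDerivAt (fun x : ℝ => x ^ (k + 1) / (k + 1 : ℝ) ^ 2 - x ^ (k + 1) * Real.log x / (k + 1))
      (-Real.log x * x ^ k) x := by
  have h1 := (hasDerivAt_pow (k + 1) x)
  have h2 := Real.hasDerivAt_log hx.ne'
  have h3 := (h1.div_const ((k + 1 : ℝ) ^ 2)).sub ((h1.mul h2).div_const (k + 1 : ℝ))
  refine h3.congr_deriv ?_
  have : (k + 1 : ℝ) ≠ 0 := by positivity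
  push_cast
  field_simp
  ring

theorem lintegral_neg_log_div_one_add :
    ∫⁻ x in Ioo (0 : ℝ) 1, ENNReal.ofReal (-Real.log x / (1 + x))
      = ENNReal.ofReal (Real.pi ^ 2 / 12) := by
  have hs : ∀ x ∈ Ioo (0 : ℝ) 1, ENNReal.ofReal (-Real.log x / (1 + x))
      = ∑' n : ℕ, ENNReal.ofReal (-Real.log x * x ^ (2 * n) - -Real.log x * x ^ (2 * n + 1)) := by
    intro x hx
    have hl : 0 ≤ -Real.log x := by linarith [Real.log_nonpos hx.1.le hx.2.le]
    have hx2 : x ^ 2 < 1 := by nlinarith [hx.1, hx.2]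
    have h := (hasSum_geometric_of_lt_one (sq_nonneg x) hx2).mul_left (-Real.log x * (1 - x))
    have h' : HasSum (fun n : ℕ => -Real.log x * x ^ (2 * n) - -Real.log x * x ^ (2 * n + 1))
        (-Real.log x / (1 + x)) := by
      have e : -Real.log x / (1 + x) = -Real.log x * (1 - x) * (1 - x ^ 2)⁻¹ := by
        have : 1 - x ≠ 0 := by linarith [hx.2]
        have : 1 + x ≠ 0 := by linarith [hx.1]
        rw [show 1 - x ^ 2 = (1 - x) * (1 + x) by ring]
        field_simp
      have e' : (fun n : ℕ => -Real.log x * x ^ (2 * n) - -Real.log x * x ^ (2 * n + 1))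
          = fun n : ℕ => -Real.log x * (1 - x) * (x ^ 2) ^ n := by
        ext n
        ring
      rw [e, e']
      exact h
    rw [← h'.tsum_eq, ENNReal.ofReal_tsum_of_nonneg _ h'.summable]
    intro n
    have : x ^ (2 * n + 1) ≤ x ^ (2 * n) :=
      pow_le_pow_of_le_one hx.1.le hx.2.le (Nat.le_succ _)
    nlinarith
  rw [setLIntegral_congr_fun measurableSet_Ioo hs,
    lintegral_tsum (fun n => by fun_prop), ← hasSum_alternating_sq.tsum_eq,
    ENNReal.ofReal_tsum_of_nonneg _ hasSum_alternating_sq.summable]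
  · congr 1
    ext n
    have hnn : ∀ x ∈ Ioo (0 : ℝ) 1,
        0 ≤ -Real.log x * x ^ (2 * n) - -Real.log x * x ^ (2 * n + 1) := by
      intro x hx
      have hl : 0 ≤ -Real.log x := by linarith [Real.log_nonpos hx.1.le hx.2.le]
      have : x ^ (2 * n + 1) ≤ x ^ (2 * n) :=
        pow_le_pow_of_le_one hx.1.le hx.2.le (Nat.le_succ _)
      nlinarith
    have hz : ∀ k : ℕ, Tendsto
        (fun x : ℝ => x ^ (k + 1) / (k + 1 : ℝ) ^ 2 - x ^ (k + 1) * Real.log x / (k + 1))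
        (𝓝[>] 0) (𝓝 0) := by
      intro k
      have h1 : Tendsto (fun x : ℝ => x ^ (k + 1) / (k + 1 : ℝ) ^ 2) (𝓝[>] 0) (𝓝 0) := by
        have : Continuous fun x : ℝ => x ^ (k + 1) / (k + 1 : ℝ) ^ 2 := by fun_prop
        simpa using this.continuousAt (x := 0) |>.tendsto.mono_left nhdsWithin_le_nhds
      simpa using h1.sub ((tendsto_pow_mul_log_zero k).div_const (k + 1 : ℝ))
    have ho : ∀ k : ℕ, Tendsto
        (fun x : ℝ => x ^ (k + 1) / (k + 1 : ℝ) ^ 2 - x ^ (k + 1) * Real.log x / (k + 1))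
        (𝓝[<] 1) (𝓝 (1 / (k + 1 : ℝ) ^ 2)) := by
      intro k
      have := (hasDerivAt_pow_mul_log k one_pos).continuousAt.tendsto.mono_left
        (nhdsWithin_le_nhds (s := Iio 1))
      simpa using this
    have := (lintegral_Ioo_of_hasDerivAt zero_lt_one (fun x hx =>
      (hasDerivAt_pow_mul_log (2 * n) hx.1).sub (hasDerivAt_pow_mul_log (2 * n + 1) hx.1)) hnn
      ((hz _).sub (hz _)) ((ho _).sub (ho _))).2
    rw [this]
    push_cast
    congr 1
    ring
  · intro n
    rw [sub_nonneg]
    gcongr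
    linarith

/-- A primitive of `log ((1 - x) / x) / (1 - x)` on `(0, 1/2)`. -/
theorem exists_primitive_log_div :
    ∃ M : ℝ → ℝ, (∀ x ∈ Ioo (0 : ℝ) (1 / 2),
        HasDerivAt M ((Real.log (1 - x) - Real.log x) / (1 - x)) x) ∧
      Tendsto M (𝓝[>] 0) (𝓝 0) ∧ Tendsto M (𝓝[<] (1 / 2)) (𝓝 (Real.pi ^ 2 / 12)) := by
  set g : ℝ → ℝ := fun x => -Real.log x / (1 + x) with hg
  have hpos : ∀ x ∈ Ioo (0 : ℝ) 1, 0 ≤ g x := fun x hx =>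
    div_nonneg (by linarith [Real.log_nonpos hx.1.le hx.2.le]) (by linarith [hx.1])
  have hpos' : 0 ≤ᵐ[volume.restrict (Ioo (0 : ℝ) 1)] g :=
    (ae_restrict_iff' measurableSet_Ioo).2 (Eventually.of_forall hpos)
  have hmeas : Measurable g := by fun_prop
  have hint : IntegrableOn g (Ioo 0 1) := by
    refine ⟨hmeas.aestronglyMeasurable, ?_⟩
    rw [hasFiniteIntegral_iff_ofReal hpos', lintegral_neg_log_div_one_add]
    exact ENNReal.ofReal_lt_top
  have hii : IntervalIntegrable g volume 0 1 := by
    rw [intervalIntegrable_iff_integrableOn_Ioc_of_le zero_le_one]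
    exact (integrableOn_Ioc_iff_integrableOn_Ioo).2 hint
  have hval : ∫ x in (0 : ℝ)..1, g x = Real.pi ^ 2 / 12 := by
    rw [intervalIntegral.integral_of_le zero_le_one, integral_Ioc_eq_integral_Ioo,
      integral_eq_lintegral_of_nonneg_ae hpos' hmeas.aestronglyMeasurable,
      lintegral_neg_log_div_one_add, ENNReal.toReal_ofReal (by positivity)]
  set N : ℝ → ℝ := fun y => ∫ x in (0 : ℝ)..y, g x with hN
  have hNc : ContinuousOn N (Icc 0 1) := by
    have := intervalIntegral.continuousOn_primitive_interval' (b₁ := 0) (b₂ := 1) (a := 0) hii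
      (by simp)
    simpa [uIcc_of_le zero_le_one] using this
  have hN' : ∀ x ∈ Ioo (0 : ℝ) 1, HasDerivAt N (g x) x := by
    intro x hx
    refine intervalIntegral.integral_hasDerivAt_right
      (hii.mono_set ?_) hmeas.stronglyMeasurable.stronglyMeasurableAtFilter ?_
    · rw [uIcc_of_le hx.1.le, uIcc_of_le zero_le_one]
      exact Icc_subset_Icc_right hx.2.le
    · have : 1 + x ≠ 0 := by linarith [hx.1]
      exact ((Real.continuousAt_log hx.1.ne').neg).div (by fun_prop) this
  have hmap : ∀ x ∈ Ioo (0 : ℝ) (1 / 2), x / (1 - x) ∈ Ioo (0 : ℝ) 1 := by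
    intro x hx
    have h1 : 0 < 1 - x := by linarith [hx.2]
    exact ⟨div_pos hx.1 h1, by rw [div_lt_one h1]; linarith [hx.2]⟩
  refine ⟨fun x => N (x / (1 - x)), fun x hx => ?_, ?_, ?_⟩
  · have h1 : 0 < 1 - x := by linarith [hx.2]
    have hd : HasDerivAt (fun x : ℝ => x / (1 - x)) (1 / (1 - x) ^ 2) x := by
      refine ((hasDerivAt_id x).div ((hasDerivAt_id x).const_sub 1) h1.ne').congr_deriv ?_
      simp
    refine ((hN' _ (hmap x hx)).comp x hd).congr_deriv ?_
    simp only [hg]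
    rw [Real.log_div hx.1.ne' h1.ne']
    field_simp
    ring
  · have h0 : Tendsto N (𝓝[Icc 0 1] 0) (𝓝 0) := by
      have := (hNc 0 (by simp)).tendsto
      simpa [hN] using this
    refine h0.comp (tendsto_nhdsWithin_iff.2 ⟨?_, ?_⟩)
    · have : ContinuousAt (fun x : ℝ => x / (1 - x)) 0 := by fun_prop (disch := norm_num)
      simpa using this.tendsto.mono_left (nhdsWithin_le_nhds (s := Ioi 0))
    · filter_upwards [Ioo_mem_nhdsGT (show (0 : ℝ) < 1 / 2 by norm_num)] with x hx
      exact Ioo_subset_Icc_self (hmap x hx)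
  · have h0 : Tendsto N (𝓝[Icc 0 1] 1) (𝓝 (Real.pi ^ 2 / 12)) := by
      have := (hNc 1 (by simp)).tendsto
      rwa [show N 1 = Real.pi ^ 2 / 12 from hval] at this
    refine h0.comp (tendsto_nhdsWithin_iff.2 ⟨?_, ?_⟩)
    · have : ContinuousAt (fun x : ℝ => x / (1 - x)) (1 / 2) := by
        fun_prop (disch := norm_num)
      have h := this.tendsto.mono_left (nhdsWithin_le_nhds (s := Iio (1 / 2)))
      norm_num at h ⊢
      exact h
    · filter_upwards [Ioo_mem_nhdsLT (show (0 : ℝ) < 1 / 2 by norm_num)] with x hx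
      exact Ioo_subset_Icc_self (hmap x hx)

end

class CompRing (R : Type) extends Add R, Mul R where
  cst : ℤ → R
  isz : R → Bool

open CompRing

def CompRing.pw {R : Type} [CompRing R] (a : R) : ℕ → R
  | 0 => cst 1
  | n + 1 => pw a n * a

structure CompRing.Val {R : Type} [CompRing R] (φ : R → ℝ) : Prop where
  add : ∀ a b, φ (a + b) = φ a + φ b
  mul : ∀ a b, φ (a * b) = φ a * φ b
  cst : ∀ z : ℤ, φ (cst z) = z
  isz : ∀ a, isz a = true → φ a = 0

theorem CompRing.Val.pw {R : Type} [CompRing R] {φ : R → ℝ} (h : Val φ) (a : R) (n : ℕ) :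
    φ (pw a n) = φ a ^ n := by
  induction n with
  | zero => simp [CompRing.pw, h.cst]
  | succ n ih => rw [CompRing.pw, h.mul, ih, pow_succ]

theorem CompRing.Val.eq_of_isz {R : Type} [CompRing R] {φ : R → ℝ} (h : Val φ) {a b : R}
    (hab : CompRing.isz (a + CompRing.cst (-1) * b) = true) : φ a = φ b := by
  have := h.isz _ hab
  rw [h.add, h.mul, h.cst] at this
  push_cast at this
  linarith

instance : CompRing ℤ where
  cst z := z
  isz z := z == 0

theorem valInt : CompRing.Val (fun z : ℤ => (z : ℝ)) where
  add a b := by push_cast; rfl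
  mul a b := by push_cast; rfl
  cst z := rfl
  isz a h := by
    have : a = 0 := by simpa [CompRing.isz] using h
    simp [this]

def Horner (R : Type) := List R

namespace Horner

variable {R : Type} [CompRing R]

def add : List R → List R → List R
  | [], l => l
  | a :: l, [] => a :: l
  | a :: l, b :: m => (a + b) :: add l m

def smul (c : R) : List R → List R
  | [] => []
  | a :: l => (c * a) :: smul c l

def mul : List R → List R → List R
  | [], _ => []
  | a :: l, m => if isz a then cst 0 :: mul l m else add (smul a m) (cst 0 :: mul l m)

def isz : List R → Bool
  | [] => true
  | a :: l => CompRing.isz a && isz l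

instance : CompRing (Horner R) where
  add := Horner.add
  mul := Horner.mul
  cst z := if z == 0 then [] else [cst z]
  isz := Horner.isz

def derivAux : List R → ℤ → List R
  | [], _ => []
  | a :: l, k => cst k * a :: derivAux l (k + 1)

def evalAux (φ : R → ℝ) (x : ℝ) : List R → ℝ
  | [] => 0
  | a :: l => φ a + x * evalAux φ x l

def eval (φ : R → ℝ) (x : ℝ) (p : Horner R) : ℝ := evalAux φ x p

def X : Horner R := ([cst 0, cst 1] : List R)
def C (a : R) : Horner R := ([a] : List R)

def deriv (p : Horner R) : Horner R := derivAux (List.tail p) 1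

/-- Evaluation of the formal variable at an element of the coefficient ring. -/
def sub (v : R) : List R → R
  | [] => cst 0
  | a :: l => a + v * sub v l

/-- Coefficients of `N` times the antiderivative, where `N` is divisible by all indices used. -/
def antiderivAux (N : ℤ) : List R → ℤ → List R
  | [], _ => []
  | a :: l, k => cst (N / k) * a :: antiderivAux N l (k + 1)

def antideriv (N : ℤ) (p : List R) : List R := cst 0 :: antiderivAux N p 1



variable {φ : R → ℝ}

theorem evalAux_add (h : Val φ) (x : ℝ) (l m : List R) :
    evalAux φ x (add l m) = evalAux φ x l + evalAux φ x m := by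
  induction l generalizing m with
  | nil => simp [add, evalAux]
  | cons a l ih =>
    cases m with
    | nil => simp [add, evalAux]
    | cons b m => simp only [add, evalAux, ih, h.add]; ring

theorem evalAux_smul (h : Val φ) (x : ℝ) (c : R) (l : List R) :
    evalAux φ x (smul c l) = φ c * evalAux φ x l := by
  induction l with
  | nil => simp [smul, evalAux]
  | cons a l ih => simp only [smul, evalAux, ih, h.mul]; ring

theorem evalAux_mul (h : Val φ) (x : ℝ) (l m : List R) :
    evalAux φ x (mul l m) = evalAux φ x l * evalAux φ x m := by
  induction l with
  | nil => simp [mul, evalAux]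
  | cons a l ih =>
    rw [mul]
    split_ifs with ha
    · simp only [evalAux, ih, h.cst, h.isz a ha]
      push_cast
      ring
    · simp only [evalAux_add h, evalAux, ih, h.cst, evalAux_smul h]
      push_cast
      ring

theorem evalAux_isz (h : Val φ) (x : ℝ) (l : List R) (hl : isz l = true) :
    evalAux φ x l = 0 := by
  induction l with
  | nil => rfl
  | cons a l ih =>
    rw [isz, Bool.and_eq_true] at hl
    rw [evalAux, h.isz a hl.1, ih hl.2]
    ring

theorem val_eval (h : Val φ) (x : ℝ) : Val (eval φ x) where
  add a b := evalAux_add h x a b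
  mul a b := evalAux_mul h x a b
  cst z := by
    change evalAux φ x (if z == 0 then [] else [cst z]) = z
    split_ifs with hz
    · have : z = 0 := by simpa using hz
      simp [evalAux, this]
    · simp [evalAux, h.cst]
  isz a ha := evalAux_isz h x a ha

theorem eval_X (h : Val φ) (x : ℝ) : eval φ x X = x := by
  simp [eval, X, evalAux, h.cst]

theorem eval_C (x : ℝ) (a : R) : eval φ x (C a) = φ a := by
  simp [eval, C, evalAux]

theorem map_sub (h : Val φ) (v : R) (l : List R) : φ (sub v l) = evalAux φ (φ v) l := by
  induction l with
  | nil => simp [sub, evalAux, h.cst]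
  | cons a l ih => simp only [sub, evalAux, h.add, h.mul, ih]

theorem evalAux_derivAux (h : Val φ) (x : ℝ) (l : List R) (k : ℤ) :
    evalAux φ x (derivAux l k) = k * evalAux φ x l + x * evalAux φ x (derivAux l.tail 1) := by
  induction l generalizing k with
  | nil => simp [derivAux, evalAux]
  | cons a l ih =>
    have h1 := ih 1
    simp only [derivAux, evalAux, List.tail_cons, h.mul, h.cst, ih (k + 1), h1]
    push_cast
    ring

theorem hasDerivAt_evalAux (h : Val φ) (x : ℝ) (l : List R) :
    HasDerivAt (fun x => evalAux φ x l) (evalAux φ x (derivAux l.tail 1)) x := by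
  induction l with
  | nil => exact hasDerivAt_const x 0
  | cons a l ih =>
    refine (((hasDerivAt_id x).mul ih).const_add (φ a)).congr_deriv ?_
    rw [List.tail_cons, evalAux_derivAux h x l 1]
    simp

theorem hasDerivAt_eval (h : Val φ) (x : ℝ) (p : Horner R) :
    HasDerivAt (fun x => eval φ x p) (eval φ x (deriv p)) x :=
  hasDerivAt_evalAux h x p

theorem evalAux_derivAux_antiderivAux (h : Val φ) (x : ℝ) (N : ℤ) (l : List R) (k : ℕ)
    (hk : ∀ j : ℕ, k ≤ j → j < k + l.length → (j : ℤ) ∣ N) :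
    evalAux φ x (derivAux (antiderivAux N l k) k) = N * evalAux φ x l := by
  induction l generalizing k with
  | nil => simp [antiderivAux, derivAux, evalAux]
  | cons a l ih =>
    have h1 := ih (k + 1) fun j h2 h3 => hk j (by omega) (by simp only [List.length_cons]; omega)
    have h2 : (k : ℤ) * (N / k) = N :=
      Int.mul_ediv_cancel' (hk k le_rfl (by simp))
    have h3 : (k : ℝ) * ((N / k : ℤ) : ℝ) = N := by exact_mod_cast congrArg (Int.cast (R := ℝ)) h2
    push_cast at h1
    simp only [antiderivAux, derivAux, evalAux, h.mul, h.cst, h1, Int.cast_natCast]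
    rw [← mul_assoc, h3]
    ring

theorem hasDerivAt_antideriv (h : Val φ) (x : ℝ) (N : ℤ) (l : List R)
    (hN : ∀ j : ℕ, 1 ≤ j → j ≤ l.length → (j : ℤ) ∣ N) :
    HasDerivAt (fun x => evalAux φ x (antideriv N l)) (N * evalAux φ x l) x := by
  refine (hasDerivAt_evalAux h x (antideriv N l)).congr_deriv ?_
  rw [antideriv, List.tail_cons]
  exact_mod_cast evalAux_derivAux_antiderivAux h x N l 1 fun j h1 h2 => hN j h1 (by omega)

theorem evalAux_antideriv_zero (h : Val φ) (N : ℤ) (l : List R) :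
    evalAux φ 0 (antideriv N l) = 0 := by
  simp [antideriv, evalAux, h.cst]

end Horner

abbrev H1 := Horner ℤ
abbrev H2 := Horner H1
abbrev H3 := Horner H2

namespace CompRing
variable {R : Type} [CompRing R]

def sb (a b : R) : R := a + cst (-1) * b

def detNumB (r s A B C D : R) : R :=
  let u := fun i j => pw A (5-i) * pw B (5-j)
  let v := fun i j => pw s (i+j) * (pw C (5-i) * pw D (5-j))
  pw r 0 * (u 0 0 * (cst (24) * v 0 0 + cst (-84) * v 1 1 + cst (48) * v 1 2 + cst (-24) * v 1 3 + cst (48) * v 2 1 + cst (16) * v 2 4 + cst (-24) * v 3 1 + cst (12) * v 3 3 + cst (-24) * v 3 4 + cst (16) * v 4 2 + cst (-24) * v 4 3 + cst (18) * v 4 4 + cst (-1) * v 5 5))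
    + pw r 2 * (u 1 1 * (cst (-84) * v 0 0 + cst (144) * v 1 1 + cst (-48) * v 1 2 + cst (48) * v 1 3 + cst (-48) * v 2 1 + cst (-36) * v 2 2 + cst (-24) * v 2 4 + cst (48) * v 3 1 + cst (-24) * v 3 3 + cst (24) * v 3 4 + cst (-24) * v 4 2 + cst (24) * v 4 3 + cst (-9) * v 4 4))
    + pw r 3 * (u 1 2 * (cst (48) * v 0 0 + cst (-48) * v 1 1 + cst (-32) * v 1 2 + cst (48) * v 2 1 + cst (24) * v 2 2 + cst (-48) * v 3 1 + cst (8) * v 3 3 + cst (16) * v 4 2 + cst (-8) * v 4 3))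
    + pw r 4 * (u 1 3 * (cst (-24) * v 0 0 + cst (48) * v 1 1 + cst (-48) * v 2 1 + cst (24) * v 3 1 + cst (-4) * v 4 2))
    + pw r 3 * (u 2 1 * (cst (48) * v 0 0 + cst (-48) * v 1 1 + cst (48) * v 1 2 + cst (-48) * v 1 3 + cst (-32) * v 2 1 + cst (24) * v 2 2 + cst (16) * v 2 4 + cst (8) * v 3 3 + cst (-8) * v 3 4))
    + pw r 4 * (u 2 2 * (cst (-36) * v 1 1 + cst (24) * v 1 2 + cst (24) * v 2 1 + cst (-12) * v 2 2 + cst (-2) * v 3 3))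
    + pw r 6 * (u 2 4 * (cst (16) * v 0 0 + cst (-24) * v 1 1 + cst (16) * v 2 1 + cst (-4) * v 3 1))
    + pw r 4 * (u 3 1 * (cst (-24) * v 0 0 + cst (48) * v 1 1 + cst (-48) * v 1 2 + cst (24) * v 1 3 + cst (-4) * v 2 4))
    + pw r 6 * (u 3 3 * (cst (12) * v 0 0 + cst (-24) * v 1 1 + cst (8) * v 1 2 + cst (8) * v 2 1 + cst (-2) * v 2 2))
    + pw r 7 * (u 3 4 * (cst (-24) * v 0 0 + cst (24) * v 1 1 + cst (-8) * v 2 1))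
    + pw r 6 * (u 4 2 * (cst (16) * v 0 0 + cst (-24) * v 1 1 + cst (16) * v 1 2 + cst (-4) * v 1 3))
    + pw r 7 * (u 4 3 * (cst (-24) * v 0 0 + cst (24) * v 1 1 + cst (-8) * v 1 2))
    + pw r 8 * (u 4 4 * (cst (18) * v 0 0 + cst (-9) * v 1 1))
    + pw r 10 * (u 5 5 * (cst (-1) * v 0 0))

def detNumC (r s A B : R) : R :=
  let v := fun i j n => pw s n * (pw A (5-i) * pw B (5-j))
  pw r 0 * (cst (24) * v 0 0 0 + cst (-84) * v 1 1 2 + cst (48) * v 1 2 3 + cst (-24) * v 1 3 4 + cst (48) * v 2 1 3 + cst (16) * v 2 4 6 + cst (-24) * v 3 1 4 + cst (12) * v 3 3 6 + cst (-24) * v 3 4 7 + cst (16) * v 4 2 6 + cst (-24) * v 4 3 7 + cst (18) * v 4 4 8 + cst (-1) * v 5 5 10)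
    + pw r 2 * (cst (-84) * v 1 1 0 + cst (144) * v 2 2 2 + cst (-48) * v 2 3 3 + cst (48) * v 2 4 4 + cst (-48) * v 3 2 3 + cst (-36) * v 3 3 4 + cst (-24) * v 3 5 6 + cst (48) * v 4 2 4 + cst (-24) * v 4 4 6 + cst (24) * v 4 5 7 + cst (-24) * v 5 3 6 + cst (24) * v 5 4 7 + cst (-9) * v 5 5 8)
    + pw r 3 * (cst (48) * v 1 2 0 + cst (-48) * v 2 3 2 + cst (-32) * v 2 4 3 + cst (48) * v 3 3 3 + cst (24) * v 3 4 4 + cst (-48) * v 4 3 4 + cst (8) * v 4 5 6 + cst (16) * v 5 4 6 + cst (-8) * v 5 5 7)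
    + pw r 4 * (cst (-24) * v 1 3 0 + cst (48) * v 2 4 2 + cst (-48) * v 3 4 3 + cst (24) * v 4 4 4 + cst (-4) * v 5 5 6)
    + pw r 3 * (cst (48) * v 2 1 0 + cst (-48) * v 3 2 2 + cst (48) * v 3 3 3 + cst (-48) * v 3 4 4 + cst (-32) * v 4 2 3 + cst (24) * v 4 3 4 + cst (16) * v 4 5 6 + cst (8) * v 5 4 6 + cst (-8) * v 5 5 7)
    + pw r 4 * (cst (-36) * v 3 3 2 + cst (24) * v 3 4 3 + cst (24) * v 4 3 3 + cst (-12) * v 4 4 4 + cst (-2) * v 5 5 6)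
    + pw r 6 * (cst (16) * v 2 4 0 + cst (-24) * v 3 5 2 + cst (16) * v 4 5 3 + cst (-4) * v 5 5 4)
    + pw r 4 * (cst (-24) * v 3 1 0 + cst (48) * v 4 2 2 + cst (-48) * v 4 3 3 + cst (24) * v 4 4 4 + cst (-4) * v 5 5 6)
    + pw r 6 * (cst (12) * v 3 3 0 + cst (-24) * v 4 4 2 + cst (8) * v 4 5 3 + cst (8) * v 5 4 3 + cst (-2) * v 5 5 4)
    + pw r 7 * (cst (-24) * v 3 4 0 + cst (24) * v 4 5 2 + cst (-8) * v 5 5 3)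
    + pw r 6 * (cst (16) * v 4 2 0 + cst (-24) * v 5 3 2 + cst (16) * v 5 4 3 + cst (-4) * v 5 5 4)
    + pw r 7 * (cst (-24) * v 4 3 0 + cst (24) * v 5 4 2 + cst (-8) * v 5 5 3)
    + pw r 8 * (cst (18) * v 4 4 0 + cst (-9) * v 5 5 2)
    + pw r 10 * (cst (-1) * v 5 5 0)

def hNumB (a b r : R) : R :=
  let s := sb (r + b) a
  ((cst 6 * pw (sb (cst 2 * r + b) a) 2) + cst 2 * (sb (sb (cst 2 + pw a 2 + pw b 2) a) b)) * (a * b * (sb (cst 1) a * sb (cst 1) b))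
   + cst (-2) * (pw r 4 * (b * sb (cst 1) a) + pw s 4 * (a * sb (cst 1) b))

def hNumC (a b r : R) : R :=
  let s := sb (sb (cst 2 * b) (cst 2 * a)) r
  ((cst 12 * pw (sb (sb b a) r) 2) + cst 4 * (sb (sb (cst 2 + pw a 2 + pw b 2) a) b)) * (cst 4 * (b * sb (cst 1) a))
   + cst (-1) * (pw r 4 + pw s 4)
def integrandB (a b r : R) : R :=
  hNumB a b r * detNumB r (sb (r + b) a) a (sb (cst 1) b) (sb (cst 1) a) b

def integrandC (a b r : R) : R :=
  hNumC a b r * detNumC r (sb (sb (cst 2 * b) (cst 2 * a)) r) (cst 2 * sb (cst 1) a) (cst 2 * b)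

end CompRing


theorem CompRing.Val.sb {R : Type} [CompRing R] {φ : R → ℝ} (h : Val φ) (a b : R) :
    φ (sb a b) = φ a - φ b := by
  rw [CompRing.sb, h.add, h.mul, h.cst]
  push_cast
  ring

section

open CompRing

/-- Determinant of the Gram matrix of `1, x, y` on the unit square with two right triangular
corners removed: one at the origin with legs `p, q`, one at `(1, 1)` with legs `p', q'`. -/
noncomputable def cornerDet (p q p' q' : ℝ) : ℝ :=
  let m00 := 1 - p * q / 2 - p' * q' / 2
  let m10 := 1 / 2 - p ^ 2 * q / 6 - (p' * q' / 2 - p' ^ 2 * q' / 6)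
  let m01 := 1 / 2 - p * q ^ 2 / 6 - (p' * q' / 2 - p' * q' ^ 2 / 6)
  let m20 := 1 / 3 - p ^ 3 * q / 12 - (p' * q' / 2 - p' ^ 2 * q' / 3 + p' ^ 3 * q' / 12)
  let m02 := 1 / 3 - p * q ^ 3 / 12 - (p' * q' / 2 - p' * q' ^ 2 / 3 + p' * q' ^ 3 / 12)
  let m11 := 1 / 4 - p ^ 2 * q ^ 2 / 24
    - (p' * q' / 2 - p' ^ 2 * q' / 6 - p' * q' ^ 2 / 6 + p' ^ 2 * q' ^ 2 / 24)
  m00 * (m20 * m02 - m11 ^ 2) - m10 * (m10 * m02 - m11 * m01) + m01 * (m10 * m11 - m20 * m01)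

theorem CompRing.Val.detNumB {R : Type} [CompRing R] {φ : R → ℝ} (h : Val φ) {r s A B C D : R}
    (hA : φ A ≠ 0) (hB : φ B ≠ 0) (hC : φ C ≠ 0) (hD : φ D ≠ 0) :
    φ (detNumB r s A B C D) = 3456 * (φ A * φ B * φ C * φ D) ^ 5
      * cornerDet (φ r / φ A) (φ r / φ B) (φ s / φ C) (φ s / φ D) := by
  simp only [CompRing.detNumB, h.add, h.mul, h.cst, h.pw, cornerDet]
  generalize φ A = A at *
  generalize φ B = B at *
  generalize φ C = C at *
  generalize φ D = D at *
  generalize φ r = r at *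
  generalize φ s = s at *
  obtain ⟨a, rfl⟩ : ∃ a, A = a⁻¹ := ⟨A⁻¹, (inv_inv A).symm⟩
  obtain ⟨b, rfl⟩ : ∃ a, B = a⁻¹ := ⟨B⁻¹, (inv_inv B).symm⟩
  obtain ⟨c, rfl⟩ : ∃ a, C = a⁻¹ := ⟨C⁻¹, (inv_inv C).symm⟩
  obtain ⟨d, rfl⟩ : ∃ a, D = a⁻¹ := ⟨D⁻¹, (inv_inv D).symm⟩
  simp only [div_inv_eq_mul]
  have ha : a ≠ 0 := fun h => hA (by simp [h])
  have hb : b ≠ 0 := fun h => hB (by simp [h])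
  have hc : c ≠ 0 := fun h => hC (by simp [h])
  have hd : d ≠ 0 := fun h => hD (by simp [h])
  push_cast
  norm_num
  field_simp
  ring

theorem CompRing.Val.detNumC {R : Type} [CompRing R] {φ : R → ℝ} (h : Val φ) {r s A B : R}
    (hA : φ A ≠ 0) (hB : φ B ≠ 0) :
    φ (detNumC r s A B) = 3456 * (φ A * φ B) ^ 5
      * cornerDet (φ r / φ A) (φ r / φ B) (φ s / φ A) (φ s / φ B) := by
  simp only [CompRing.detNumC, h.add, h.mul, h.cst, h.pw, cornerDet]
  generalize φ A = A at *
  generalize φ B = B at *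
  generalize φ r = r at *
  generalize φ s = s at *
  push_cast
  norm_num
  field_simp
  ring

def polyT_B : H3 := integrandB (.C (.C .X)) (.C .X) .X
def polyT_C : H3 := integrandC (.C (.C .X)) (.C .X) .X

def primB : H2 := Horner.sub (R := H2) (.C .X) (Horner.antideriv (R := H2) 360360 polyT_B)
def primC : H2 := Horner.sub (R := H2) (sb .X (.C .X)) (Horner.antideriv (R := H2) 360360 polyT_C)
def polyF : H2 := ([[0, 0, 0, 0, 0, 0, 0, 0, 0, 0, 0, 0, 0, 226800, -226800, 83160],
    [0, 0, 0, 0, 0, 0, 0, 0, 0, -1801800, 4504500, -6748560, 3669120, -1853460, 856170, -317520],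
    [0, 0, 0, 0, 0, 0, 0, 8648640, -13169520, 18389280, -9146340, 19686520, -11701200, 4884180, -1207570, 465360],
    [0, 0, 0, 0, 0, 0, -72792720, 108533880, -126207900, 4317600, -17507700, -14985320, 11948160, -5817840, 649880, -290640],
    [0, 0, 0, 0, 0, 479999520, -806485680, 1082292120, -400507380, 279116040, -35946540, 1466920, 2688000, 1942080, -33880, 117600],
    [0, 0, 0, 328648320, -2689006320, 4396031640, -3271646560, 1100672300, -7261323370, 13489637924, -12681282754, 5425073500, -718547830, 58379720, 1634976, -1023456],
    [0, 908107200, -7204317120, 21064483440, -35246090880, 49794064320, -67801497400, 66158570660, -15220539670, -40100722060, 46797642290, -18099872420, 1268475950, 77937440, -36804600, 4527600],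
    [454053600, -7718911200, 48477789360, -140904723960, 269708018580, -395287532640, 472243684640, -413885825080, 199616968460, 10432200800, -64629326440, 22808311960, -277441360, -310717120, 58035600, -5527200],
    [-2946303360, 29130060960, -149021112240, 409319830920, -774948714540, 1094445271920, -1202619796560, 970932329640, -491641523100, 83749949640, 39795116760, -12866731920, -550158840, 234753120, -33339600, 3175200],
    [8651522880, -65734709040, 282498456240, -714661207260, 1270623023670, -1656988613280, 1634064639480, -1178908632720, 558576869760, -120857917320, -9227080800, 2741366880, 260977920, -52167360, 7408800, -705600],
    [-15562651104, 101243862720, -376643875608, 858567201492, -1371835487022, 1575812430192, -1328277951000, 806024419200, -325615890600, 66234168000],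
    [19740761040, -115269194040, 378263913300, -760594161600, 1046412407040, -1003181579400, 673856263080, -309637167840, 90566395920, -13246833600],
    [-19186547640, 101611520400, -293400106740, 507723629400, -577575878880, 436455899880, -214045551720, 62670207600, -8481072600],
    [14829083085, -70288672920, 174471292620, -251211736620, 225840164550, -125652006480, 40042842840, -5654048400],
    [-9099463425, 37614900240, -77425965180, 88428118740, -58695707070, 21328627320, -3311708400],
    [4335070386, -15097563720, 24590804508, -20773947792, 9021684672, -1602592992],
    [-1552844130, 4348725840, -5229468540, 2892219720, -614413800],
    [399040545, -838925400, 659312100, -178354800],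
    [-68235405, 95570160, -36722700],
    [6807360, -4771200],
    [-293832]] : List (List ℤ))
def polyLogB : H1 := ([0, 0, 0, 0, 1427025600, -4676752080, 8995306320, -10358908560, 8572986240, -5367287520, 2575069560, -945115920, 260977920, -52167360, 7408800, -705600] : List ℤ)
def polyLogC : H1 := ([0, 0, -272432160, 2650087440, -6519633120, 6703176480, -5704979280, 9835906080, -17016777960, 16492150080, -5437895400, -945115920, 260977920, -52167360, 7408800, -705600] : List ℤ)
def polyS : H1 := ([0, -5257744480800, 23659850163600, -41187027260400, 33747812660100, -12022584835380, 881356807800, 132958816200, 32259074400, -3319961400, 15359309280, 3077650800, -823964400, 158583600, -21168000, 2116800] : List ℤ)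
def polyQ : H1 := ([0, -5255517397005, 48614893684335, -200320578865250, 482865489581720, -751031556433959, 783007729271055, -549627324121710, 254584630155630, -77031624689850, 20245308496302, -10450163932320, 6656823728540, -2972976076520, 822969588900, -109578010128, 1716989400, -270421200, 30693600, -2116800] : List ℤ)

set_option maxRecDepth 100000 in
theorem length_polyT_B : (List.length (polyT_B : List H2)).ble 15 = true := by decide +kernel

set_option maxRecDepth 100000 in
theorem length_polyT_C : (List.length (polyT_C : List H2)).ble 15 = true := by decide +kernel

set_option maxRecDepth 100000 in
theorem isz_deriv_polyF : isz (
  let a : H2 := .C .X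
  let b : H2 := .X
  let b' : H2 := sb (cst 1) b
  sb (cst 32768 * (pw a 6 * (Horner.deriv polyF * (b * b') + cst (-5) * (polyF * (sb (cst 1) (cst 2 * b)))
    + .C polyLogB * (pw b 5 * pw b' 6) + .C polyLogC * (pw b 6 * pw b' 5))))
   (cst 105 * (cst 16384 * primB + pw a 6 * (pw b' 6 * primC)))) = true := by decide +kernel

set_option maxRecDepth 100000 in
theorem isz_deriv_polyS : isz (
  let a' : H1 := sb (cst 1) .X
  sb (Horner.deriv polyS * a' + cst 5 * polyS + cst (104320327 * 50400) * pw a' 5)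
    (cst 15 * (polyLogB + polyLogC))) = true := by decide +kernel

set_option maxRecDepth 100000 in
theorem isz_deriv_polyQ : isz (
  let a : H1 := .X
  let a' : H1 := sb (cst 1) a
  sb (pw a 5 * (Horner.deriv polyQ * a' + cst 10 * polyQ))
   (pw a 4 * pw a' 5 * polyS
    + cst 15 * (sb (Horner.sub (R := H1) a' polyF) (Horner.sub (R := H1) a polyF)))) = true := by
  decide +kernel

end

section

open CompRing MeasureTheory Set Filter Topology

noncomputable def meanDistB (α β r : ℝ) : ℝ :=
  2 * (r + (β - α) / 2) ^ 2 + (2 - α - β + α ^ 2 + β ^ 2) / 6 - r ^ 4 / (6 * α * (1 - β))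
    - (r + β - α) ^ 4 / (6 * β * (1 - α))

noncomputable def meanDistC (α β r : ℝ) : ℝ :=
  2 * ((β - α) / 2 - r) ^ 2 + (2 - α - β + α ^ 2 + β ^ 2) / 6 - r ^ 4 / (6 * β * (1 - α))
    - (β - α - r) ^ 4 / (6 * β * (1 - α))

noncomputable def cornerDetB (α β r : ℝ) : ℝ :=
  cornerDet (r / α) (r / (1 - β)) ((r + β - α) / (1 - α)) ((r + β - α) / β)

noncomputable def cornerDetC (α β r : ℝ) : ℝ :=
  cornerDet (r / (1 - α)) (r / β) ((β - α - r) / (1 - α)) ((β - α - r) / β)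

noncomputable def val1 (α : ℝ) : H1 → ℝ := Horner.eval (fun z : ℤ => (z : ℝ)) α

noncomputable def val2 (α β : ℝ) : H2 → ℝ := Horner.eval (val1 α) β

theorem val_val1 (α : ℝ) : Val (val1 α) := Horner.val_eval valInt α

theorem val_val2 (α β : ℝ) : Val (val2 α β) := Horner.val_eval (val_val1 α) β

theorem val1_X (α : ℝ) : val1 α Horner.X = α := Horner.eval_X valInt α

theorem val2_X (α β : ℝ) : val2 α β Horner.X = β := Horner.eval_X (val_val1 α) β

theorem val2_C (α β : ℝ) (p : H1) : val2 α β (Horner.C p) = val1 α p := Horner.eval_C β p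

theorem CompRing.Val.integrandB {R : Type} [CompRing R] {φ : R → ℝ} (h : Val φ) {a b r : R}
    (ha : φ a ≠ 0) (ha' : 1 - φ a ≠ 0) (hb : φ b ≠ 0) (hb' : 1 - φ b ≠ 0) :
    φ (integrandB a b r) = 41472 * (φ a * φ b * (1 - φ a) * (1 - φ b)) ^ 6
      * (meanDistB (φ a) (φ b) (φ r) * cornerDetB (φ a) (φ b) (φ r)) := by
  rw [CompRing.integrandB, h.mul, h.detNumB ha (by simpa [h.sb, h.cst] using hb')
    (by simpa [h.sb, h.cst] using ha') hb]
  have e : φ (hNumB a b r)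
      = 12 * (φ a * φ b * (1 - φ a) * (1 - φ b)) * meanDistB (φ a) (φ b) (φ r) := by
    simp only [hNumB, h.add, h.mul, h.sb, h.cst, h.pw, meanDistB]
    field_simp
    push_cast
    ring
  rw [e, cornerDetB]
  simp only [h.sb, h.cst, h.add, Int.cast_one]
  ring

theorem CompRing.Val.integrandC {R : Type} [CompRing R] {φ : R → ℝ} (h : Val φ) {a b q : R}
    (ha' : 1 - φ a ≠ 0) (hb : φ b ≠ 0) :
    φ (integrandC a b q) = 82944 * (4 * φ b * (1 - φ a)) ^ 6
      * (meanDistC (φ a) (φ b) (φ q / 2) * cornerDetC (φ a) (φ b) (φ q / 2)) := by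
  rw [CompRing.integrandC, h.mul, h.detNumC (by simpa [h.sb, h.cst, h.mul] using ha')
    (by simpa [h.cst, h.mul] using hb)]
  have e : φ (hNumC a b q)
      = 24 * (4 * φ b * (1 - φ a)) * meanDistC (φ a) (φ b) (φ q / 2) := by
    simp only [hNumC, h.add, h.mul, h.sb, h.cst, h.pw, meanDistC]
    field_simp
    push_cast
    ring
  rw [e, cornerDetC]
  simp only [h.sb, h.cst, h.mul, Int.cast_one, Int.cast_ofNat]
  rw [show φ q / 2 / (1 - φ a) = φ q / (2 * (1 - φ a)) by rw [div_div],
    show φ q / 2 / φ b = φ q / (2 * φ b) by rw [div_div],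
    show (φ b - φ a - φ q / 2) / (1 - φ a) = (2 * φ b - 2 * φ a - φ q) / (2 * (1 - φ a)) by
      field_simp,
    show (φ b - φ a - φ q / 2) / φ b = (2 * φ b - 2 * φ a - φ q) / (2 * φ b) by
      field_simp]
  ring

theorem dvd_of_le_fifteen {l : List H2} (hl : (List.length l).ble 15 = true) (j : ℕ) (h1 : 1 ≤ j)
    (h2 : j ≤ l.length) : (j : ℤ) ∣ 360360 := by
  have := Nat.le_of_ble_eq_true hl
  have h3 : j ≤ 15 := by omega
  interval_cases j <;> norm_num

theorem lintegral_B {α β : ℝ} (hα : 0 < α) (h1 : α < β) (h2 : β < 1 - α)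
    (h : ∀ r ∈ Ioo 0 α, 0 ≤ meanDistB α β r * cornerDetB α β r) :
    0 ≤ val2 α β primB / (360360 * 41472 * (α * β * (1 - α) * (1 - β)) ^ 6) ∧
    ∫⁻ r in Ioo 0 α, ENNReal.ofReal (meanDistB α β r * cornerDetB α β r)
      = ENNReal.ofReal (val2 α β primB
        / (360360 * 41472 * (α * β * (1 - α) * (1 - β)) ^ 6)) := by
  have hb : 0 < β := by linarith
  have ha' : 0 < 1 - α := by linarith
  have hb' : 0 < 1 - β := by linarith
  have hd : ∀ r, HasDerivAt (fun r => Horner.evalAux (val2 α β)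
      r (Horner.antideriv (R := H2) 360360 polyT_B)
        / (360360 * 41472 * (α * β * (1 - α) * (1 - β)) ^ 6))
      (meanDistB α β r * cornerDetB α β r) r := by
    intro r
    refine ((Horner.hasDerivAt_antideriv (val_val2 α β) r 360360 polyT_B
      (dvd_of_le_fifteen length_polyT_B)).div_const _).congr_deriv ?_
    have hv := Horner.val_eval (val_val2 α β) r
    have e : Horner.evalAux (val2 α β) r polyT_B = 41472 * (α * β * (1 - α) * (1 - β)) ^ 6
      * (meanDistB α β r * cornerDetB α β r) := by
      have eb : Horner.eval (val2 α β) r (Horner.C Horner.X) = β := by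
        rw [Horner.eval_C, val2_X]
      have ea : Horner.eval (val2 α β) r (Horner.C (Horner.C Horner.X)) = α := by
        rw [Horner.eval_C, val2_C, val1_X]
      have er : Horner.eval (val2 α β) r Horner.X = r := Horner.eval_X (val_val2 α β) r
      have := hv.integrandB (a := .C (.C .X)) (b := .C .X) (r := .X) (by rw [ea]; exact hα.ne')
        (by rw [ea]; exact ha'.ne') (by rw [eb]; exact hb.ne') (by rw [eb]; exact hb'.ne')
      rw [ea, eb, er] at this
      exact this
    rw [e]
    push_cast
    field_simp
  have := lintegral_Ioo_of_hasDerivAt_Icc hα (fun r _ => hd r) h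
  have e0 : Horner.evalAux (val2 α β) 0 (Horner.antideriv (R := H2) 360360 polyT_B) = 0 :=
    Horner.evalAux_antideriv_zero (val_val2 α β) _ _
  have ea : Horner.evalAux (val2 α β) α (Horner.antideriv (R := H2) 360360 polyT_B)
      = val2 α β primB := by
    rw [primB, Horner.map_sub (val_val2 α β), val2_C, val1_X]
  simp only [e0, ea, zero_div, sub_zero] at this
  exact this

theorem lintegral_C {α β : ℝ} (hα : 0 < α) (h1 : α < β) (h2 : β < 1 - α)
    (h : ∀ r ∈ Ioo 0 ((β - α) / 2), 0 ≤ meanDistC α β r * cornerDetC α β r) :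
    0 ≤ val2 α β primC / (360360 * 165888 * (4 * β * (1 - α)) ^ 6) ∧
    ∫⁻ r in Ioo 0 ((β - α) / 2), ENNReal.ofReal (meanDistC α β r * cornerDetC α β r)
      = ENNReal.ofReal (val2 α β primC / (360360 * 165888 * (4 * β * (1 - α)) ^ 6)) := by
  have hb : 0 < β := by linarith
  have ha' : 0 < 1 - α := by linarith
  have hd : ∀ r, HasDerivAt (fun r => Horner.evalAux (val2 α β)
      (2 * r) (Horner.antideriv (R := H2) 360360 polyT_C)
        / (360360 * 165888 * (4 * β * (1 - α)) ^ 6))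
      (meanDistC α β r * cornerDetC α β r) r := by
    intro r
    have hd2 : HasDerivAt (fun r : ℝ => 2 * r) 2 r := by
      simpa using (hasDerivAt_id r).const_mul 2
    refine (((Horner.hasDerivAt_antideriv (val_val2 α β) (2 * r) 360360 polyT_C
      (dvd_of_le_fifteen length_polyT_C)).comp r hd2).div_const _).congr_deriv ?_
    have hv := Horner.val_eval (val_val2 α β) (2 * r)
    have e : Horner.evalAux (val2 α β) (2 * r) polyT_C = 82944 * (4 * β * (1 - α)) ^ 6
      * (meanDistC α β r * cornerDetC α β r) := by
      have eb : Horner.eval (val2 α β) (2 * r) (Horner.C Horner.X) = β := by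
        rw [Horner.eval_C, val2_X]
      have ea : Horner.eval (val2 α β) (2 * r) (Horner.C (Horner.C Horner.X)) = α := by
        rw [Horner.eval_C, val2_C, val1_X]
      have er : Horner.eval (val2 α β) (2 * r) Horner.X = 2 * r :=
        Horner.eval_X (val_val2 α β) (2 * r)
      have := hv.integrandC (a := .C (.C .X)) (b := .C .X) (q := .X)
        (by rw [ea]; exact ha'.ne') (by rw [eb]; exact hb.ne')
      rw [ea, eb, er, mul_div_cancel_left₀ _ (two_ne_zero)] at this
      exact this
    rw [e]
    push_cast
    field_simp
    ring
  have := lintegral_Ioo_of_hasDerivAt_Icc (show 0 < (β - α) / 2 by linarith) (fun r _ => hd r) h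
  have e0 : Horner.evalAux (val2 α β) 0 (Horner.antideriv (R := H2) 360360 polyT_C) = 0 :=
    Horner.evalAux_antideriv_zero (val_val2 α β) _ _
  have ea : Horner.evalAux (val2 α β) (β - α) (Horner.antideriv (R := H2) 360360 polyT_C)
      = val2 α β primC := by
    rw [primC, Horner.map_sub (val_val2 α β), (val_val2 α β).sb, val2_C, val1_X, val2_X]
  rw [mul_div_cancel₀ _ (two_ne_zero), mul_zero] at this
  simp only [e0, ea, zero_div, sub_zero] at this
  exact this

noncomputable def primF (α β : ℝ) : ℝ :=
  val2 α β polyF / (784604620800 * β ^ 5 * (1 - α) ^ 6 * (1 - β) ^ 5)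
    + val1 α polyLogB / (784604620800 * (1 - α) ^ 6) * Real.log β
    - val1 α polyLogC / (784604620800 * (1 - α) ^ 6) * Real.log (1 - β)

theorem hasDerivAt_primF {α β : ℝ} (hα : 0 < α) (ha' : 0 < 1 - α) (hb : 0 < β)
    (hb' : 0 < 1 - β) :
    HasDerivAt (primF α)
      (val2 α β primB / (360360 * 41472 * (α * β * (1 - α) * (1 - β)) ^ 6)
        + val2 α β primC / (360360 * 165888 * (4 * β * (1 - α)) ^ 6)) β := by
  have h1 : HasDerivAt (fun β => val2 α β polyF) (val2 α β (Horner.deriv polyF)) β :=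
    Horner.hasDerivAt_eval (val_val1 α) β polyF
  have h2 : HasDerivAt (fun β : ℝ => 1 - β) (-1) β := by
    simpa using (hasDerivAt_id β).const_sub 1
  have h3 := ((((hasDerivAt_pow 5 β).const_mul (784604620800 : ℝ)).mul_const
    ((1 - α) ^ 6)).mul (h2.pow 5))
  have h4 := Real.hasDerivAt_log hb.ne'
  have h5 := h2.log hb'.ne'
  have h6 := ((h1.div h3 (by simp only [Pi.mul_apply, Pi.pow_apply]; positivity)).add
    (h4.const_mul (val1 α polyLogB / (784604620800 * (1 - α) ^ 6)))).sub
    (h5.const_mul (val1 α polyLogC / (784604620800 * (1 - α) ^ 6)))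
  refine h6.congr_deriv ?_
  have h := val_val2 α β
  have hc := h.eq_of_isz isz_deriv_polyF
  simp only [h.add, h.mul, h.cst, h.pw, h.sb, val2_C, val1_X, val2_X] at hc
  push_cast at hc
  simp only [Pi.pow_apply, Pi.mul_apply]
  generalize val2 α β polyF = F at *
  generalize val2 α β (Horner.deriv polyF) = F' at *
  generalize val1 α polyLogB = PB at *
  generalize val1 α polyLogC = PC at *
  have hB : val2 α β primB = (32768 * (α ^ 6 * (F' * (β * (1 - β)) + -5 * (F * (1 - 2 * β))
      + PB * (β ^ 5 * (1 - β) ^ 6) + PC * (β ^ 6 * (1 - β) ^ 5))) / 105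
      - α ^ 6 * ((1 - β) ^ 6 * val2 α β primC)) / 16384 := by
    rw [hc]
    ring
  rw [hB]
  field_simp
  ring

theorem primF_sub (α : ℝ) (h0 : 0 < α) (h1 : 0 < 1 - α) :
    primF α (1 - α) - primF α α
      = (val1 α (Horner.sub (R := H1) (sb (cst 1) .X) polyF)
          - val1 α (Horner.sub (R := H1) .X polyF)) / (784604620800 * α ^ 5 * (1 - α) ^ 11)
        + (val1 α polyLogB + val1 α polyLogC) / (784604620800 * (1 - α) ^ 6)
          * (Real.log (1 - α) - Real.log α) := by
  have h := val_val1 α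
  have e1 : val1 α (Horner.sub (R := H1) (sb (cst 1) .X) polyF) = val2 α (1 - α) polyF := by
    refine (Horner.map_sub h (sb (cst 1) .X) polyF).trans ?_
    rw [h.sb, h.cst, val1_X, Int.cast_one]
    rfl
  have e2 : val1 α (Horner.sub (R := H1) .X polyF) = val2 α α polyF := by
    refine (Horner.map_sub h .X polyF).trans ?_
    rw [val1_X]
    rfl
  rw [e1, e2, primF, primF, show 1 - (1 - α) = α by ring]
  field_simp
  ring

theorem hasDerivAt_primK {M : ℝ → ℝ} {α : ℝ} (h0 : 0 < α) (h1 : 0 < 1 - α)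
    (hM : HasDerivAt M ((Real.log (1 - α) - Real.log α) / (1 - α)) α) :
    HasDerivAt (fun α => val1 α polyS / (11769069312000 * (1 - α) ^ 5)
        * (Real.log (1 - α) - Real.log α) + val1 α polyQ / (11769069312000 * (1 - α) ^ 10)
        + 104320327 / 233513280 * M α) (primF α (1 - α) - primF α α) α := by
  have hS : HasDerivAt (fun α => val1 α polyS) (val1 α (Horner.deriv polyS)) α :=
    Horner.hasDerivAt_eval valInt α polyS
  have hQ : HasDerivAt (fun α => val1 α polyQ) (val1 α (Horner.deriv polyQ)) α :=
    Horner.hasDerivAt_eval valInt α polyQ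
  have h2 : HasDerivAt (fun β : ℝ => 1 - β) (-1) α := by
    simpa using (hasDerivAt_id α).const_sub 1
  have hl := (h2.log h1.ne').sub (Real.hasDerivAt_log h0.ne')
  have h3 := (h2.pow 5).const_mul (11769069312000 : ℝ)
  have h4 := (h2.pow 10).const_mul (11769069312000 : ℝ)
  refine (((((hS.div h3 (by simp only [Pi.pow_apply]; positivity)).mul hl).add
    (hQ.div h4 (by simp only [Pi.pow_apply]; positivity)))).add
    (hM.const_mul (104320327 / 233513280))).congr_deriv ?_
  rw [primF_sub α h0 h1]
  have h := val_val1 α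
  have c1 := h.eq_of_isz isz_deriv_polyS
  have c2 := h.eq_of_isz isz_deriv_polyQ
  simp only [h.add, h.mul, h.cst, h.pw, h.sb, val1_X] at c1 c2
  push_cast at c1 c2
  simp only [Pi.pow_apply, Pi.sub_apply, Pi.div_apply]
  generalize val1 α (Horner.sub (R := H1) (sb (cst 1) .X) polyF) = F1 at *
  generalize val1 α (Horner.sub (R := H1) .X polyF) = F2 at *
  generalize val1 α polyS = S at *
  generalize val1 α polyQ = Q at *
  generalize val1 α polyLogB = PB at *
  generalize val1 α polyLogC = PC at *
  generalize val1 α (Horner.deriv polyS) = S' at *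
  generalize val1 α (Horner.deriv polyQ) = Q' at *
  generalize Real.log (1 - α) - Real.log α = l at *
  obtain rfl : PB = (S' * (1 - α) + 5 * S + 104320327 * 50400 * (1 - α) ^ 5) / 15 - PC := by
    linarith
  obtain rfl : F1 = (α ^ 5 * (Q' * (1 - α) + 10 * Q) - α ^ 4 * (1 - α) ^ 5 * S) / 15 + F2 := by
    linarith
  field_simp
  ring

theorem lintegral_BC
    (hB : ∀ α β, 0 < α → α < β → β < 1 - α → ∀ r ∈ Ioo 0 α,
      0 ≤ meanDistB α β r * cornerDetB α β r)
    (hC : ∀ α β, 0 < α → α < β → β < 1 - α → ∀ r ∈ Ioo 0 ((β - α) / 2),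
      0 ≤ meanDistC α β r * cornerDetC α β r) :
    ∫⁻ α in Ioo (0 : ℝ) (1 / 2), ∫⁻ β in Ioo α (1 - α),
      ((∫⁻ r in Ioo 0 α, ENNReal.ofReal (meanDistB α β r * cornerDetB α β r))
        + ∫⁻ r in Ioo 0 ((β - α) / 2), ENNReal.ofReal (meanDistC α β r * cornerDetC α β r))
      = ENNReal.ofReal (-61702559 / 218700 / 768 + 104320327 / 3648645 / 768 * Real.pi ^ 2) := by
  obtain ⟨M, hM, hM0, hM1⟩ := exists_primitive_log_div
  have inner : ∀ α ∈ Ioo (0 : ℝ) (1 / 2), 0 ≤ primF α (1 - α) - primF α α ∧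
      ∫⁻ β in Ioo α (1 - α),
      ((∫⁻ r in Ioo 0 α, ENNReal.ofReal (meanDistB α β r * cornerDetB α β r))
        + ∫⁻ r in Ioo 0 ((β - α) / 2), ENNReal.ofReal (meanDistC α β r * cornerDetC α β r))
        = ENNReal.ofReal (primF α (1 - α) - primF α α) := by
    rintro α ⟨h0, h1⟩
    have e : ∀ β ∈ Ioo α (1 - α),
        0 ≤ (val2 α β primB / (360360 * 41472 * (α * β * (1 - α) * (1 - β)) ^ 6)
          + val2 α β primC / (360360 * 165888 * (4 * β * (1 - α)) ^ 6)) ∧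
        ((∫⁻ r in Ioo 0 α, ENNReal.ofReal (meanDistB α β r * cornerDetB α β r))
        + ∫⁻ r in Ioo 0 ((β - α) / 2), ENNReal.ofReal (meanDistC α β r * cornerDetC α β r))
        = ENNReal.ofReal (val2 α β primB / (360360 * 41472 * (α * β * (1 - α) * (1 - β)) ^ 6)
          + val2 α β primC / (360360 * 165888 * (4 * β * (1 - α)) ^ 6)) := by
      rintro β ⟨h2, h3⟩
      have b := lintegral_B h0 h2 h3 (hB α β h0 h2 h3)
      have c := lintegral_C h0 h2 h3 (hC α β h0 h2 h3)
      exact ⟨add_nonneg b.1 c.1, by rw [b.2, c.2, ENNReal.ofReal_add b.1 c.1]⟩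
    rw [setLIntegral_congr_fun measurableSet_Ioo fun β hβ => (e β hβ).2]
    exact lintegral_Ioo_of_hasDerivAt_Icc (by linarith) (fun β hβ => hasDerivAt_primF h0
      (by linarith) (h0.trans_le hβ.1) (by linarith [hβ.2])) fun β hβ => (e β hβ).1
  rw [setLIntegral_congr_fun measurableSet_Ioo fun α hα => (inner α hα).2]
  have key := lintegral_Ioo_of_hasDerivAt (show (0 : ℝ) < 1 / 2 by norm_num)
    (fun α hα => hasDerivAt_primK (α := α) hα.1 (by linarith [hα.2]) (hM α hα))
    (fun α hα => (inner α hα).1) (A := 0)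
    (B := -61702559 / 218700 / 768 + 104320327 / 3648645 / 768 * Real.pi ^ 2) ?_ ?_
  · rw [key.2, sub_zero]
  · have cS : Continuous fun α => Horner.evalAux (fun z : ℤ => (z : ℝ)) α (List.tail polyS) :=
      continuous_iff_continuousAt.2 fun α =>
        (Horner.hasDerivAt_evalAux valInt α (List.tail polyS)).continuousAt
    have cQ : Continuous fun α => val1 α polyQ :=
      continuous_iff_continuousAt.2 fun α => (Horner.hasDerivAt_eval valInt α polyQ).continuousAt
    have eS : ∀ α, val1 α polyS
        = α * Horner.evalAux (fun z : ℤ => (z : ℝ)) α (List.tail polyS) := by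
      intro α
      simp [val1, Horner.eval, polyS, Horner.evalAux]
    have t1 : Tendsto (fun α : ℝ => α * (Real.log (1 - α) - Real.log α)) (𝓝[>] 0) (𝓝 0) := by
      have h1 : ContinuousAt (fun α : ℝ => α * Real.log (1 - α)) 0 := by
        fun_prop (disch := norm_num)
      have h2 := (h1.tendsto.mono_left nhdsWithin_le_nhds).sub (tendsto_pow_mul_log_zero 0)
      simpa [mul_sub] using h2
    have t2 : Tendsto (fun α : ℝ => Horner.evalAux (fun z : ℤ => (z : ℝ)) α (List.tail polyS)
        / (11769069312000 * (1 - α) ^ 5)) (𝓝[>] 0) (𝓝 (Horner.evalAux (fun z : ℤ => (z : ℝ)) 0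
        (List.tail polyS) / (11769069312000 * (1 - 0) ^ 5))) :=
      (cS.continuousAt.div (by fun_prop) (by norm_num)).tendsto.mono_left nhdsWithin_le_nhds
    have t3 : Tendsto (fun α : ℝ => val1 α polyQ / (11769069312000 * (1 - α) ^ 10))
        (𝓝[>] 0) (𝓝 (val1 0 polyQ / (11769069312000 * (1 - 0) ^ 10))) :=
      (cQ.continuousAt.div (by fun_prop) (by norm_num)).tendsto.mono_left nhdsWithin_le_nhds
    have q0 : val1 0 polyQ = 0 := by simp [val1, Horner.eval, polyQ, Horner.evalAux]
    have := ((t2.mul t1).add t3).add (hM0.const_mul (104320327 / 233513280))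
    rw [q0] at this
    simp only [mul_zero, zero_div, add_zero] at this
    refine this.congr fun α => ?_
    rw [eS]
    ring
  · have cS : Continuous fun α => val1 α polyS :=
      continuous_iff_continuousAt.2 fun α => (Horner.hasDerivAt_eval valInt α polyS).continuousAt
    have cQ : Continuous fun α => val1 α polyQ :=
      continuous_iff_continuousAt.2 fun α => (Horner.hasDerivAt_eval valInt α polyQ).continuousAt
    have h1 : ContinuousAt (fun α : ℝ => val1 α polyS / (11769069312000 * (1 - α) ^ 5)
        * (Real.log (1 - α) - Real.log α)) (1 / 2) :=
      (cS.continuousAt.div (by fun_prop) (by norm_num)).mul (by fun_prop (disch := norm_num))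
    have h2 : ContinuousAt (fun α : ℝ => val1 α polyQ / (11769069312000 * (1 - α) ^ 10)) (1 / 2) :=
      cQ.continuousAt.div (by fun_prop) (by norm_num)
    have := ((h1.tendsto.add h2.tendsto).mono_left nhdsWithin_le_nhds).add
      (hM1.const_mul (104320327 / 233513280))
    have q : val1 (1 / 2) polyQ = -61702559 / 218700 / 768 * (11769069312000 * (1 - 1 / 2) ^ 10) := by
      simp only [val1, Horner.eval, polyQ, Horner.evalAux]
      norm_num
    have l : Real.log (1 - 1 / 2) - Real.log (1 / 2) = 0 := by norm_num
    rw [q, l] at this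
    convert this using 2
    ring

noncomputable def meanDistA (b c t : ℝ) : ℝ :=
  4 / 3 * t + (1 - t) ^ 4 / (3 * (1 - b ^ 2) * (1 - c ^ 2))

noncomputable def gramDetA (b c t : ℝ) : ℝ :=
  2 / 27 * (3 + b ^ 2 + c ^ 2 - b ^ 2 * c ^ 2) * (1 - t) ^ 10
    / ((1 - b ^ 2) ^ 5 * (1 - c ^ 2) ^ 5)

/-- The primitive of `1 / (1 - x ^ 2) ^ (k + 1)` vanishing at `0`. -/
noncomputable def primInvPow : ℕ → ℝ → ℝ
  | 0, x => (Real.log (1 + x) - Real.log (1 - x)) / 2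
  | k + 1, x => x / (2 * (k + 1) * (1 - x ^ 2) ^ (k + 1))
      + (2 * k + 1) / (2 * (k + 1)) * primInvPow k x

theorem primInvPow_zero_right (k : ℕ) : primInvPow k 0 = 0 := by
  induction k with
  | zero => simp [primInvPow]
  | succ k ih => simp [primInvPow, ih]

theorem hasDerivAt_primInvPow (k : ℕ) {x : ℝ} (h0 : 0 < 1 + x) (h1 : 0 < 1 - x) :
    HasDerivAt (primInvPow k) (1 / (1 - x ^ 2) ^ (k + 1)) x := by
  have h2 : 0 < 1 - x ^ 2 := by nlinarith
  induction k with
  | zero =>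
    have e1 : HasDerivAt (fun x : ℝ => 1 + x) 1 x := (hasDerivAt_id x).const_add 1
    have e2 : HasDerivAt (fun x : ℝ => 1 - x) (-1) x := by
      simpa using (hasDerivAt_id x).const_sub 1
    refine (((e1.log h0.ne').sub (e2.log h1.ne')).div_const 2).congr_deriv ?_
    rw [zero_add, pow_one]
    field_simp
    ring
  | succ k ih =>
    have e1 : HasDerivAt (fun x : ℝ => 1 - x ^ 2) (-(2 * x)) x := by
      simpa using (hasDerivAt_pow 2 x).const_sub 1
    have e2 := (hasDerivAt_id x).div ((e1.pow (k + 1)).const_mul (2 * (k + 1 : ℝ)))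
      (by simp only [Pi.pow_apply]; positivity)
    refine (e2.add (ih.const_mul ((2 * k + 1 : ℝ) / (2 * (k + 1))))).congr_deriv ?_
    have : (k + 1 : ℝ) ≠ 0 := by positivity
    simp only [Pi.pow_apply, id, add_tsub_cancel_right]
    push_cast
    field_simp
    ring

theorem lintegral_A_inner {b c : ℝ} (hc : 0 < c) (hcb : c < b) (hb : b < 1) :
    ∫⁻ t in Ioo b 1, ENNReal.ofReal (meanDistA b c t * gramDetA b c t)
      = ENNReal.ofReal (2 / 27 * (3 + b ^ 2 + c ^ 2 - b ^ 2 * c ^ 2)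
        * ((1 - b) ^ 9 / (45 * (1 + b) ^ 6 * (1 - c ^ 2) ^ 6)
          + (1 - b) ^ 6 * (1 + 11 * b) / (99 * (1 + b) ^ 5 * (1 - c ^ 2) ^ 5))) := by
  have h1 : 0 < 1 - b := by linarith
  have h1' : 0 < 1 + b := by linarith
  have hb2 : 0 < 1 - b ^ 2 := by nlinarith
  have hc2 : 0 < 1 - c ^ 2 := by nlinarith
  have h := lintegral_Ioo_of_hasDerivAt_Icc (a := b) (b := 1)
    (f := fun t => meanDistA b c t * gramDetA b c t)
    (F := fun t => 2 / 27 * (3 + b ^ 2 + c ^ 2 - b ^ 2 * c ^ 2)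
      / ((1 - b ^ 2) ^ 5 * (1 - c ^ 2) ^ 5) * (4 / 3 * ((1 - t) ^ 12 / 12 - (1 - t) ^ 11 / 11)
        - (1 - t) ^ 15 / (45 * (1 - b ^ 2) * (1 - c ^ 2)))) hb ?_ ?_
  · rw [h.2]
    congr 1
    rw [show 1 - b ^ 2 = (1 - b) * (1 + b) by ring]
    field_simp
    ring
  · intro t _
    have e : HasDerivAt (fun t : ℝ => 1 - t) (-1) t := by
      simpa using (hasDerivAt_id t).const_sub 1
    refine ((((((e.pow 12).div_const 12).sub ((e.pow 11).div_const 11)).const_mul (4 / 3)).sub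
      ((e.pow 15).div_const (45 * (1 - b ^ 2) * (1 - c ^ 2)))).const_mul _).congr_deriv ?_
    rw [meanDistA, gramDetA]
    field_simp
    ring
  · rintro t ⟨h2, h3⟩
    have : 0 < t := by linarith
    have : 0 ≤ 3 + b ^ 2 + c ^ 2 - b ^ 2 * c ^ 2 := by nlinarith [sq_nonneg b]
    rw [meanDistA, gramDetA]
    have : 0 ≤ 1 - t := by linarith
    positivity

theorem lintegral_A_middle {b : ℝ} (h0 : 0 < b) (hb : b < 1) :
    0 ≤ 2 / 27 * (1 - b) ^ 9 / (45 * (1 + b) ^ 6)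
        * (4 * primInvPow 5 b - (1 - b ^ 2) * primInvPow 4 b)
      + 2 / 27 * (1 - b) ^ 6 * (1 + 11 * b) / (99 * (1 + b) ^ 5)
        * (4 * primInvPow 4 b - (1 - b ^ 2) * primInvPow 3 b) ∧
    ∫⁻ c in Ioo 0 b, ∫⁻ t in Ioo b 1, ENNReal.ofReal (meanDistA b c t * gramDetA b c t)
      = ENNReal.ofReal (2 / 27 * (1 - b) ^ 9 / (45 * (1 + b) ^ 6)
        * (4 * primInvPow 5 b - (1 - b ^ 2) * primInvPow 4 b)
      + 2 / 27 * (1 - b) ^ 6 * (1 + 11 * b) / (99 * (1 + b) ^ 5)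
        * (4 * primInvPow 4 b - (1 - b ^ 2) * primInvPow 3 b)) := by
  have h1 : 0 < 1 - b := by linarith
  have h := lintegral_Ioo_of_hasDerivAt_Icc (a := 0) (b := b)
    (f := fun c => 2 / 27 * (3 + b ^ 2 + c ^ 2 - b ^ 2 * c ^ 2)
        * ((1 - b) ^ 9 / (45 * (1 + b) ^ 6 * (1 - c ^ 2) ^ 6)
          + (1 - b) ^ 6 * (1 + 11 * b) / (99 * (1 + b) ^ 5 * (1 - c ^ 2) ^ 5)))
    (F := fun c => 2 / 27 * (1 - b) ^ 9 / (45 * (1 + b) ^ 6)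
        * (4 * primInvPow 5 c - (1 - b ^ 2) * primInvPow 4 c)
      + 2 / 27 * (1 - b) ^ 6 * (1 + 11 * b) / (99 * (1 + b) ^ 5)
        * (4 * primInvPow 4 c - (1 - b ^ 2) * primInvPow 3 c)) h0 ?_ ?_
  · rw [setLIntegral_congr_fun measurableSet_Ioo fun c hc => lintegral_A_inner hc.1 hc.2 hb]
    simpa [primInvPow_zero_right] using h
  · rintro c ⟨h2, h3⟩
    have h4 : 0 < 1 + c := by linarith
    have h5 : 0 < 1 - c := by linarith
    have hc2 : 0 < 1 - c ^ 2 := by nlinarith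
    have d := fun k => hasDerivAt_primInvPow k h4 h5
    refine (((((d 5).const_mul 4).sub ((d 4).const_mul (1 - b ^ 2))).const_mul _).add
      ((((d 4).const_mul 4).sub ((d 3).const_mul (1 - b ^ 2))).const_mul _)).congr_deriv ?_
    field_simp
    ring
  · rintro c ⟨h2, h3⟩
    have hc2 : 0 < 1 - c ^ 2 := by nlinarith
    have : 0 ≤ 3 + b ^ 2 + c ^ 2 - b ^ 2 * c ^ 2 := by nlinarith [sq_nonneg b]
    positivity

def polyLogA : H1 := ([-3811365690, -17368979490, -30739211115, -25778935590, -9556876590, -804854850, 99368400, -19032450, 3775800, -544500, 28875] : List ℤ)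

def polyA : H1 := ([0, 7622731380, 70730188500, 292413164710, 707364058900, 1104265781736, 1155026886840, 810981260010, 369813851880, 100110784180, 12562675204, 85119450, -13589500, 3503600, -858000, 57750] : List ℤ)

theorem isz_deriv_polyLogA : isz (
  let b : H1 := .X
  let p : H1 := sb (cst 1) b
  let q : H1 := (cst 1 : H1) + b
  let S : H1 := p * polyLogA
  sb (Horner.deriv polyLogA * (p * q) + cst (-1) * (polyLogA * q) + cst (-5) * S
      + cst (-5498539200) * pw q 5)
    (cst 4950 * pw p 9 * (sb (cst 126) (cst 35 * (p * q)))
      + cst 45000 * pw p 6 * ((cst 1 : H1) + cst 11 * b) * q * (sb (cst 7) (cst 2 * (p * q))))) = true := by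
  decide +kernel

theorem isz_deriv_polyA : isz (
  let b : H1 := .X
  let p : H1 := sb (cst 1) b
  let q : H1 := (cst 1 : H1) + b
  let p6 : H1 := b * (cst (2895) + cst (-7110) * pw b 2 + cst (8064) * pw b 4 + cst (-4410) * pw b 6 + cst (945) * pw b 8)
  let p5 : H1 := b * (cst (2790) + cst (-5110) * pw b 2 + cst (3850) * pw b 4 + cst (-1050) * pw b 6)
  let p4 : H1 := b * (cst (2640) + cst (-3200) * pw b 2 + cst (1200) * pw b 4)
  sb (Horner.deriv polyA * q + cst (-10) * polyA + cst 2 * polyLogA * pw q 5)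
    (cst 330 * pw p 4 * (sb (cst 4 * p6) (pw (p * q) 2 * p5))
      + cst 150 * pw p 2 * ((cst 1 : H1) + cst 11 * b) * pw q 2
        * (sb (cst 4 * p5) (pw (p * q) 2 * p4)))) = true := by
  decide +kernel

theorem hasDerivAt_primA {M : ℝ → ℝ} {b : ℝ} (h0 : 0 < b) (h1 : 0 < 1 - b)
    (hM : HasDerivAt M
      ((Real.log (1 - (1 - b) / 2) - Real.log ((1 - b) / 2)) / (1 - (1 - b) / 2)) ((1 - b) / 2)) :
    HasDerivAt (fun b => val1 b polyA / (769824000 * (1 + b) ^ 10)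
      + (1 - b) * val1 b polyLogA / (769824000 * (1 + b) ^ 5) * (Real.log (1 + b) - Real.log (1 - b))
      + 3857 / 540 * M ((1 - b) / 2))
      (2 / 27 * (1 - b) ^ 9 / (45 * (1 + b) ^ 6)
        * (4 * primInvPow 5 b - (1 - b ^ 2) * primInvPow 4 b)
      + 2 / 27 * (1 - b) ^ 6 * (1 + 11 * b) / (99 * (1 + b) ^ 5)
        * (4 * primInvPow 4 b - (1 - b ^ 2) * primInvPow 3 b)) b := by
  have h2 : 0 < 1 + b := by linarith
  have e1 : HasDerivAt (fun b : ℝ => 1 - b) (-1) b := by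
    simpa using (hasDerivAt_id b).const_sub 1
  have e2 : HasDerivAt (fun b : ℝ => 1 + b) 1 b := (hasDerivAt_id b).const_add 1
  have hT : HasDerivAt (fun b => val1 b polyLogA) (val1 b (Horner.deriv polyLogA)) b :=
    Horner.hasDerivAt_eval valInt b polyLogA
  have hQ : HasDerivAt (fun b => val1 b polyA) (val1 b (Horner.deriv polyA)) b :=
    Horner.hasDerivAt_eval valInt b polyA
  have hl := (e2.log h2.ne').sub (e1.log h1.ne')
  have h3 := (e2.pow 5).const_mul (769824000 : ℝ)
  have h4 := (e2.pow 10).const_mul (769824000 : ℝ)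
  refine (((hQ.div h4 (by simp only [Pi.pow_apply]; positivity)).add
    (((e1.mul hT).div h3 (by simp only [Pi.pow_apply]; positivity)).mul hl)).add
    ((hM.comp b (e1.div_const 2)).const_mul (3857 / 540))).congr_deriv ?_
  have hm : (Real.log (1 - (1 - b) / 2) - Real.log ((1 - b) / 2)) / (1 - (1 - b) / 2)
      = 2 * (Real.log (1 + b) - Real.log (1 - b)) / (1 + b) := by
    rw [show 1 - (1 - b) / 2 = (1 + b) / 2 by ring, Real.log_div h2.ne' two_ne_zero,
      Real.log_div h1.ne' two_ne_zero]
    field_simp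
    ring
  rw [hm]
  have h := val_val1 b
  have c1 := h.eq_of_isz isz_deriv_polyLogA
  have c2 := h.eq_of_isz isz_deriv_polyA
  simp only [h.add, h.mul, h.cst, h.pw, h.sb, val1_X] at c1 c2
  push_cast at c1 c2
  simp only [Pi.pow_apply, Pi.mul_apply, Pi.div_apply, Pi.sub_apply]
  simp only [primInvPow]
  push_cast
  generalize Real.log (1 + b) - Real.log (1 - b) = L at *
  generalize val1 b polyLogA = T at *
  generalize val1 b polyA = Q at *
  generalize val1 b (Horner.deriv polyA) = Q' at *
  generalize val1 b (Horner.deriv polyLogA) = T' at *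
  rw [show 1 - b ^ 2 = (1 - b) * (1 + b) by ring]
  obtain rfl : Q' = (10 * Q - 2 * (T * (1 + b) ^ 5) + (330 * (1 - b) ^ 4
      * (4 * (b * ((2895) + (-7110) * b ^ 2 + (8064) * b ^ 4 + (-4410) * b ^ 6 + (945) * b ^ 8)) - ((1 - b) * (1 + b)) ^ 2 * (b * ((2790) + (-5110) * b ^ 2 + (3850) * b ^ 4 + (-1050) * b ^ 6)))
      + 150 * (1 - b) ^ 2 * (1 + 11 * b) * (1 + b) ^ 2
      * (4 * (b * ((2790) + (-5110) * b ^ 2 + (3850) * b ^ 4 + (-1050) * b ^ 6)) - ((1 - b) * (1 + b)) ^ 2 * (b * ((2640) + (-3200) * b ^ 2 + (1200) * b ^ 4))))) / (1 + b) := by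
    rw [eq_div_iff h2.ne']
    linear_combination c2
  obtain rfl : T' = (T * (1 + b) + 5 * ((1 - b) * T) + 5498539200 * (1 + b) ^ 5
      + 4950 * (1 - b) ^ 9 * (126 - 35 * ((1 - b) * (1 + b)))
      + 45000 * (1 - b) ^ 6 * (1 + 11 * b) * (1 + b) * (7 - 2 * ((1 - b) * (1 + b))))
      / ((1 - b) * (1 + b)) := by
    rw [eq_div_iff (mul_pos h1 h2).ne']
    linear_combination c1
  clear c1 c2
  field_simp
  ring

theorem lintegral_A :
    ∫⁻ b in Ioo (0 : ℝ) 1, ∫⁻ c in Ioo 0 b, ∫⁻ t in Ioo b 1,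
      ENNReal.ofReal (meanDistA b c t * gramDetA b c t)
      = ENNReal.ofReal (5139122 / 18225 / 48 - 3857 / 135 / 48 * Real.pi ^ 2) := by
  obtain ⟨M, hM, hM0, hM1⟩ := exists_primitive_log_div
  rw [setLIntegral_congr_fun measurableSet_Ioo fun b hb => (lintegral_A_middle hb.1 hb.2).2]
  have cT : Continuous fun b => val1 b polyLogA :=
    continuous_iff_continuousAt.2 fun b => (Horner.hasDerivAt_eval valInt b polyLogA).continuousAt
  have cQ : Continuous fun b => val1 b polyA :=
    continuous_iff_continuousAt.2 fun b => (Horner.hasDerivAt_eval valInt b polyA).continuousAt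
  have key := lintegral_Ioo_of_hasDerivAt zero_lt_one
    (fun b hb => hasDerivAt_primA (b := b) hb.1 (by linarith [hb.2])
      (hM _ ⟨by linarith [hb.2], by linarith [hb.1]⟩))
    (fun b hb => (lintegral_A_middle hb.1 hb.2).1) (A := 3857 / 540 * (Real.pi ^ 2 / 12))
    (B := 5139122 / 18225 / 48) ?_ ?_
  · rw [key.2]
    congr 1
    ring
  · have t1 : ContinuousAt (fun b : ℝ => val1 b polyA / (769824000 * (1 + b) ^ 10)
      + (1 - b) * val1 b polyLogA / (769824000 * (1 + b) ^ 5)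
        * (Real.log (1 + b) - Real.log (1 - b))) 0 := by
      refine (cQ.continuousAt.div (by fun_prop) (by norm_num)).add ?_
      refine ContinuousAt.mul (ContinuousAt.div ?_ (by fun_prop) (by norm_num)) ?_
      · exact (by fun_prop : Continuous fun b : ℝ => 1 - b).continuousAt.mul cT.continuousAt
      · fun_prop (disch := norm_num)
    have t2 : Tendsto (fun b : ℝ => M ((1 - b) / 2)) (𝓝[>] 0) (𝓝 (Real.pi ^ 2 / 12)) := by
      refine hM1.comp (tendsto_nhdsWithin_iff.2 ⟨?_, ?_⟩)
      · have : Continuous fun b : ℝ => (1 - b) / 2 := by fun_prop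
        simpa using this.continuousAt (x := 0) |>.tendsto.mono_left
          (nhdsWithin_le_nhds (s := Ioi 0))
      · filter_upwards [self_mem_nhdsWithin] with b hb
        have : 0 < b := hb
        change (1 - b) / 2 < 1 / 2
        linarith
    have := (t1.tendsto.mono_left nhdsWithin_le_nhds).add (t2.const_mul (3857 / 540))
    have q0 : val1 0 polyA = 0 := by simp [val1, Horner.eval, polyA, Horner.evalAux]
    rw [q0] at this
    simpa using this
  · have t1 : ContinuousAt (fun b : ℝ => val1 b polyA / (769824000 * (1 + b) ^ 10)) 1 :=
      cQ.continuousAt.div (by fun_prop) (by norm_num)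
    have t3 : ContinuousAt (fun b : ℝ => val1 b polyLogA / (769824000 * (1 + b) ^ 5)) 1 :=
      cT.continuousAt.div (by fun_prop) (by norm_num)
    have t4 : Tendsto (fun b : ℝ => (1 - b) * (Real.log (1 + b) - Real.log (1 - b)))
        (𝓝[<] 1) (𝓝 0) := by
      have h1 : ContinuousAt (fun b : ℝ => (1 - b) * Real.log (1 + b)) 1 := by
        fun_prop (disch := norm_num)
      have h2 : Tendsto (fun b : ℝ => 1 - b) (𝓝[<] 1) (𝓝[>] 0) := by
        refine tendsto_nhdsWithin_iff.2 ⟨?_, ?_⟩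
        · have : Continuous fun b : ℝ => 1 - b := by fun_prop
          simpa using this.continuousAt (x := 1) |>.tendsto.mono_left
            (nhdsWithin_le_nhds (s := Iio 1))
        · filter_upwards [self_mem_nhdsWithin] with b hb
          have : b < 1 := hb
          change 0 < 1 - b
          linarith
      have h3 := (h1.tendsto.mono_left nhdsWithin_le_nhds).sub
        ((tendsto_pow_mul_log_zero 0).comp h2)
      simpa [mul_sub] using h3
    have t2 : Tendsto (fun b : ℝ => M ((1 - b) / 2)) (𝓝[<] 1) (𝓝 0) := by
      refine hM0.comp (tendsto_nhdsWithin_iff.2 ⟨?_, ?_⟩)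
      · have : Continuous fun b : ℝ => (1 - b) / 2 := by fun_prop
        simpa using this.continuousAt (x := 1) |>.tendsto.mono_left
          (nhdsWithin_le_nhds (s := Iio 1))
      · filter_upwards [self_mem_nhdsWithin] with b hb
        have : b < 1 := hb
        change 0 < (1 - b) / 2
        linarith
    have := ((t1.tendsto.mono_left nhdsWithin_le_nhds).add
      ((t3.tendsto.mono_left nhdsWithin_le_nhds).mul t4)).add (t2.const_mul (3857 / 540))
    have q : val1 1 polyA = 5139122 / 18225 / 48 * (769824000 * (1 + 1) ^ 10) := by
      simp only [val1, Horner.eval, polyA, Horner.evalAux]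
      norm_num
    rw [q] at this
    have e : (5139122 / 18225 / 48 * (769824000 * (1 + 1) ^ 10) / (769824000 * (1 + 1) ^ 10)
        + val1 1 polyLogA / (769824000 * (1 + 1) ^ 5) * 0 + 3857 / 540 * 0 : ℝ)
        = 5139122 / 18225 / 48 := by
      norm_num
    rw [e] at this
    refine this.congr fun b => ?_
    ring

end

section

open MeasureTheory Set

/-- A triple of points as an element of an iterated product. -/
def finThreeArrowEquiv (α : Type*) [MeasurableSpace α] : (Fin 3 → α) ≃ᵐ α × α × α :=
  (MeasurableEquiv.piFinSuccAbove (fun _ : Fin 3 => α) 0).trans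
    ((MeasurableEquiv.refl α).prodCongr (MeasurableEquiv.piFinTwo fun _ => α))

theorem finThreeArrowEquiv_apply {α : Type*} [MeasurableSpace α] (x : Fin 3 → α) :
    finThreeArrowEquiv α x = (x 0, x 1, x 2) := rfl

theorem finThreeArrowEquiv_symm_apply {α : Type*} [MeasurableSpace α] (p : α × α × α) :
    (finThreeArrowEquiv α).symm p = ![p.1, p.2.1, p.2.2] := by
  rw [MeasurableEquiv.symm_apply_eq, finThreeArrowEquiv_apply]
  rfl

theorem volume_preserving_finThreeArrowEquiv (α : Type*) [MeasureSpace α]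
    [SigmaFinite (volume : Measure α)] :
    MeasurePreserving (finThreeArrowEquiv α) :=
  (volume_preserving_piFinSuccAbove (fun _ : Fin 3 => α) 0).trans
    ((MeasurePreserving.id volume).prod (volume_preserving_piFinTwo fun _ => α))

theorem lintegral_volume_prod {α β : Type*} [MeasureSpace α] [MeasureSpace β]
    [SFinite (volume : Measure β)] {f : α × β → ENNReal}
    (hf : Measurable f) : ∫⁻ p, f p = ∫⁻ a, ∫⁻ b, f (a, b) :=
  lintegral_prod f hf.aemeasurable

theorem lintegral_finThree {α : Type*} [MeasureSpace α] [SigmaFinite (volume : Measure α)]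
    {f : (Fin 3 → α) → ENNReal} (hf : Measurable f) :
    ∫⁻ x, f x = ∫⁻ a, ∫⁻ b, ∫⁻ c, f ![a, b, c] := by
  rw [← (volume_preserving_finThreeArrowEquiv α).symm.lintegral_comp_emb
    (MeasurableEquiv.measurableEmbedding _)]
  have hm : Measurable fun p : α × α × α => f ((finThreeArrowEquiv α).symm p) :=
    hf.comp (MeasurableEquiv.measurable _)
  rw [lintegral_volume_prod hm]
  refine lintegral_congr fun a => ?_
  refine (lintegral_volume_prod (hm.comp measurable_prodMk_left)).trans ?_
  refine lintegral_congr fun b => lintegral_congr fun c => ?_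
  rw [Function.comp_apply, finThreeArrowEquiv_symm_apply]

/-- Coordinates on three-dimensional Euclidean space. -/
theorem volume_preserving_coords :
    MeasurePreserving fun X : EuclideanSpace ℝ (Fin 3) => (X 0, X 1, X 2) :=
  (volume_preserving_finThreeArrowEquiv ℝ).comp (PiLp.volume_preserving_ofLp (Fin 3))

theorem volume_corner_simplex :
    volume {X : EuclideanSpace ℝ (Fin 3) | (∀ i, 0 ≤ X i) ∧ ∑ i, X i ≤ 1} = ENNReal.ofReal (1 / 6) := by
  set T : Set (ℝ × ℝ × ℝ) :=
    {p | 0 ≤ p.1 ∧ 0 ≤ p.2.1 ∧ 0 ≤ p.2.2 ∧ p.1 + p.2.1 + p.2.2 ≤ 1} with hT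
  have hTm : MeasurableSet T := by
    refine (IsClosed.measurableSet ?_)
    simp only [hT, ofPred_and]
    refine (isClosed_le ?_ ?_).inter ((isClosed_le ?_ ?_).inter
      ((isClosed_le ?_ ?_).inter (isClosed_le ?_ ?_))) <;> fun_prop
  have e : {X : EuclideanSpace ℝ (Fin 3) | (∀ i, 0 ≤ X i) ∧ ∑ i, X i ≤ 1}
      = (fun X : EuclideanSpace ℝ (Fin 3) => (X 0, X 1, X 2)) ⁻¹' T := by
    ext X
    simp [hT, Fin.forall_fin_succ, Fin.sum_univ_three, and_assoc]
  rw [e, volume_preserving_coords.measure_preimage hTm.nullMeasurableSet,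
    ← lintegral_indicator_one hTm, lintegral_volume_prod (measurable_one.indicator hTm)]
  have h1 : ∀ a b : ℝ, 0 ≤ a → 0 ≤ b → a + b ≤ 1 →
      ∫⁻ c, T.indicator (1 : ℝ × ℝ × ℝ → ENNReal) (a, b, c) = ENNReal.ofReal (1 - a - b) := by
    intro a b ha hb hab
    have : (fun c => T.indicator (1 : ℝ × ℝ × ℝ → ENNReal) (a, b, c))
        = (Icc 0 (1 - a - b)).indicator 1 := by
      ext c
      simp only [indicator, hT, mem_ofPred_eq, mem_Icc]
      refine if_congr ⟨fun h => ⟨h.2.2.1, by linarith [h.2.2.2]⟩,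
        fun h => ⟨ha, hb, h.1, by linarith [h.2]⟩⟩ rfl rfl
    rw [this, lintegral_indicator_one measurableSet_Icc, Real.volume_Icc, sub_zero]
  have h2 : ∀ a b : ℝ, ¬ (0 ≤ a ∧ 0 ≤ b ∧ a + b ≤ 1) →
      ∫⁻ c, T.indicator (1 : ℝ × ℝ × ℝ → ENNReal) (a, b, c) = 0 := by
    intro a b hab
    refine (lintegral_congr fun c => indicator_of_notMem (fun h => hab ?_) _).trans
      lintegral_zero
    exact ⟨h.1, h.2.1, by linarith [h.2.2.1, h.2.2.2]⟩
  have h3 : ∀ a : ℝ, a ∈ Ioo (0 : ℝ) 1 → ∫⁻ b, ∫⁻ c, T.indicator (1 : ℝ × ℝ × ℝ → ENNReal) (a, b, c)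
      = ENNReal.ofReal ((1 - a) ^ 2 / 2) := by
    intro a ha
    have : (fun b => ∫⁻ c, T.indicator (1 : ℝ × ℝ × ℝ → ENNReal) (a, b, c))
        = (Icc 0 (1 - a)).indicator fun b => ENNReal.ofReal (1 - a - b) := by
      ext b
      by_cases hb : b ∈ Icc 0 (1 - a)
      · rw [indicator_of_mem hb, h1 a b ha.1.le hb.1 (by linarith [hb.2])]
      · rw [indicator_of_notMem hb, h2 a b fun h => hb ⟨h.2.1, by linarith [h.2.2]⟩]
    rw [this, lintegral_indicator measurableSet_Icc, ← restrict_Ioo_eq_restrict_Icc,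
      (lintegral_Ioo_of_hasDerivAt_Icc (F := fun b => -(1 - a - b) ^ 2 / 2) (by linarith [ha.2])
        (fun b _ => ?_) fun b hb => by linarith [hb.2]).2]
    · congr 1; ring
    · refine (((((hasDerivAt_id' b).const_sub (1 - a)).pow 2).neg).div_const 2).congr_deriv ?_
      simp
  have h4 : (fun a => ∫⁻ b, ∫⁻ c, T.indicator (1 : ℝ × ℝ × ℝ → ENNReal) (a, b, c))
      =ᵐ[volume] (Ioo 0 1).indicator fun a => ENNReal.ofReal ((1 - a) ^ 2 / 2) := by
    filter_upwards [Measure.ae_ne volume (0 : ℝ), Measure.ae_ne volume (1 : ℝ)] with a ha0 ha1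
    by_cases ha : a ∈ Ioo (0 : ℝ) 1
    · rw [indicator_of_mem ha, h3 a ha]
    · rw [indicator_of_notMem ha]
      refine (lintegral_congr fun b => h2 a b fun h => ha ⟨lt_of_le_of_ne h.1 (Ne.symm ha0),
        lt_of_le_of_ne (by linarith [h.2.1, h.2.2]) ha1⟩).trans lintegral_zero
  have h5 : ∀ a, ∫⁻ y : ℝ × ℝ, T.indicator (1 : ℝ × ℝ × ℝ → ENNReal) (a, y)
      = ∫⁻ b, ∫⁻ c, T.indicator (1 : ℝ × ℝ × ℝ → ENNReal) (a, b, c) := fun a =>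
    lintegral_volume_prod ((measurable_one.indicator hTm).comp measurable_prodMk_left)
  simp_rw [h5]
  rw [lintegral_congr_ae h4, lintegral_indicator measurableSet_Ioo,
    (lintegral_Ioo_of_hasDerivAt_Icc (F := fun a => -(1 - a) ^ 3 / 6) one_pos
        (fun b _ => ?_) fun b hb => by positivity).2]
  · norm_num
  · refine (((((hasDerivAt_id' b).const_sub 1).pow 3).neg).div_const 6).congr_deriv ?_
    simp
    ring

theorem convexHull_corner_simplex :
    convexHull ℝ (insert 0 (Set.range fun i : Fin 3 => EuclideanSpace.single i (1 : ℝ)))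
      = {X : EuclideanSpace ℝ (Fin 3) | (∀ i, 0 ≤ X i) ∧ ∑ i, X i ≤ 1} := by
  apply subset_antisymm
  · refine convexHull_min ?_ ?_
    · rintro _ (rfl | ⟨i, rfl⟩)
      · simp
      · refine ⟨fun j => ?_, ?_⟩
        · simp only [PiLp.single_apply]
          split_ifs <;> norm_num
        · simp [Pi.single_apply]
    · intro x hx y hy a b ha hb hab
      refine ⟨fun i => ?_, ?_⟩
      · have := hx.1 i
        have := hy.1 i
        simp only [PiLp.add_apply, PiLp.smul_apply, smul_eq_mul]
        positivity
      · have h1 := hx.2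
        have h2 := hy.2
        simp only [PiLp.add_apply, PiLp.smul_apply, smul_eq_mul, Finset.sum_add_distrib,
          ← Finset.mul_sum]
        nlinarith
  · intro X hX
    have := (convex_convexHull ℝ
      (insert 0 (Set.range fun i : Fin 3 => EuclideanSpace.single i (1 : ℝ)))).sum_mem
      (t := Finset.univ) (w := fun i : Option (Fin 3) => i.elim (1 - ∑ i, X i) fun i => X i)
      (z := fun i => i.elim 0 fun i => EuclideanSpace.single i (1 : ℝ)) ?_ ?_ ?_
    · convert this using 1
      ext j
      simp [Fintype.sum_option, Pi.single_apply]
    · rintro (_ | i) -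
      · simpa using hX.2
      · exact hX.1 i
    · simp [Fintype.sum_option]
    · rintro (_ | i) -
      · exact subset_convexHull _ _ (mem_insert _ _)
      · exact subset_convexHull _ _ (mem_insert_of_mem _ ⟨i, rfl⟩)

/-- Six times the signed volume of a tetrahedron, in coordinates. -/
def tetraDet (X Y Z W : ℝ × ℝ × ℝ) : ℝ :=
  (W.1 - X.1) * ((Y.2.1 - X.2.1) * (Z.2.2 - X.2.2) - (Z.2.1 - X.2.1) * (Y.2.2 - X.2.2))
  + (W.2.1 - X.2.1) * ((Y.2.2 - X.2.2) * (Z.1 - X.1) - (Z.2.2 - X.2.2) * (Y.1 - X.1))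
  + (W.2.2 - X.2.2) * ((Y.1 - X.1) * (Z.2.1 - X.2.1) - (Z.1 - X.1) * (Y.2.1 - X.2.1))

theorem volume_convexHull_four (X Y Z W : EuclideanSpace ℝ (Fin 3)) :
    volume (convexHull ℝ {X, Y, Z, W}) = ENNReal.ofReal (|tetraDet (X 0, X 1, X 2)
      (Y 0, Y 1, Y 2) (Z 0, Z 1, Z 2) (W 0, W 1, W 2)| / 6) := by
  let b := (EuclideanSpace.basisFun (Fin 3) ℝ).toBasis
  let M : Matrix (Fin 3) (Fin 3) ℝ := Matrix.of fun i j => ![Y i - X i, Z i - X i, W i - X i] j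
  let f := Matrix.toLin b b M
  have hf : ∀ j, f (EuclideanSpace.single j 1) = WithLp.toLp 2 fun i => M i j := by
    intro j
    have h := Matrix.toLin_self b b M j
    have hb : ∀ j, b j = EuclideanSpace.single j 1 := fun j => by simp [b]
    simp only [hb] at h
    rw [h]
    ext i
    simp [Pi.single_apply]
  have e : ({X, Y, Z, W} : Set (EuclideanSpace ℝ (Fin 3)))
      = (fun p => X + p) '' (f '' insert 0 (Set.range fun i : Fin 3 => EuclideanSpace.single i (1 : ℝ))) := by
    rw [image_insert_eq, image_insert_eq, ← range_comp, ← range_comp, map_zero, add_zero]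
    congr 1
    have h3 : ∀ g : Fin 3 → EuclideanSpace ℝ (Fin 3), range g = {g 0, g 1, g 2} := by
      intro g
      ext p
      simp [Fin.exists_fin_succ, eq_comm]
    rw [h3]
    simp only [Function.comp_apply, hf]
    congr 1
    · ext i; simp [M]
    congr 1
    · ext i; simp [M]
    congr 1
    · ext i; simp [M]
  have e2 := (f.image_convexHull (insert 0 (Set.range fun i : Fin 3 =>
    EuclideanSpace.single i (1 : ℝ))))
  have hdet : LinearMap.det f = tetraDet (X 0, X 1, X 2)
      (Y 0, Y 1, Y 2) (Z 0, Z 1, Z 2) (W 0, W 1, W 2) := by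
    rw [LinearMap.det_toLin, Matrix.det_fin_three]
    simp [M, tetraDet]
    ring
  have e3 : convexHull ℝ {X, Y, Z, W} = (fun p => X + p) ''
      (f '' {X : EuclideanSpace ℝ (Fin 3) | (∀ i, 0 ≤ X i) ∧ ∑ i, X i ≤ 1}) := by
    rw [e, ← convexHull_corner_simplex, e2]
    exact (convexHull_vadd (𝕜 := ℝ) X (f '' insert 0
      (Set.range fun i : Fin 3 => EuclideanSpace.single i (1 : ℝ))))
  rw [e3, image_add_left, measure_preimage_add, Measure.addHaar_image_linearMap, hdet,
    volume_corner_simplex, ← ENNReal.ofReal_mul (abs_nonneg _)]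
  congr 1
  ring

theorem convexHull_octahedron :
    convexHull ℝ ((Set.range fun i => EuclideanSpace.single i (1 : ℝ)) ∪
          (Set.range fun i : Fin 3 => -EuclideanSpace.single i (1 : ℝ)))
      = {X : EuclideanSpace ℝ (Fin 3) | |X 0| + |X 1| + |X 2| ≤ 1} := by
  apply subset_antisymm
  · refine convexHull_min ?_ ?_
    · rintro _ (⟨i, rfl⟩ | ⟨i, rfl⟩) <;> fin_cases i <;> simp [Pi.single_apply]
    · intro x hx y hy a b ha hb hab
      have key : ∀ i, |(a • x + b • y) i| ≤ a * |x i| + b * |y i| := by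
        intro i
        refine (abs_add_le _ _).trans_eq ?_
        simp [abs_mul, abs_of_nonneg ha, abs_of_nonneg hb]
      have h0 := key 0
      have h1 := key 1
      have h2 := key 2
      simp only [mem_ofPred_eq] at hx hy ⊢
      nlinarith
  · intro X hX
    simp only [mem_ofPred_eq] at hX
    have := (convex_convexHull ℝ ((Set.range fun i => EuclideanSpace.single i (1 : ℝ)) ∪
          (Set.range fun i : Fin 3 => -EuclideanSpace.single i (1 : ℝ)))).sum_mem
      (t := Finset.univ) (w := fun i : Fin 3 ⊕ Fin 3 =>
        i.elim (fun i => (|X i| + X i) / 2 + (1 - (|X 0| + |X 1| + |X 2|)) / 6)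
          fun i => (|X i| - X i) / 2 + (1 - (|X 0| + |X 1| + |X 2|)) / 6)
      (z := fun i => i.elim (fun i => EuclideanSpace.single i (1 : ℝ))
        fun i => -EuclideanSpace.single i (1 : ℝ)) ?_ ?_ ?_
    · convert this using 1
      ext j
      simp [Fintype.sum_sum_type, Fin.sum_univ_three, Pi.single_apply]
      fin_cases j <;> simp <;> ring
    · rintro (i | i) - <;>
      · have := neg_abs_le (X i)
        have := le_abs_self (X i)
        simp only [Sum.elim_inl, Sum.elim_inr]
        linarith
    · simp [Fintype.sum_sum_type, Fin.sum_univ_three]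
      ring
    · rintro (i | i) -
      · exact subset_convexHull _ _ (Or.inl ⟨i, rfl⟩)
      · exact subset_convexHull _ _ (Or.inr ⟨i, rfl⟩)

/-- The regular octahedron in coordinates. -/
def octa : Set (ℝ × ℝ × ℝ) := {p | |p.1| + |p.2.1| + |p.2.2| ≤ 1}

theorem isClosed_octa : IsClosed octa := isClosed_le (by fun_prop) (by fun_prop)

theorem measurableSet_octa : MeasurableSet octa := isClosed_octa.measurableSet

@[fun_prop]
theorem continuous_tetraDet {α : Type*} [TopologicalSpace α] {f g h k : α → ℝ × ℝ × ℝ}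
    (hf : Continuous f) (hg : Continuous g) (hh : Continuous h) (hk : Continuous k) :
    Continuous fun a => tetraDet (f a) (g a) (h a) (k a) := by
  unfold tetraDet
  fun_prop

/-- Volume of a tetrahedron given by the coordinates of its vertices. -/
noncomputable def tetraVol (X Y Z W : ℝ × ℝ × ℝ) : ENNReal :=
  ENNReal.ofReal (|tetraDet X Y Z W| / 6)

theorem measurable_tetraVol : Measurable fun p : (ℝ × ℝ × ℝ) × (ℝ × ℝ × ℝ) × (ℝ × ℝ × ℝ) × ℝ × ℝ × ℝ =>
    tetraVol p.1 p.2.1 p.2.2.1 p.2.2.2 := by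
  unfold tetraVol
  exact (ENNReal.continuous_ofReal.comp (by fun_prop)).measurable

theorem measurable_tetraVol_right (X Y Z : ℝ × ℝ × ℝ) : Measurable (tetraVol X Y Z) := by
  unfold tetraVol
  exact (ENNReal.continuous_ofReal.comp (by fun_prop)).measurable

theorem volume_octahedron :
    volume {X : EuclideanSpace ℝ (Fin 3) | |X 0| + |X 1| + |X 2| ≤ 1} = ENNReal.ofReal (4 / 3) := by
  have h := volume_sum_rpow_le (ι := Fin 3) (p := 1) le_rfl 1
  have e : {X : EuclideanSpace ℝ (Fin 3) | |X 0| + |X 1| + |X 2| ≤ 1} = WithLp.ofLp ⁻¹'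
      {x : Fin 3 → ℝ | (∑ i, |x i| ^ (1 : ℝ)) ^ (1 / (1 : ℝ)) ≤ 1} := by
    ext X
    simp [Fin.sum_univ_three]
  rw [e, (PiLp.volume_preserving_ofLp (Fin 3)).measure_preimage, h]
  · have h4 : Real.Gamma (3 + 1) = 6 := by
      have := Real.Gamma_nat_eq_factorial 3
      push_cast at this
      rw [this]
      norm_num [Nat.factorial]
    have h2 : Real.Gamma (1 + 1) = 1 := by
      have := Real.Gamma_nat_eq_factorial 1
      push_cast at this
      rw [this]
      norm_num
    norm_num [h4, h2] 
  · refine (IsClosed.measurableSet ?_).nullMeasurableSet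
    simp only [Real.rpow_one, div_one]
    exact isClosed_le (by fun_prop) (by fun_prop)

theorem setIntegral_toReal_of_le {α : Type*} [MeasurableSpace α] {μ : Measure α} {S : Set α}
    (hS : MeasurableSet S) {f : α → ENNReal} (hf : Measurable f) {C : ENNReal} (hC : C ≠ ⊤)
    (hfC : ∀ x ∈ S, f x ≤ C) : ∫ x in S, (f x).toReal ∂μ = (∫⁻ x in S, f x ∂μ).toReal :=
  integral_toReal hf.aemeasurable
    ((ae_restrict_iff' hS).2 (Filter.Eventually.of_forall fun x hx => (hfC x hx).trans_lt hC.lt_top))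

theorem setLIntegral_le_mul {α : Type*} [MeasurableSpace α] {μ : Measure α} {S : Set α}
    {f : α → ENNReal} {C : ENNReal} (hS : MeasurableSet S)
    (hfC : ∀ x ∈ S, f x ≤ C) : ∫⁻ x in S, f x ∂μ ≤ C * μ S :=
  (setLIntegral_mono' hS hfC).trans_eq (setLIntegral_const _ _)

theorem measurable_lintegral_four {α : Type*} [MeasurableSpace α] {μ : Measure α} [SFinite μ]
    {f : α → α → α → α → ENNReal}
    (hf : Measurable fun p : α × α × α × α => f p.1 p.2.1 p.2.2.1 p.2.2.2) :
    Measurable fun p : α × α × α => ∫⁻ w, f p.1 p.2.1 p.2.2 w ∂μ :=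
  Measurable.lintegral_prod_right' (f := fun p : (α × α × α) × α => f p.1.1 p.1.2.1 p.1.2.2 p.2)
    (hf.comp (by fun_prop : Measurable fun p : (α × α × α) × α => (p.1.1, p.1.2.1, p.1.2.2, p.2)))

theorem measurable_lintegral_three {α : Type*} [MeasurableSpace α] {μ : Measure α} [SFinite μ]
    {f : α → α → α → ENNReal} (hf : Measurable fun p : α × α × α => f p.1 p.2.1 p.2.2) :
    Measurable fun p : α × α => ∫⁻ w, f p.1 p.2 w ∂μ :=
  Measurable.lintegral_prod_right' (f := fun p : (α × α) × α => f p.1.1 p.1.2 p.2)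
    (hf.comp (by fun_prop : Measurable fun p : (α × α) × α => (p.1.1, p.1.2, p.2)))

theorem measurable_lintegral_two {α : Type*} [MeasurableSpace α] {μ : Measure α} [SFinite μ]
    {f : α → α → ENNReal} (hf : Measurable fun p : α × α => f p.1 p.2) :
    Measurable fun p : α => ∫⁻ w, f p w ∂μ :=
  Measurable.lintegral_prod_right' (f := fun p : α × α => f p.1 p.2) hf

theorem iteratedIntegral_toReal {α : Type*} [MeasurableSpace α] {μ : Measure α} [SFinite μ]
    {S : Set α} (hS : MeasurableSet S) (hμ : μ S ≠ ⊤) {f : α → α → α → α → ENNReal}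
    (hf : Measurable fun p : α × α × α × α => f p.1 p.2.1 p.2.2.1 p.2.2.2)
    {C : ENNReal} (hC : C ≠ ⊤)
    (hfC : ∀ x ∈ S, ∀ y ∈ S, ∀ z ∈ S, ∀ w ∈ S, f x y z w ≤ C) :
    ∫ x in S, ∫ y in S, ∫ z in S, ∫ w in S, (f x y z w).toReal ∂μ ∂μ ∂μ ∂μ
      = (∫⁻ x in S, ∫⁻ y in S, ∫⁻ z in S, ∫⁻ w in S, f x y z w ∂μ ∂μ ∂μ ∂μ).toReal := by
  have m3 := measurable_lintegral_four (μ := μ.restrict S) hf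
  have m2 := measurable_lintegral_three (μ := μ.restrict S)
    (f := fun x y z => ∫⁻ w in S, f x y z w ∂μ) m3
  have m1 := measurable_lintegral_two (μ := μ.restrict S)
    (f := fun x y => ∫⁻ z in S, ∫⁻ w in S, f x y z w ∂μ ∂μ) m2
  have b3 : ∀ x ∈ S, ∀ y ∈ S, ∀ z ∈ S, ∫⁻ w in S, f x y z w ∂μ ≤ C * μ S :=
    fun x hx y hy z hz => setLIntegral_le_mul hS (hfC x hx y hy z hz)
  have b2 : ∀ x ∈ S, ∀ y ∈ S, ∫⁻ z in S, ∫⁻ w in S, f x y z w ∂μ ∂μ ≤ C * μ S * μ S :=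
    fun x hx y hy => setLIntegral_le_mul hS (b3 x hx y hy)
  have b1 : ∀ x ∈ S, ∫⁻ y in S, ∫⁻ z in S, ∫⁻ w in S, f x y z w ∂μ ∂μ ∂μ ≤ C * μ S * μ S * μ S :=
    fun x hx => setLIntegral_le_mul hS (b2 x hx)
  have n3 := ENNReal.mul_ne_top hC hμ
  have n2 := ENNReal.mul_ne_top n3 hμ
  have n1 := ENNReal.mul_ne_top n2 hμ
  rw [← setIntegral_toReal_of_le hS m1 n1 b1]
  refine setIntegral_congr_fun hS fun x hx => ?_
  refine Eq.trans ?_ (setIntegral_toReal_of_le hS (m2.comp measurable_prodMk_left) n2 (b2 x hx))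
  refine setIntegral_congr_fun hS fun y hy => ?_
  refine Eq.trans ?_ (setIntegral_toReal_of_le hS (m3.comp (measurable_prodMk_left.comp
    measurable_prodMk_left)) n3 (b3 x hx y hy))
  refine setIntegral_congr_fun hS fun z hz => ?_
  exact setIntegral_toReal_of_le hS (hf.comp (measurable_prodMk_left.comp (measurable_prodMk_left.comp
    measurable_prodMk_left))) hC (hfC x hx y hy z hz)

theorem setLIntegral_coords {f : ℝ × ℝ × ℝ → ENNReal} (hf : Measurable f) :
    ∫⁻ X : EuclideanSpace ℝ (Fin 3) in {X | |X 0| + |X 1| + |X 2| ≤ 1}, f (X 0, X 1, X 2)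
      = ∫⁻ p in octa, f p :=
  volume_preserving_coords.setLIntegral_comp_preimage measurableSet_octa hf

theorem measurable_tetraVol_one : Measurable fun p : (ℝ × ℝ × ℝ) × (ℝ × ℝ × ℝ) × (ℝ × ℝ × ℝ) =>
    ∫⁻ W in octa, tetraVol p.1 p.2.1 p.2.2 W :=
  measurable_lintegral_four measurable_tetraVol

theorem measurable_tetraVol_two : Measurable fun p : (ℝ × ℝ × ℝ) × (ℝ × ℝ × ℝ) =>
    ∫⁻ Z in octa, ∫⁻ W in octa, tetraVol p.1 p.2 Z W :=
  measurable_lintegral_three (f := fun X Y Z => ∫⁻ W in octa, tetraVol X Y Z W)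
    measurable_tetraVol_one

theorem measurable_tetraVol_one_right (X Y : ℝ × ℝ × ℝ) :
    Measurable fun Z => ∫⁻ W in octa, tetraVol X Y Z W := by
  have h := measurable_tetraVol_one.comp
    (by fun_prop : Measurable fun Z : ℝ × ℝ × ℝ => (X, Y, Z))
  exact h

theorem measurable_tetraVol_two_right (X : ℝ × ℝ × ℝ) :
    Measurable fun Y => ∫⁻ Z in octa, ∫⁻ W in octa, tetraVol X Y Z W := by
  have h := measurable_tetraVol_two.comp (by fun_prop : Measurable fun Y : ℝ × ℝ × ℝ => (X, Y))
  exact h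

theorem measurable_tetraVol_three :
    Measurable fun X => ∫⁻ Y in octa, ∫⁻ Z in octa, ∫⁻ W in octa, tetraVol X Y Z W :=
  measurable_lintegral_two (f := fun X Y => ∫⁻ Z in octa, ∫⁻ W in octa, tetraVol X Y Z W)
    measurable_tetraVol_two

theorem integral_volume_convexHull :
    ∫ x₀ : EuclideanSpace ℝ (Fin 3) in {X | |X 0| + |X 1| + |X 2| ≤ 1},
      ∫ x₁ : EuclideanSpace ℝ (Fin 3) in {X | |X 0| + |X 1| + |X 2| ≤ 1},
      ∫ x₂ : EuclideanSpace ℝ (Fin 3) in {X | |X 0| + |X 1| + |X 2| ≤ 1},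
      ∫ x₃ : EuclideanSpace ℝ (Fin 3) in {X | |X 0| + |X 1| + |X 2| ≤ 1},
        (volume (convexHull ℝ {x₀, x₁, x₂, x₃})).toReal
      = (∫⁻ X in octa, ∫⁻ Y in octa, ∫⁻ Z in octa, ∫⁻ W in octa, tetraVol X Y Z W).toReal := by
  have hS : MeasurableSet {X : EuclideanSpace ℝ (Fin 3) | |X 0| + |X 1| + |X 2| ≤ 1} :=
    (isClosed_le (by fun_prop) (by fun_prop)).measurableSet
  have hμ : volume {X : EuclideanSpace ℝ (Fin 3) | |X 0| + |X 1| + |X 2| ≤ 1} ≠ ⊤ := by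
    rw [volume_octahedron]
    exact ENNReal.ofReal_ne_top
  have hc := volume_preserving_coords.measurable
  rw [iteratedIntegral_toReal hS hμ (C := volume {X : EuclideanSpace ℝ (Fin 3) |
    |X 0| + |X 1| + |X 2| ≤ 1}) ?_ hμ ?_]
  · congr 1
    refine Eq.trans ?_ (setLIntegral_coords measurable_tetraVol_three)
    refine lintegral_congr fun X => ?_
    refine Eq.trans ?_ (setLIntegral_coords
      (f := fun Y => ∫⁻ Z in octa, ∫⁻ W in octa, tetraVol (X 0, X 1, X 2) Y Z W)
      (measurable_tetraVol_two_right _))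
    refine lintegral_congr fun Y => ?_
    refine Eq.trans ?_ (setLIntegral_coords
      (f := fun Z => ∫⁻ W in octa, tetraVol (X 0, X 1, X 2) (Y 0, Y 1, Y 2) Z W)
      (measurable_tetraVol_one_right _ _))
    refine lintegral_congr fun Z => ?_
    refine Eq.trans ?_ (setLIntegral_coords
      (f := tetraVol (X 0, X 1, X 2) (Y 0, Y 1, Y 2) (Z 0, Z 1, Z 2))
      (measurable_tetraVol_right _ _ _))
    refine lintegral_congr fun W => ?_
    exact volume_convexHull_four X Y Z W
  · simp only [volume_convexHull_four]
    have h := measurable_tetraVol.comp (by fun_prop : Measurable fun p : EuclideanSpace ℝ (Fin 3)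
      × EuclideanSpace ℝ (Fin 3) × EuclideanSpace ℝ (Fin 3) × EuclideanSpace ℝ (Fin 3) =>
      ((p.1 0, p.1 1, p.1 2), (p.2.1 0, p.2.1 1, p.2.1 2), (p.2.2.1 0, p.2.2.1 1, p.2.2.1 2),
        (p.2.2.2 0, p.2.2.2 1, p.2.2.2 2)))
    exact h
  · intro x hx y hy z hz w hw
    refine measure_mono (convexHull_min ?_ ?_)
    · rintro _ (rfl | rfl | rfl | rfl) <;> assumption
    · rw [← convexHull_octahedron]
      exact convex_convexHull _ _

theorem setLIntegral_three {α : Type*} [MeasureSpace α] [SigmaFinite (volume : Measure α)]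
    {S : Set α} (hS : MeasurableSet S) {f : α → α → α → ENNReal}
    (hf : Measurable fun p : α × α × α => f p.1 p.2.1 p.2.2) :
    ∫⁻ x in S, ∫⁻ y in S, ∫⁻ z in S, f x y z
      = ∫⁻ w : Fin 3 → α, {w : Fin 3 → α | ∀ i, w i ∈ S}.indicator
          (fun w => f (w 0) (w 1) (w 2)) w := by
  have hm : MeasurableSet {w : Fin 3 → α | ∀ i, w i ∈ S} := by
    have : {w : Fin 3 → α | ∀ i, w i ∈ S} = Set.pi univ fun _ => S := by ext; simp
    rw [this]
    exact MeasurableSet.univ_pi fun _ => hS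
  rw [lintegral_finThree]
  · rw [← lintegral_indicator hS]
    refine lintegral_congr fun x => ?_
    by_cases hx : x ∈ S
    · rw [indicator_of_mem hx, ← lintegral_indicator hS]
      refine lintegral_congr fun y => ?_
      by_cases hy : y ∈ S
      · rw [indicator_of_mem hy, ← lintegral_indicator hS]
        refine lintegral_congr fun z => ?_
        by_cases hz : z ∈ S <;> simp [indicator, Fin.forall_fin_succ, hx, hy, hz]
      · simp [indicator, Fin.forall_fin_succ, hy]
    · simp [indicator, Fin.forall_fin_succ, hx]
  · refine Measurable.indicator ?_ hm
    have h := hf.comp (by fun_prop : Measurable fun w : Fin 3 → α => (w 0, w 1, w 2))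
    exact h

/-- Three points of space are the same as three coordinate vectors. -/
theorem volume_preserving_transpose : MeasurePreserving fun w : Fin 3 → ℝ × ℝ × ℝ =>
    ((fun i => (w i).1, fun i => (w i).2.1, fun i => (w i).2.2) :
      (Fin 3 → ℝ) × (Fin 3 → ℝ) × (Fin 3 → ℝ)) := by
  have h1 := volume_measurePreserving_arrowProdEquivProdArrow ℝ (ℝ × ℝ) (Fin 3)
  have h2 := (MeasurePreserving.id (volume : Measure (Fin 3 → ℝ))).prod
    (volume_measurePreserving_arrowProdEquivProdArrow ℝ ℝ (Fin 3))
  exact h2.comp h1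

/-- Twice the signed area of a planar triangle with coordinate vectors `y` and `z`. -/
def signedArea (y z : Fin 3 → ℝ) : ℝ := (y 1 - y 0) * (z 2 - z 0) - (y 2 - y 0) * (z 1 - z 0)

/-- The mean over the fourth vertex of the volume of a tetrahedron, as a function of the three
coordinate vectors of the first three vertices. -/
noncomputable def octaKernel (p : (Fin 3 → ℝ) × (Fin 3 → ℝ) × (Fin 3 → ℝ)) : ENNReal :=
  {p : (Fin 3 → ℝ) × (Fin 3 → ℝ) × (Fin 3 → ℝ) |
      ∀ i, |p.1 i| + |p.2.1 i| + |p.2.2 i| ≤ 1}.indicator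
    (fun p => ∫⁻ W in octa, ENNReal.ofReal (|(W.1 - p.1 0) * signedArea p.2.1 p.2.2
      + (W.2.1 - p.2.1 0) * signedArea p.2.2 p.1 + (W.2.2 - p.2.2 0) * signedArea p.1 p.2.1| / 6)) p

theorem tetraVol_eq (x y z : Fin 3 → ℝ) (W : ℝ × ℝ × ℝ) :
    tetraVol (x 0, y 0, z 0) (x 1, y 1, z 1) (x 2, y 2, z 2) W
      = ENNReal.ofReal (|(W.1 - x 0) * signedArea y z
      + (W.2.1 - y 0) * signedArea z x + (W.2.2 - z 0) * signedArea x y| / 6) := by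
  unfold tetraVol tetraDet signedArea
  congr 3

theorem measurableSet_octaKernel : MeasurableSet {p : (Fin 3 → ℝ) × (Fin 3 → ℝ) × (Fin 3 → ℝ) |
      ∀ i, |p.1 i| + |p.2.1 i| + |p.2.2 i| ≤ 1} := by
  refine IsClosed.measurableSet ?_
  rw [ofPred_forall]
  exact isClosed_iInter fun i => isClosed_le (by fun_prop) (by fun_prop)

theorem measurable_octaKernel : Measurable octaKernel := by
  refine Measurable.indicator ?_ measurableSet_octaKernel
  have h := measurable_tetraVol_one.comp (by fun_prop :
    Measurable fun p : (Fin 3 → ℝ) × (Fin 3 → ℝ) × (Fin 3 → ℝ) =>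
      ((p.1 0, p.2.1 0, p.2.2 0), (p.1 1, p.2.1 1, p.2.2 1), (p.1 2, p.2.1 2, p.2.2 2)))
  convert h using 2 with p
  exact lintegral_congr fun W => (tetraVol_eq _ _ _ W).symm

theorem lintegral_tetraVol :
    ∫⁻ X in octa, ∫⁻ Y in octa, ∫⁻ Z in octa, ∫⁻ W in octa, tetraVol X Y Z W
      = ∫⁻ p, octaKernel p := by
  rw [setLIntegral_three (f := fun X Y Z => ∫⁻ W in octa, tetraVol X Y Z W) measurableSet_octa
    measurable_tetraVol_one, ← volume_preserving_transpose.lintegral_comp measurable_octaKernel]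
  refine lintegral_congr fun w => ?_
  by_cases hw : w ∈ {w : Fin 3 → ℝ × ℝ × ℝ | ∀ i, w i ∈ octa}
  · rw [indicator_of_mem hw, octaKernel, indicator_of_mem (by exact hw)]
    exact lintegral_congr fun W => tetraVol_eq (fun i => (w i).1) (fun i => (w i).2.1)
      (fun i => (w i).2.2) W
  · rw [indicator_of_notMem hw, octaKernel, indicator_of_notMem (by exact hw)]

theorem volume_preserving_rotate (α : Type*) [MeasureSpace α] [SFinite (volume : Measure α)] :
    MeasurePreserving fun p : α × α × α => (p.2.1, p.2.2, p.1) :=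
  (volume_preserving_prodAssoc (α₁ := α) (β₁ := α) (γ₁ := α)).comp
    (Measure.measurePreserving_swap (μ := (volume : Measure α)) (ν := (volume : Measure (α × α))))

theorem octaKernel_rotate (p : (Fin 3 → ℝ) × (Fin 3 → ℝ) × (Fin 3 → ℝ)) :
    octaKernel (p.2.1, p.2.2, p.1) = octaKernel p := by
  simp only [octaKernel, indicator]
  refine if_congr ?_ ?_ rfl
  · exact forall_congr' fun i => by simp only []; rw [← add_rotate]
  · have h := (volume_preserving_rotate ℝ).setLIntegral_comp_preimage measurableSet_octa
      (f := fun W => ENNReal.ofReal (|(W.1 - p.2.1 0) * signedArea p.2.2 p.1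
        + (W.2.1 - p.2.2 0) * signedArea p.1 p.2.1 + (W.2.2 - p.1 0) * signedArea p.2.1 p.2.2| / 6))
      (by fun_prop)
    refine h.symm.trans ?_
    have e : (fun p : ℝ × ℝ × ℝ => (p.2.1, p.2.2, p.1)) ⁻¹' octa = octa := by
      ext W
      simp only [octa, mem_preimage, mem_ofPred_eq]
      rw [← add_rotate]
    rw [e]
    refine lintegral_congr fun W => ?_
    congr 3
    ring

/-- Coordinates of three points on the plane `x + q₀ y + q₁ z = q₂`. -/
def planeLift (q y z : Fin 3 → ℝ) : Fin 3 → ℝ := fun i => q 2 - q 0 * y i - q 1 * z i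

@[fun_prop]
theorem continuous_planeLift {α : Type*} [TopologicalSpace α] {q y z : α → Fin 3 → ℝ}
    (hq : Continuous q) (hy : Continuous y) (hz : Continuous z) :
    Continuous fun a => planeLift (q a) (y a) (z a) := by
  unfold planeLift
  fun_prop

@[fun_prop]
theorem continuous_signedArea {α : Type*} [TopologicalSpace α] {y z : α → Fin 3 → ℝ}
    (hy : Continuous y) (hz : Continuous z) :
    Continuous fun a => signedArea (y a) (z a) := by
  unfold signedArea
  fun_prop

theorem lintegral_planeLift (y z : Fin 3 → ℝ) (h : signedArea y z ≠ 0)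
    {g : (Fin 3 → ℝ) → ENNReal} (hg : Measurable g) :
    ∫⁻ x, g x = ∫⁻ q, ENNReal.ofReal |signedArea y z| * g (planeLift q y z) := by
  let M : Matrix (Fin 3) (Fin 3) ℝ := Matrix.of fun i j => ![-y i, -z i, 1] j
  have hM : M.det = signedArea y z := by
    rw [Matrix.det_fin_three]
    simp [M, signedArea]
    ring
  have hL : ∀ q, Matrix.toLin' M q = planeLift q y z := by
    intro q
    ext i
    simp [M, Matrix.mulVec, dotProduct, Fin.sum_univ_three, planeLift]
    ring
  have hmap := Real.map_matrix_volume_pi_eq_smul_volume_pi (M := M) (by rwa [hM])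
  have hcont : Continuous fun q => planeLift q y z := by fun_prop
  have h1 : ∫⁻ q, g (planeLift q y z) = ENNReal.ofReal |(signedArea y z)⁻¹| * ∫⁻ x, g x := by
    rw [← smul_eq_mul, ← lintegral_smul_measure, ← hM, ← hmap, lintegral_map hg]
    · simp only [hL]
    · rw [funext hL]
      exact hcont.measurable
  have hm : Measurable fun q => g (planeLift q y z) := hg.comp hcont.measurable
  rw [lintegral_const_mul _ hm, h1, ← mul_assoc,
    ← ENNReal.ofReal_mul (abs_nonneg _), ← abs_mul, mul_inv_cancel₀ h]
  simp

/-- Mean distance (up to normalization) of a point of the octahedron from the plane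
`x + q₀ y + q₁ z = q₂`. -/
noncomputable def planeDist (q : Fin 3 → ℝ) : ENNReal :=
  ∫⁻ W in octa, ENNReal.ofReal |W.1 + q 0 * W.2.1 + q 1 * W.2.2 - q 2|

/-- Triples of points, given by coordinate vectors, whose lifts to the plane
`x + q₀ y + q₁ z = q₂` belong to the octahedron. -/
def sectionTriples (q : Fin 3 → ℝ) : Set ((Fin 3 → ℝ) × (Fin 3 → ℝ)) :=
  {w | ∀ i, |planeLift q w.1 w.2 i| + |w.1 i| + |w.2 i| ≤ 1}

/-- Second moment of the area of a triangle in a plane section of the octahedron. -/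
noncomputable def sectionMoment (q : Fin 3 → ℝ) : ENNReal :=
  ∫⁻ w, (sectionTriples q).indicator (fun w => ENNReal.ofReal (signedArea w.1 w.2 ^ 2)) w

theorem isClosed_sectionTriples :
    IsClosed {p : (Fin 3 → ℝ) × ((Fin 3 → ℝ) × (Fin 3 → ℝ)) | p.2 ∈ sectionTriples p.1} := by
  simp only [sectionTriples, mem_ofPred_eq, planeLift]
  rw [ofPred_forall]
  exact isClosed_iInter fun i => isClosed_le (by fun_prop) (by fun_prop)

theorem measurable_planeDist : Measurable planeDist :=
  Measurable.lintegral_prod_right' (f := fun p : (Fin 3 → ℝ) × (ℝ × ℝ × ℝ) =>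
    ENNReal.ofReal |p.2.1 + p.1 0 * p.2.2.1 + p.1 1 * p.2.2.2 - p.1 2|) (by fun_prop)

theorem measurable_sectionMoment : Measurable sectionMoment := by
  have h : Measurable fun p : (Fin 3 → ℝ) × ((Fin 3 → ℝ) × (Fin 3 → ℝ)) =>
      {p : (Fin 3 → ℝ) × ((Fin 3 → ℝ) × (Fin 3 → ℝ)) | p.2 ∈ sectionTriples p.1}.indicator
        (fun p => ENNReal.ofReal (signedArea p.2.1 p.2.2 ^ 2)) p := by
    refine Measurable.indicator ?_ isClosed_sectionTriples.measurableSet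
    exact (ENNReal.continuous_ofReal.comp (by fun_prop)).measurable
  exact h.lintegral_prod_right'

theorem signedArea_planeLift (q y z : Fin 3 → ℝ) :
    signedArea z (planeLift q y z) = q 0 * signedArea y z ∧
      signedArea (planeLift q y z) y = q 1 * signedArea y z := by
  constructor <;> simp only [signedArea, planeLift] <;> ring

theorem octaKernel_planeLift (q : Fin 3 → ℝ) (w : (Fin 3 → ℝ) × (Fin 3 → ℝ)) :
    ENNReal.ofReal |signedArea w.1 w.2| * octaKernel (planeLift q w.1 w.2, w.1, w.2)
      = ENNReal.ofReal (1 / 6) * planeDist q *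
        (sectionTriples q).indicator (fun w => ENNReal.ofReal (signedArea w.1 w.2 ^ 2)) w := by
  by_cases hw : w ∈ sectionTriples q
  · rw [octaKernel, indicator_of_mem hw, indicator_of_mem (by exact hw)]
    simp only [(signedArea_planeLift q w.1 w.2).1, (signedArea_planeLift q w.1 w.2).2]
    have e : ∀ W : ℝ × ℝ × ℝ, ENNReal.ofReal (|(W.1 - planeLift q w.1 w.2 0) * signedArea w.1 w.2
        + (W.2.1 - w.1 0) * (q 0 * signedArea w.1 w.2)
        + (W.2.2 - w.2 0) * (q 1 * signedArea w.1 w.2)| / 6)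
        = ENNReal.ofReal (|signedArea w.1 w.2| / 6)
          * ENNReal.ofReal |W.1 + q 0 * W.2.1 + q 1 * W.2.2 - q 2| := by
      intro W
      rw [← ENNReal.ofReal_mul (by positivity), div_mul_eq_mul_div, ← abs_mul]
      congr 3
      simp only [planeLift]
      ring
    simp only [e]
    rw [lintegral_const_mul _ (by fun_prop), planeDist, ← mul_assoc,
      ← ENNReal.ofReal_mul (abs_nonneg _), mul_right_comm, ← ENNReal.ofReal_mul (by norm_num)]
    congr 2
    rw [← sq_abs]
    ring
  · rw [octaKernel, indicator_of_notMem hw, indicator_of_notMem (by exact hw), mul_zero, mul_zero]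

theorem lintegral_octaKernel_chart {T : Set ((Fin 3 → ℝ) × (Fin 3 → ℝ) × (Fin 3 → ℝ))}
    {Q : Set (Fin 3 → ℝ)} (hT : MeasurableSet T) (hQ : MeasurableSet Q)
    (hTQ : ∀ q y z, signedArea y z ≠ 0 → ((planeLift q y z, y, z) ∈ T ↔ q ∈ Q))
    (hT0 : ∀ x y z, signedArea y z = 0 → (x, y, z) ∈ T → octaKernel (x, y, z) = 0) :
    ∫⁻ p, T.indicator octaKernel p
      = ∫⁻ q in Q, ENNReal.ofReal (1 / 6) * planeDist q * sectionMoment q := by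
  have hK := measurable_octaKernel.indicator hT
  have h1 : ∫⁻ p, T.indicator octaKernel p
      = ∫⁻ w : (Fin 3 → ℝ) × (Fin 3 → ℝ), ∫⁻ x, T.indicator octaKernel (x, w) :=
    lintegral_prod_symm _ hK.aemeasurable
  have hmeas : Measurable fun p : ((Fin 3 → ℝ) × (Fin 3 → ℝ)) × (Fin 3 → ℝ) =>
      ENNReal.ofReal |signedArea p.1.1 p.1.2|
        * Q.indicator (fun q => octaKernel (planeLift q p.1.1 p.1.2, p.1.1, p.1.2)) p.2 := by
    have hm1 : Measurable fun p : ((Fin 3 → ℝ) × (Fin 3 → ℝ)) × (Fin 3 → ℝ) =>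
        octaKernel (planeLift p.2 p.1.1 p.1.2, p.1.1, p.1.2) := by
      have hc : Continuous fun p : ((Fin 3 → ℝ) × (Fin 3 → ℝ)) × (Fin 3 → ℝ) =>
        (planeLift p.2 p.1.1 p.1.2, p.1.1, p.1.2) := by fun_prop
      have h := measurable_octaKernel.comp hc.measurable
      exact h
    have hm2 := hm1.indicator (measurable_snd hQ)
    have hc : Continuous fun p : ((Fin 3 → ℝ) × (Fin 3 → ℝ)) × (Fin 3 → ℝ) =>
      |signedArea p.1.1 p.1.2| := by fun_prop
    exact hc.measurable.ennreal_ofReal.mul hm2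
  have h2 : ∀ w : (Fin 3 → ℝ) × (Fin 3 → ℝ), ∫⁻ x, T.indicator octaKernel (x, w)
      = ∫⁻ q, ENNReal.ofReal |signedArea w.1 w.2|
        * Q.indicator (fun q => octaKernel (planeLift q w.1 w.2, w.1, w.2)) q := by
    intro w
    by_cases hw : signedArea w.1 w.2 = 0
    · simp only [hw, abs_zero, ENNReal.ofReal_zero, zero_mul, lintegral_zero]
      refine (lintegral_congr fun x => ?_).trans lintegral_zero
      by_cases hx : (x, w) ∈ T
      · rw [indicator_of_mem hx]
        exact hT0 x w.1 w.2 hw hx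
      · rw [indicator_of_notMem hx]
    · have hm : Measurable fun x => T.indicator octaKernel (x, w) := by
        have h := hK.comp (measurable_prodMk_right (y := w))
        exact h
      rw [lintegral_planeLift w.1 w.2 hw hm]
      refine lintegral_congr fun q => ?_
      congr 1
      by_cases hq : q ∈ Q
      · rw [indicator_of_mem hq, indicator_of_mem ((hTQ q w.1 w.2 hw).2 hq)]
      · rw [indicator_of_notMem hq, indicator_of_notMem fun h => hq ((hTQ q w.1 w.2 hw).1 h)]
  rw [h1, lintegral_congr h2, lintegral_lintegral_swap hmeas.aemeasurable,
    ← lintegral_indicator hQ]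
  refine lintegral_congr fun q => ?_
  by_cases hq : q ∈ Q
  · simp only [indicator_of_mem hq, octaKernel_planeLift]
    refine lintegral_const_mul _ (Measurable.indicator ?_ ?_)
    · exact (ENNReal.continuous_ofReal.comp (by fun_prop)).measurable
    · have h : Continuous fun w : (Fin 3 → ℝ) × (Fin 3 → ℝ) => (q, w) := by fun_prop
      exact (isClosed_sectionTriples.preimage h).measurableSet
  · simp [indicator_of_notMem hq]

theorem lintegral_octaKernel_rotate {f : (Fin 3 → ℝ) × (Fin 3 → ℝ) × (Fin 3 → ℝ) → ENNReal}
    (hf : Measurable f) :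
    ∫⁻ p, (f p + f (p.2.1, p.2.2, p.1) + f (p.2.2, p.1, p.2.1)) = 3 * ∫⁻ p, f p := by
  have h := volume_preserving_rotate (Fin 3 → ℝ)
  have h1 := h.lintegral_comp hf
  have h2 := (h.comp h).lintegral_comp hf
  have m1 := hf.comp h.measurable
  rw [lintegral_add_right, lintegral_add_right, h1]
  · have h2' : ∫⁻ p : (Fin 3 → ℝ) × (Fin 3 → ℝ) × (Fin 3 → ℝ), f (p.2.2, p.1, p.2.1)
        = ∫⁻ p, f p := h2
    rw [h2']
    ring
  · exact m1
  · exact hf.comp (h.comp h).measurable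

theorem octaKernel_eq_zero {x y z : Fin 3 → ℝ} (h1 : signedArea y z = 0)
    (h2 : signedArea z x = 0) (h3 : signedArea x y = 0) : octaKernel (x, y, z) = 0 := by
  simp [octaKernel, indicator, h1, h2, h3]

theorem le_ite_add_ite_add_ite (a b c : ℝ) (k : ENNReal) :
    k ≤ (if b ≤ a ∧ c ≤ a then k else 0) + (if c ≤ b ∧ a ≤ b then k else 0)
      + (if a ≤ c ∧ b ≤ c then k else 0) := by
  by_cases h1 : b ≤ a ∧ c ≤ a
  · rw [if_pos h1]
    exact le_add_right (le_add_right le_rfl)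
  by_cases h2 : c ≤ b ∧ a ≤ b
  · rw [if_pos h2]
    exact le_add_right (le_add_left le_rfl)
  have h3 : a ≤ c ∧ b ≤ c := by grind
  rw [if_pos h3]
  exact le_add_left le_rfl

theorem ite_add_ite_add_ite_le (a b c : ℝ) (k : ENNReal) :
    (if b < a ∧ c < a then k else 0) + (if c < b ∧ a < b then k else 0)
      + (if a < c ∧ b < c then k else 0) ≤ k := by
  split_ifs <;> first
    | (exfalso; grind)
    | simp

theorem lintegral_octaKernel :
    ∫⁻ p, octaKernel p = 3 * ∫⁻ q in {q : Fin 3 → ℝ | |q 0| < 1 ∧ |q 1| < 1},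
      ENNReal.ofReal (1 / 6) * planeDist q * sectionMoment q := by
  have hQ : MeasurableSet {q : Fin 3 → ℝ | |q 0| < 1 ∧ |q 1| < 1} := by
    rw [ofPred_and]
    refine IsOpen.measurableSet ?_
    refine (isOpen_lt ?_ ?_).inter (isOpen_lt ?_ ?_) <;> fun_prop
  have hQ2 : MeasurableSet {q : Fin 3 → ℝ | |q 0| ≤ 1 ∧ |q 1| ≤ 1} := by
    rw [ofPred_and]
    refine IsClosed.measurableSet ?_
    refine (isClosed_le ?_ ?_).inter (isClosed_le ?_ ?_) <;> fun_prop
  let T : Set ((Fin 3 → ℝ) × (Fin 3 → ℝ) × (Fin 3 → ℝ)) :=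
    {p | |signedArea p.2.2 p.1| < |signedArea p.2.1 p.2.2| ∧
      |signedArea p.1 p.2.1| < |signedArea p.2.1 p.2.2|}
  let T' : Set ((Fin 3 → ℝ) × (Fin 3 → ℝ) × (Fin 3 → ℝ)) :=
    {p | |signedArea p.2.2 p.1| ≤ |signedArea p.2.1 p.2.2| ∧
      |signedArea p.1 p.2.1| ≤ |signedArea p.2.1 p.2.2|}
  have hT : MeasurableSet T := by
    simp only [T]
    rw [ofPred_and]
    refine IsOpen.measurableSet ?_
    refine (isOpen_lt ?_ ?_).inter (isOpen_lt ?_ ?_) <;> fun_prop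
  have hT' : MeasurableSet T' := by
    simp only [T']
    rw [ofPred_and]
    refine IsClosed.measurableSet ?_
    refine (isClosed_le ?_ ?_).inter (isClosed_le ?_ ?_) <;> fun_prop
  have e : ∫⁻ p, T.indicator octaKernel p = ∫⁻ p, T'.indicator octaKernel p := by
    rw [lintegral_octaKernel_chart hT hQ, lintegral_octaKernel_chart hT' hQ2]
    · refine setLIntegral_congr ?_
      have hne : ∀ i : Fin 3, ∀ a : ℝ, ∀ᵐ q : Fin 3 → ℝ, q i ≠ a := by
        intro i a
        have h := (Measure.quasiMeasurePreserving_eval (μ := fun _ : Fin 3 => (volume : Measure ℝ)) i)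
        exact h.ae (Measure.ae_ne volume a)
      filter_upwards [hne 0 1, hne 0 (-1), hne 1 1, hne 1 (-1)] with q h1 h2 h3 h4
      have key : ∀ x : ℝ, x ≠ 1 → x ≠ -1 → (|x| < 1 ↔ |x| ≤ 1) := by
        intro x hx hx'
        refine ⟨le_of_lt, fun h => lt_of_le_of_ne h fun h => ?_⟩
        rcases (abs_eq zero_le_one).1 h with h | h <;> contradiction
      exact propext (and_congr (key _ h1 h2) (key _ h3 h4))
    · intro q y z h
      have h := abs_pos.2 h
      simp only [T', mem_ofPred_eq, signedArea_planeLift, abs_mul]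
      refine and_congr ?_ ?_ <;> exact mul_le_iff_le_one_left h
    · intro x y z h hx
      simp only [T', mem_ofPred_eq, h, abs_zero] at hx
      exact octaKernel_eq_zero h (abs_nonpos_iff.1 hx.1) (abs_nonpos_iff.1 hx.2)
    · intro q y z h
      have h := abs_pos.2 h
      simp only [T, mem_ofPred_eq, signedArea_planeLift, abs_mul]
      refine and_congr ?_ ?_ <;> exact mul_lt_iff_lt_one_left h
    · intro x y z h hx
      simp only [T, mem_ofPred_eq, h, abs_zero] at hx
      exact absurd hx.1 (abs_nonneg _).not_gt
  rw [← lintegral_octaKernel_chart (T := T) hT hQ]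
  · have hr1 := octaKernel_rotate
    have hr2 : ∀ p, octaKernel (p.2.2, p.1, p.2.1) = octaKernel p := fun p =>
      (hr1 (p.2.1, p.2.2, p.1)).trans (hr1 p)
    apply le_antisymm
    · rw [e, ← lintegral_octaKernel_rotate (measurable_octaKernel.indicator hT')]
      refine lintegral_mono fun p => ?_
      simp only [indicator, hr1, hr2, T', mem_ofPred_eq]
      convert le_ite_add_ite_add_ite |signedArea p.2.1 p.2.2| |signedArea p.2.2 p.1|
        |signedArea p.1 p.2.1| (octaKernel p)
    · rw [← lintegral_octaKernel_rotate (measurable_octaKernel.indicator hT)]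
      refine lintegral_mono fun p => ?_
      simp only [indicator, hr1, hr2, T, mem_ofPred_eq]
      convert ite_add_ite_add_ite_le |signedArea p.2.1 p.2.2| |signedArea p.2.2 p.1|
        |signedArea p.1 p.2.1| (octaKernel p)
  · intro q y z h
    have h := abs_pos.2 h
    simp only [T, mem_ofPred_eq, signedArea_planeLift, abs_mul]
    refine and_congr ?_ ?_ <;> exact mul_lt_iff_lt_one_left h
  · intro x y z h hx
    simp only [T, mem_ofPred_eq, h, abs_zero] at hx
    exact absurd hx.1 (abs_nonneg _).not_gt

theorem lintegral_Ioo_even {a : ℝ} {g : ℝ → ENNReal} (hg : ∀ x, g (-x) = g x) (ha : 0 < a) :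
    ∫⁻ x in Ioo (-a) a, g x = 2 * ∫⁻ x in Ioo 0 a, g x := by
  have h1 : ∫⁻ x in Ioo (-a) 0, g x = ∫⁻ x in Ioo 0 a, g x := by
    have h := (Measure.measurePreserving_neg (volume : Measure ℝ)).setLIntegral_comp_preimage_emb
      (Homeomorph.neg ℝ).measurableEmbedding g (Ioo 0 a)
    simpa [hg] using h
  have h2 : (Ioo (-a) a : Set ℝ) =ᵐ[volume] (Ioo (-a) 0 ∪ Ioo 0 a : Set ℝ) := by
    filter_upwards [Measure.ae_ne volume (0 : ℝ)] with x hx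
    refine propext ⟨fun h => ?_, fun h => ?_⟩
    · rcases lt_or_gt_of_ne hx with h0 | h0
      · exact Or.inl ⟨h.1, h0⟩
      · exact Or.inr ⟨h0, h.2⟩
    · rcases h with h | h
      · exact ⟨h.1, h.2.trans ha⟩
      · exact ⟨by linarith [h.1], h.2⟩
  rw [setLIntegral_congr h2, lintegral_union measurableSet_Ioo, h1, two_mul]
  exact disjoint_left.2 fun x h h' => lt_asymm h.2 h'.1

theorem lintegral_Ioo_split {a m b : ℝ} (g : ℝ → ENNReal) (h1 : a < m) (h2 : m < b) :
    ∫⁻ x in Ioo a b, g x = (∫⁻ x in Ioo a m, g x) + ∫⁻ x in Ioo m b, g x := by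
  have h : (Ioo a b : Set ℝ) =ᵐ[volume] (Ioo a m ∪ Ioo m b : Set ℝ) := by
    filter_upwards [Measure.ae_ne volume m] with x hx
    refine propext ⟨fun h => ?_, fun h => ?_⟩
    · rcases lt_or_gt_of_ne hx with h0 | h0
      · exact Or.inl ⟨h.1, h0⟩
      · exact Or.inr ⟨h0, h.2⟩
    · rcases h with h | h
      · exact ⟨h.1, h.2.trans h2⟩
      · exact ⟨h1.trans h.1, h.2⟩
  rw [setLIntegral_congr h, lintegral_union measurableSet_Ioo]
  exact disjoint_left.2 fun x h h' => lt_asymm h.2 h'.1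

/-- Interchange of the order of integration over a planar region. -/
theorem lintegral_region_swap {s t : Set ℝ} {u v : ℝ → Set ℝ} (hs : MeasurableSet s)
    (ht : MeasurableSet t) (hu : ∀ x, MeasurableSet (u x)) (hv : ∀ y, MeasurableSet (v y))
    (hr : MeasurableSet {p : ℝ × ℝ | p.1 ∈ s ∧ p.2 ∈ u p.1})
    (h : ∀ x y, (x ∈ s ∧ y ∈ u x) ↔ (y ∈ t ∧ x ∈ v y)) {g : ℝ × ℝ → ENNReal} (hg : Measurable g) :
    ∫⁻ x in s, ∫⁻ y in u x, g (x, y) = ∫⁻ y in t, ∫⁻ x in v y, g (x, y) := by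
  have h1 : ∫⁻ x in s, ∫⁻ y in u x, g (x, y)
      = ∫⁻ x, ∫⁻ y, {p : ℝ × ℝ | p.1 ∈ s ∧ p.2 ∈ u p.1}.indicator g (x, y) := by
    rw [← lintegral_indicator hs]
    refine lintegral_congr fun x => ?_
    by_cases hx : x ∈ s
    · rw [indicator_of_mem hx, ← lintegral_indicator (hu x)]
      refine lintegral_congr fun y => ?_
      by_cases hy : y ∈ u x <;> simp [indicator, hx, hy]
    · simp [indicator, hx]
  have h2 : ∫⁻ y in t, ∫⁻ x in v y, g (x, y)
      = ∫⁻ y, ∫⁻ x, {p : ℝ × ℝ | p.1 ∈ s ∧ p.2 ∈ u p.1}.indicator g (x, y) := by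
    rw [← lintegral_indicator ht]
    refine lintegral_congr fun y => ?_
    by_cases hy : y ∈ t
    · rw [indicator_of_mem hy, ← lintegral_indicator (hv y)]
      refine lintegral_congr fun x => ?_
      by_cases hx : x ∈ v y <;> simp [indicator, h, hy, hx]
    · simp [indicator, h, hy]
  rw [h1, h2]
  exact lintegral_lintegral_swap (f := fun x y =>
    {p : ℝ × ℝ | p.1 ∈ s ∧ p.2 ∈ u p.1}.indicator g (x, y)) (hg.indicator hr).aemeasurable

theorem lintegral_square_symm {g : ℝ × ℝ → ENNReal} (hg : Measurable g)
    (h : ∀ x y, g (x, y) = g (y, x)) :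
    ∫⁻ b in Ioo (0 : ℝ) 1, ∫⁻ c in Ioo (0 : ℝ) 1, g (b, c)
      = 2 * ∫⁻ b in Ioo (0 : ℝ) 1, ∫⁻ c in Ioo 0 b, g (b, c) := by
  have hr : MeasurableSet {p : ℝ × ℝ | p.1 ∈ Ioo 0 1 ∧ p.2 ∈ Ioo 0 p.1} := by
    simp only [mem_Ioo, ofPred_and]
    refine IsOpen.measurableSet ?_
    refine ((isOpen_lt ?_ ?_).inter (isOpen_lt ?_ ?_)).inter
      ((isOpen_lt ?_ ?_).inter (isOpen_lt ?_ ?_)) <;> fun_prop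
  have h1 : ∫⁻ b in Ioo (0 : ℝ) 1, ∫⁻ c in Ioo (0 : ℝ) 1, g (b, c)
      = ∫⁻ b in Ioo (0 : ℝ) 1, ((∫⁻ c in Ioo 0 b, g (b, c)) + ∫⁻ c in Ioo b 1, g (b, c)) :=
    setLIntegral_congr_fun measurableSet_Ioo fun b hb => lintegral_Ioo_split _ hb.1 hb.2
  have hm : Measurable fun b => ∫⁻ c in Ioo 0 b, g (b, c) := by
    have e : ∀ b, ∫⁻ c in Ioo 0 b, g (b, c)
        = ∫⁻ c, {p : ℝ × ℝ | p.2 ∈ Ioo 0 p.1}.indicator g (b, c) := by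
      intro b
      rw [← lintegral_indicator measurableSet_Ioo]
      refine lintegral_congr fun c => ?_
      simp [indicator]
    simp only [e]
    refine Measurable.lintegral_prod_right' (hg.indicator ?_)
    simp only [mem_Ioo, ofPred_and]
    refine IsOpen.measurableSet ?_
    refine (isOpen_lt ?_ ?_).inter (isOpen_lt ?_ ?_) <;> fun_prop
  rw [h1, lintegral_add_left hm, two_mul]
  congr 1
  rw [lintegral_region_swap (s := Ioo 0 1) (t := Ioo 0 1) (u := fun x => Ioo 0 x)
    (v := fun x => Ioo x 1) measurableSet_Ioo measurableSet_Ioo (fun _ => measurableSet_Ioo)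
    (fun _ => measurableSet_Ioo) hr ?_ hg]
  · simp only [h]
  · intro x y
    simp only [mem_Ioo]
    constructor
    · rintro ⟨⟨_, _⟩, _, _⟩
      exact ⟨⟨by linarith, by linarith⟩, by linarith, by linarith⟩
    · rintro ⟨⟨_, _⟩, _, _⟩
      exact ⟨⟨by linarith, by linarith⟩, by linarith, by linarith⟩

theorem planeDist_comp {q q' : Fin 3 → ℝ} {e : ℝ × ℝ × ℝ → ℝ × ℝ × ℝ} (he : MeasurePreserving e)
    (ho : ∀ W, e W ∈ octa ↔ W ∈ octa)
    (hq : ∀ W, |(e W).1 + q' 0 * (e W).2.1 + q' 1 * (e W).2.2 - q' 2|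
      = |W.1 + q 0 * W.2.1 + q 1 * W.2.2 - q 2|) : planeDist q' = planeDist q := by
  have hm : Measurable fun W : ℝ × ℝ × ℝ => ENNReal.ofReal |W.1 + q' 0 * W.2.1 + q' 1 * W.2.2 - q' 2| := by
    fun_prop
  have h := he.setLIntegral_comp_preimage measurableSet_octa hm
  have hp : e ⁻¹' octa = octa := ext ho
  rw [hp] at h
  rw [planeDist, ← h]
  simp only [hq]
  rfl

theorem sectionMoment_comp {q q' : Fin 3 → ℝ} {e : (Fin 3 → ℝ) × (Fin 3 → ℝ) → (Fin 3 → ℝ) × (Fin 3 → ℝ)}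
    (he : MeasurePreserving e) (ho : ∀ w, e w ∈ sectionTriples q' ↔ w ∈ sectionTriples q)
    (hs : ∀ w, signedArea (e w).1 (e w).2 ^ 2 = signedArea w.1 w.2 ^ 2) :
    sectionMoment q' = sectionMoment q := by
  have hm : Measurable fun w => (sectionTriples q').indicator
      (fun w => ENNReal.ofReal (signedArea w.1 w.2 ^ 2)) w := by
    refine Measurable.indicator ?_ ?_
    · exact (ENNReal.continuous_ofReal.comp (by fun_prop)).measurable
    · exact measurable_prodMk_left (x := q') isClosed_sectionTriples.measurableSet
  rw [sectionMoment, ← he.lintegral_comp hm, sectionMoment]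
  refine lintegral_congr fun w => ?_
  by_cases h : w ∈ sectionTriples q
  · rw [indicator_of_mem ((ho w).2 h), indicator_of_mem h, hs]
  · rw [indicator_of_notMem (mt (ho w).1 h), indicator_of_notMem h]

theorem planeDist_neg_fst (b c t : ℝ) : planeDist ![-b, c, t] = planeDist ![b, c, t] := by
  refine planeDist_comp (e := fun W => (W.1, -W.2.1, W.2.2)) ?_ ?_ ?_
  · exact (MeasurePreserving.id volume).prod
      ((Measure.measurePreserving_neg volume).prod (MeasurePreserving.id volume))
  · intro W
    simp [octa]
  · intro W
    simp

theorem planeDist_swap (b c t : ℝ) : planeDist ![c, b, t] = planeDist ![b, c, t] := by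
  refine planeDist_comp (e := fun W => (W.1, W.2.2, W.2.1)) ?_ ?_ ?_
  · exact (MeasurePreserving.id volume).prod Measure.measurePreserving_swap
  · intro W
    simp only [octa, mem_ofPred_eq, add_right_comm]
  · intro W
    simp [add_right_comm]

theorem planeDist_neg_offset (b c t : ℝ) : planeDist ![b, c, -t] = planeDist ![b, c, t] := by
  refine planeDist_comp (e := fun W => (-W.1, -W.2.1, -W.2.2))
    ((Measure.measurePreserving_neg volume).prod ((Measure.measurePreserving_neg volume).prod
      (Measure.measurePreserving_neg volume))) ?_ ?_
  · intro W
    simp [octa]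
  · intro W
    rw [← abs_neg]
    congr 1
    simp
    ring

theorem sectionMoment_neg_fst (b c t : ℝ) :
    sectionMoment ![-b, c, t] = sectionMoment ![b, c, t] := by
  refine sectionMoment_comp (e := fun w => (-w.1, w.2)) ?_ ?_ ?_
  · exact (Measure.measurePreserving_neg volume).prod (MeasurePreserving.id volume)
  · intro w
    simp [sectionTriples, planeLift, ← sub_eq_add_neg]
  · intro w
    simp only [signedArea, Pi.neg_apply]
    ring

theorem sectionMoment_swap (b c t : ℝ) :
    sectionMoment ![c, b, t] = sectionMoment ![b, c, t] := by
  refine sectionMoment_comp (e := Prod.swap) Measure.measurePreserving_swap ?_ ?_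
  · intro w
    simp [sectionTriples, planeLift, add_right_comm, sub_right_comm]
  · intro w
    simp only [signedArea, Prod.fst_swap, Prod.snd_swap]
    ring

theorem sectionMoment_neg_offset (b c t : ℝ) :
    sectionMoment ![b, c, -t] = sectionMoment ![b, c, t] := by
  refine sectionMoment_comp (e := fun w => (-w.1, -w.2))
    ((Measure.measurePreserving_neg volume).prod (Measure.measurePreserving_neg volume)) ?_ ?_
  · intro w
    have e : ∀ i, |planeLift ![b, c, -t] (-w.1) (-w.2) i| = |planeLift ![b, c, t] w.1 w.2 i| := by
      intro i
      rw [← abs_neg]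
      congr 1
      simp [planeLift]
      ring
    simp only [sectionTriples, mem_ofPred_eq, e]
    simp
  · intro w
    simp only [signedArea, Pi.neg_apply]
    ring

theorem sectionMoment_eq_zero {q : Fin 3 → ℝ} (hb : |q 0| < 1) (hc : |q 1| < 1) (ht : 1 < |q 2|) :
    sectionMoment q = 0 := by
  have h : sectionTriples q = ∅ := by
    refine eq_empty_iff_forall_notMem.2 fun w hw => ?_
    have h0 := hw 0
    have e : q 2 = planeLift q w.1 w.2 0 + q 0 * w.1 0 + q 1 * w.2 0 := by
      simp only [planeLift]
      ring
    have h1 : |q 2| ≤ |planeLift q w.1 w.2 0| + |q 0| * |w.1 0| + |q 1| * |w.2 0| := by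
      rw [← abs_mul, ← abs_mul]
      conv_lhs => rw [e]
      exact abs_add_three _ _ _
    nlinarith [abs_nonneg (w.1 0), abs_nonneg (w.2 0)]
  simp [sectionMoment, h]

/-- The measurable weight of a plane section in the distribution of random simplices. -/
noncomputable def sectionWeight (b c t : ℝ) : ENNReal :=
  planeDist ![b, c, t] * sectionMoment ![b, c, t]

theorem measurable_sectionWeight :
    Measurable fun p : ℝ × ℝ × ℝ => sectionWeight p.1 p.2.1 p.2.2 := by
  have hc : Continuous fun p : ℝ × ℝ × ℝ => ![p.1, p.2.1, p.2.2] := by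
    refine continuous_pi fun i => ?_
    fin_cases i <;> simp <;> fun_prop
  have h := (measurable_planeDist.mul measurable_sectionMoment).comp hc.measurable
  exact h

theorem sectionWeight_neg_fst (b c t : ℝ) : sectionWeight (-b) c t = sectionWeight b c t := by
  rw [sectionWeight, planeDist_neg_fst, sectionMoment_neg_fst, sectionWeight]

theorem sectionWeight_swap (b c t : ℝ) : sectionWeight c b t = sectionWeight b c t := by
  rw [sectionWeight, planeDist_swap, sectionMoment_swap, sectionWeight]

theorem sectionWeight_neg_offset (b c t : ℝ) : sectionWeight b c (-t) = sectionWeight b c t := by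
  rw [sectionWeight, planeDist_neg_offset, sectionMoment_neg_offset, sectionWeight]

theorem lintegral_sectionWeight_offset {b c : ℝ} (hb : b ∈ Ioo (-1) 1) (hc : c ∈ Ioo (-1) 1) :
    ∫⁻ t, sectionWeight b c t = 2 * ∫⁻ t in Ioo 0 1, sectionWeight b c t := by
  rw [← lintegral_Ioo_even (fun t => sectionWeight_neg_offset b c t) one_pos,
    ← lintegral_indicator measurableSet_Ioo]
  refine lintegral_congr_ae ?_
  filter_upwards [Measure.ae_ne volume (1 : ℝ), Measure.ae_ne volume (-1 : ℝ)] with t h1 h2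
  by_cases ht : t ∈ Ioo (-1) 1
  · rw [indicator_of_mem ht]
  · rw [indicator_of_notMem ht, sectionWeight, sectionMoment_eq_zero, mul_zero]
    · exact abs_lt.2 hb
    · exact abs_lt.2 hc
    · refine lt_of_not_ge fun h => ht ?_
      have h := abs_le.1 h
      exact ⟨lt_of_le_of_ne h.1 (Ne.symm h2), lt_of_le_of_ne h.2 h1⟩

theorem lintegral_octaKernel_eq :
    ∫⁻ p, octaKernel p = 8 * ∫⁻ b in Ioo (0 : ℝ) 1, ∫⁻ c in Ioo 0 b, ∫⁻ t in Ioo 0 1,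
      sectionWeight b c t := by
  have hQ : MeasurableSet {q : Fin 3 → ℝ | |q 0| < 1 ∧ |q 1| < 1} := by
    rw [ofPred_and]
    refine IsOpen.measurableSet ?_
    refine (isOpen_lt ?_ ?_).inter (isOpen_lt ?_ ?_) <;> fun_prop
  have hm : Measurable fun q => planeDist q * sectionMoment q :=
    measurable_planeDist.mul measurable_sectionMoment
  have e1 : ∫⁻ q in {q : Fin 3 → ℝ | |q 0| < 1 ∧ |q 1| < 1}, planeDist q * sectionMoment q
      = ∫⁻ b in Ioo (-1 : ℝ) 1, ∫⁻ c in Ioo (-1 : ℝ) 1, 2 * ∫⁻ t in Ioo 0 1, sectionWeight b c t := by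
    rw [← lintegral_indicator hQ, lintegral_finThree (hm.indicator hQ),
      ← lintegral_indicator measurableSet_Ioo]
    refine lintegral_congr fun b => ?_
    by_cases hb : b ∈ Ioo (-1) 1
    · rw [indicator_of_mem hb, ← lintegral_indicator measurableSet_Ioo]
      refine lintegral_congr fun c => ?_
      by_cases hc : c ∈ Ioo (-1) 1
      · rw [indicator_of_mem hc, ← lintegral_sectionWeight_offset hb hc]
        refine lintegral_congr fun t => ?_
        rw [indicator_of_mem]
        · rfl
        · exact ⟨abs_lt.2 hb, abs_lt.2 hc⟩
      · rw [indicator_of_notMem hc]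
        refine (lintegral_congr fun t => ?_).trans lintegral_zero
        rw [indicator_of_notMem]
        exact fun h => hc (abs_lt.1 h.2)
    · rw [indicator_of_notMem hb]
      refine (lintegral_congr fun c => (lintegral_congr fun t => ?_).trans lintegral_zero).trans
        lintegral_zero
      rw [indicator_of_notMem]
      exact fun h => hb (abs_lt.1 h.1)
  have hw : Measurable fun p : ℝ × ℝ => 2 * ∫⁻ t in Ioo 0 1, sectionWeight p.1 p.2 t := by
    refine Measurable.const_mul ?_ _
    refine Measurable.lintegral_prod_right' (f := fun p : (ℝ × ℝ) × ℝ => sectionWeight p.1.1 p.1.2 p.2) ?_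
    have h := measurable_sectionWeight.comp
      (by fun_prop : Measurable fun p : (ℝ × ℝ) × ℝ => (p.1.1, p.1.2, p.2))
    exact h
  have e2 : ∀ b : ℝ, ∫⁻ c in Ioo (-1 : ℝ) 1, 2 * ∫⁻ t in Ioo 0 1, sectionWeight b c t
      = 2 * ∫⁻ c in Ioo (0 : ℝ) 1, 2 * ∫⁻ t in Ioo 0 1, sectionWeight b c t := by
    intro b
    refine lintegral_Ioo_even (fun c => ?_) one_pos
    congr 2
    funext t
    rw [sectionWeight_swap, sectionWeight_neg_fst, sectionWeight_swap]
  have e3 : ∫⁻ b in Ioo (-1 : ℝ) 1, 2 * ∫⁻ c in Ioo (0 : ℝ) 1, 2 * ∫⁻ t in Ioo 0 1, sectionWeight b c t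
      = 2 * ∫⁻ b in Ioo (0 : ℝ) 1, 2 * ∫⁻ c in Ioo (0 : ℝ) 1, 2 * ∫⁻ t in Ioo 0 1, sectionWeight b c t := by
    refine lintegral_Ioo_even (fun b => ?_) one_pos
    simp only [sectionWeight_neg_fst]
  have e4 := lintegral_square_symm hw fun x y => by simp only [sectionWeight_swap x y]
  have e5 : ∀ b : ℝ, ∫⁻ c in Ioo 0 b, 2 * ∫⁻ t in Ioo 0 1, sectionWeight b c t
      = 2 * ∫⁻ c in Ioo 0 b, ∫⁻ t in Ioo 0 1, sectionWeight b c t := fun b =>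
    lintegral_const_mul' _ _ (by norm_num)
  simp only [lintegral_octaKernel, mul_assoc]
  rw [lintegral_const_mul _ hm, e1]
  simp only [e2]
  rw [e3, lintegral_const_mul' _ _ (by norm_num), e4]
  simp only [e5]
  rw [lintegral_const_mul' _ _ (by norm_num)]
  simp only [← mul_assoc]
  congr 1
  rw [show (3 : ENNReal) = ENNReal.ofReal 3 by norm_num, show (2 : ENNReal) = ENNReal.ofReal 2 by norm_num,
    show (8 : ENNReal) = ENNReal.ofReal 8 by norm_num]
  simp only [← ENNReal.ofReal_mul (show (0 : ℝ) ≤ 3 by norm_num)]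
  rw [← ENNReal.ofReal_mul (by norm_num), ← ENNReal.ofReal_mul (by norm_num),
    ← ENNReal.ofReal_mul (by norm_num), ← ENNReal.ofReal_mul (by norm_num)]
  norm_num

/-- Andréief's identity for the second moment of a random determinant. -/
theorem integral_det_sq {ι α : Type*} [Fintype ι] [DecidableEq ι] [MeasurableSpace α]
    {μ : Measure α} [SigmaFinite μ] {φ : ι → α → ℝ}
    (hφ : ∀ i j, Integrable (fun x => φ i x * φ j x) μ) :
    Integrable (fun w : ι → α => (Matrix.of fun i j => φ i (w j)).det ^ 2) (Measure.pi fun _ => μ) ∧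
      ∫ w : ι → α, (Matrix.of fun i j => φ i (w j)).det ^ 2 ∂(Measure.pi fun _ => μ)
        = (Fintype.card (Equiv.Perm ι) : ℝ) * (Matrix.of fun i j => ∫ x, φ i x * φ j x ∂μ).det := by
  have e : ∀ w : ι → α, (Matrix.of fun i j => φ i (w j)).det ^ 2
      = ∑ σ : Equiv.Perm ι, ∑ τ : Equiv.Perm ι,
        ((Equiv.Perm.sign σ : ℤ) : ℝ) * ((Equiv.Perm.sign τ : ℤ) : ℝ)
          * ∏ j, (φ (σ j) (w j) * φ (τ j) (w j)) := by
    intro w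
    rw [Matrix.det_apply', sq, Finset.sum_mul_sum]
    refine Finset.sum_congr rfl fun σ _ => Finset.sum_congr rfl fun τ _ => ?_
    rw [Finset.prod_mul_distrib]
    simp only [Matrix.of_apply]
    ring
  have hi : ∀ σ τ : Equiv.Perm ι, Integrable (fun w : ι → α =>
      ((Equiv.Perm.sign σ : ℤ) : ℝ) * ((Equiv.Perm.sign τ : ℤ) : ℝ)
        * ∏ j, (φ (σ j) (w j) * φ (τ j) (w j))) (Measure.pi fun _ => μ) := fun σ τ =>
    (Integrable.fintype_prod (f := fun j x => φ (σ j) x * φ (τ j) x) fun j => hφ _ _).const_mul _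
  simp only [e]
  refine ⟨integrable_finsetSum _ fun σ _ => integrable_finsetSum _ fun τ _ => hi σ τ, ?_⟩
  rw [integral_finsetSum _ fun σ _ => integrable_finsetSum _ fun τ _ => hi σ τ]
  have key : ∀ σ : Equiv.Perm ι, ∫ w : ι → α, ∑ τ : Equiv.Perm ι,
      ((Equiv.Perm.sign σ : ℤ) : ℝ) * ((Equiv.Perm.sign τ : ℤ) : ℝ)
        * ∏ j, (φ (σ j) (w j) * φ (τ j) (w j)) ∂(Measure.pi fun _ => μ)
      = (Matrix.of fun i j => ∫ x, φ i x * φ j x ∂μ).det := by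
    intro σ
    rw [integral_finsetSum _ fun τ _ => hi σ τ]
    simp only [integral_const_mul]
    have h2 : ∀ τ : Equiv.Perm ι, ∫ w : ι → α, ∏ j, (φ (σ j) (w j) * φ (τ j) (w j)) ∂(Measure.pi fun _ => μ)
        = ∏ j, ∫ x, φ (σ j) x * φ (τ j) x ∂μ := fun τ =>
      integral_fintype_prod_eq_prod (fun j x => φ (σ j) x * φ (τ j) x)
    simp only [h2, mul_assoc]
    have h1 := Matrix.det_permute σ (Matrix.of fun i j => ∫ x, φ i x * φ j x ∂μ)
    rw [← Matrix.det_transpose, Matrix.det_apply'] at h1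
    simp only [Matrix.transpose_apply, Matrix.submatrix_apply, Matrix.of_apply, id] at h1
    rw [← Finset.mul_sum, h1, ← mul_assoc, ← Int.cast_mul, ← Units.val_mul, Int.units_mul_self]
    simp
  simp only [key]
  simp

/-- The moments of order at most two of a planar set, as a functional on quadratic polynomials. -/
def HasMoments (P : Set (ℝ × ℝ)) (m₀₀ m₁₀ m₀₁ m₂₀ m₁₁ m₀₂ : ℝ) : Prop :=
  ∀ a b c d e f : ℝ,
    ∫ p in P, (a + b * p.1 + c * p.2 + d * p.1 ^ 2 + e * (p.1 * p.2) + f * p.2 ^ 2)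
      = a * m₀₀ + b * m₁₀ + c * m₀₁ + d * m₂₀ + e * m₁₁ + f * m₀₂

/-- The Gram determinant of `1, x, y` with the given moments. -/
def gramDet (m₀₀ m₁₀ m₀₁ m₂₀ m₁₁ m₀₂ : ℝ) : ℝ :=
  m₀₀ * (m₂₀ * m₀₂ - m₁₁ ^ 2) - m₁₀ * (m₁₀ * m₀₂ - m₁₁ * m₀₁) + m₀₁ * (m₁₀ * m₁₁ - m₂₀ * m₀₁)

/-- The section of the octahedron by the plane `x + b y + c z = t`, in the coordinates `y, z`. -/
def octaSection (b c t : ℝ) : Set (ℝ × ℝ) := {p | |t - b * p.1 - c * p.2| + |p.1| + |p.2| ≤ 1}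

theorem octaSection_subset (b c t : ℝ) : octaSection b c t ⊆ Icc (-1) 1 ×ˢ Icc (-1) 1 := by
  intro p hp
  have h : |t - b * p.1 - c * p.2| + |p.1| + |p.2| ≤ 1 := hp
  have h0 := abs_nonneg (t - b * p.1 - c * p.2)
  have h1 := abs_nonneg p.1
  have h2 := abs_nonneg p.2
  exact ⟨abs_le.1 (by linarith), abs_le.1 (by linarith)⟩

theorem isCompact_octaSection (b c t : ℝ) : IsCompact (octaSection b c t) :=
  (isCompact_Icc.prod isCompact_Icc).of_isClosed_subset (isClosed_le (by fun_prop) (by fun_prop))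
    (octaSection_subset b c t)

theorem sectionMoment_eq_lintegral (b c t : ℝ) :
    sectionMoment ![b, c, t] = ∫⁻ w : Fin 3 → ℝ × ℝ, ENNReal.ofReal
      (signedArea (fun i => (w i).1) (fun i => (w i).2) ^ 2)
        ∂(Measure.pi fun _ => volume.restrict (octaSection b c t)) := by
  have hc : MeasurableSet (univ.pi fun _ : Fin 3 => octaSection b c t) :=
    MeasurableSet.univ_pi fun _ => (isCompact_octaSection b c t).measurableSet
  rw [← Measure.restrict_pi_pi, ← lintegral_indicator hc, sectionMoment,
    ← (volume_measurePreserving_arrowProdEquivProdArrow ℝ ℝ (Fin 3)).lintegral_comp_emb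
      (MeasurableEquiv.measurableEmbedding _)]
  refine lintegral_congr fun w => ?_
  have e : MeasurableEquiv.arrowProdEquivProdArrow ℝ ℝ (Fin 3) w
    = (fun i => (w i).1, fun i => (w i).2) := rfl
  have h : MeasurableEquiv.arrowProdEquivProdArrow ℝ ℝ (Fin 3) w ∈ sectionTriples ![b, c, t]
      ↔ w ∈ univ.pi fun _ : Fin 3 => octaSection b c t := by
    simp [e, sectionTriples, planeLift, octaSection, Set.mem_pi]
  by_cases hw : w ∈ univ.pi fun _ : Fin 3 => octaSection b c t
  · rw [indicator_of_mem hw, indicator_of_mem (h.2 hw), e]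
  · rw [indicator_of_notMem hw, indicator_of_notMem (mt h.1 hw)]

theorem sectionMoment_eq {b c t m₀₀ m₁₀ m₀₁ m₂₀ m₁₁ m₀₂ : ℝ}
    (h : HasMoments (octaSection b c t) m₀₀ m₁₀ m₀₁ m₂₀ m₁₁ m₀₂) :
    0 ≤ gramDet m₀₀ m₁₀ m₀₁ m₂₀ m₁₁ m₀₂ ∧
      sectionMoment ![b, c, t] = ENNReal.ofReal (6 * gramDet m₀₀ m₁₀ m₀₁ m₂₀ m₁₁ m₀₂) := by
  have hf : ∀ i : Fin 3, Continuous fun p : ℝ × ℝ => ![1, p.1, p.2] i := by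
    intro i
    fin_cases i <;> simp <;> fun_prop
  obtain ⟨hi, hd⟩ := integral_det_sq (ι := Fin 3) (μ := volume.restrict (octaSection b c t))
    (φ := fun i p => ![1, p.1, p.2] i)
    fun i j => ((hf i).mul (hf j)).continuousOn.integrableOn_compact (isCompact_octaSection b c t)
  have e : ∀ w : Fin 3 → ℝ × ℝ, (Matrix.of fun i j => (![1, (w j).1, (w j).2] : Fin 3 → ℝ) i).det
      = signedArea (fun i => (w i).1) (fun i => (w i).2) := by
    intro w
    rw [Matrix.det_fin_three]
    simp [signedArea]
    ring
  simp only [e] at hi hd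
  have k00 : ∫ p in octaSection b c t, (1 : ℝ) = m₀₀ := by simpa using h 1 0 0 0 0 0
  have k10 : ∫ p in octaSection b c t, p.1 = m₁₀ := by simpa using h 0 1 0 0 0 0
  have k01 : ∫ p in octaSection b c t, p.2 = m₀₁ := by simpa using h 0 0 1 0 0 0
  have k20 : ∫ p in octaSection b c t, p.1 ^ 2 = m₂₀ := by simpa using h 0 0 0 1 0 0
  have k11 : ∫ p in octaSection b c t, p.1 * p.2 = m₁₁ := by simpa using h 0 0 0 0 1 0
  have k02 : ∫ p in octaSection b c t, p.2 ^ 2 = m₀₂ := by simpa using h 0 0 0 0 0 1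
  have k11' : ∫ p in octaSection b c t, p.2 * p.1 = m₁₁ := by simpa only [mul_comm] using k11
  have hg : (Matrix.of fun i j => ∫ p in octaSection b c t, (![1, p.1, p.2] : Fin 3 → ℝ) i
      * (![1, p.1, p.2] : Fin 3 → ℝ) j).det = gramDet m₀₀ m₁₀ m₀₁ m₂₀ m₁₁ m₀₂ := by
    rw [Matrix.det_fin_three]
    simp only [Matrix.of_apply, Matrix.cons_val_zero, Matrix.cons_val_one, Matrix.cons_val,
      one_mul, mul_one, ← sq, one_pow, k00, k10, k01, k20, k11, k11', k02, gramDet]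
    ring
  rw [hg, show (Fintype.card (Equiv.Perm (Fin 3)) : ℝ) = 6 by
    rw [Fintype.card_perm]; norm_num [Nat.factorial]] at hd
  have hp : 0 ≤ 6 * gramDet m₀₀ m₁₀ m₀₁ m₂₀ m₁₁ m₀₂ := by
    rw [← hd]
    exact integral_nonneg fun w => sq_nonneg _
  refine ⟨by linarith, ?_⟩
  rw [sectionMoment_eq_lintegral, ← hd, ofReal_integral_eq_lintegral_ofReal hi
    (Filter.Eventually.of_forall fun w => sq_nonneg _)]

theorem HasMoments.congr {P Q : Set (ℝ × ℝ)} {m₀₀ m₁₀ m₀₁ m₂₀ m₁₁ m₀₂ : ℝ}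
    (h : HasMoments P m₀₀ m₁₀ m₀₁ m₂₀ m₁₁ m₀₂) (e : Q =ᵐ[volume] P) :
    HasMoments Q m₀₀ m₁₀ m₀₁ m₂₀ m₁₁ m₀₂ := by
  intro a b c d e' f
  rw [setIntegral_congr_set e]
  exact h a b c d e' f

theorem integrableOn_quadratic {P : Set (ℝ × ℝ)} (hP : Bornology.IsBounded P) (a b c d e f : ℝ) :
    IntegrableOn (fun p : ℝ × ℝ => a + b * p.1 + c * p.2 + d * p.1 ^ 2 + e * (p.1 * p.2) + f * p.2 ^ 2)
      P :=
  (Continuous.continuousOn (by fun_prop)).integrableOn_compact hP.isCompact_closure |>.mono_set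
    subset_closure

theorem HasMoments.union {P Q : Set (ℝ × ℝ)} {m₀₀ m₁₀ m₀₁ m₂₀ m₁₁ m₀₂ n₀₀ n₁₀ n₀₁ n₂₀ n₁₁ n₀₂ : ℝ}
    (hP : HasMoments P m₀₀ m₁₀ m₀₁ m₂₀ m₁₁ m₀₂) (hQ : HasMoments Q n₀₀ n₁₀ n₀₁ n₂₀ n₁₁ n₀₂)
    (bP : Bornology.IsBounded P) (bQ : Bornology.IsBounded Q) (mQ : MeasurableSet Q)
    (hd : Disjoint P Q) :
    HasMoments (P ∪ Q) (m₀₀ + n₀₀) (m₁₀ + n₁₀) (m₀₁ + n₀₁) (m₂₀ + n₂₀) (m₁₁ + n₁₁) (m₀₂ + n₀₂) := by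
  intro a b c d e f
  rw [setIntegral_union hd mQ (integrableOn_quadratic bP a b c d e f)
    (integrableOn_quadratic bQ a b c d e f), hP, hQ]
  ring

theorem HasMoments.diff {P Q : Set (ℝ × ℝ)} {m₀₀ m₁₀ m₀₁ m₂₀ m₁₁ m₀₂ n₀₀ n₁₀ n₀₁ n₂₀ n₁₁ n₀₂ : ℝ}
    (hP : HasMoments P m₀₀ m₁₀ m₀₁ m₂₀ m₁₁ m₀₂) (hQ : HasMoments Q n₀₀ n₁₀ n₀₁ n₂₀ n₁₁ n₀₂)
    (bP : Bornology.IsBounded P) (mQ : MeasurableSet Q) (hs : Q ⊆ P) :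
    HasMoments (P \ Q) (m₀₀ - n₀₀) (m₁₀ - n₁₀) (m₀₁ - n₀₁) (m₂₀ - n₂₀) (m₁₁ - n₁₁) (m₀₂ - n₀₂) := by
  intro a b c d e f
  rw [setIntegral_sdiff mQ (integrableOn_quadratic bP a b c d e f) hs, hP, hQ]
  ring

theorem HasMoments.affine {P : Set (ℝ × ℝ)} {m₀₀ m₁₀ m₀₁ m₂₀ m₁₁ m₀₂ a b c d u v : ℝ}
    (mP : MeasurableSet P) (hJ : a * d - b * c ≠ 0)
    (h : HasMoments ((fun p : ℝ × ℝ => (a * p.1 + b * p.2 + u, c * p.1 + d * p.2 + v)) ⁻¹' P)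
      m₀₀ m₁₀ m₀₁ m₂₀ m₁₁ m₀₂) :
    HasMoments P (|a * d - b * c| * m₀₀) (|a * d - b * c| * (a * m₁₀ + b * m₀₁ + u * m₀₀))
      (|a * d - b * c| * (c * m₁₀ + d * m₀₁ + v * m₀₀))
      (|a * d - b * c| * (a ^ 2 * m₂₀ + 2 * a * b * m₁₁ + b ^ 2 * m₀₂
        + 2 * u * (a * m₁₀ + b * m₀₁) + u ^ 2 * m₀₀))
      (|a * d - b * c| * (a * c * m₂₀ + (a * d + b * c) * m₁₁ + b * d * m₀₂
        + v * (a * m₁₀ + b * m₀₁) + u * (c * m₁₀ + d * m₀₁) + u * v * m₀₀))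
      (|a * d - b * c| * (c ^ 2 * m₂₀ + 2 * c * d * m₁₁ + d ^ 2 * m₀₂
        + 2 * v * (c * m₁₀ + d * m₀₁) + v ^ 2 * m₀₀)) := by
  let g : ℝ × ℝ → ℝ × ℝ := fun p => (a * p.1 + b * p.2 + u, c * p.1 + d * p.2 + v)
  let A : ℝ × ℝ →L[ℝ] ℝ × ℝ := LinearMap.toContinuousLinearMap
    (Matrix.toLin (Module.Basis.finTwoProd ℝ) (Module.Basis.finTwoProd ℝ) !![a, b; c, d])
  have hA : A.det = a * d - b * c := by
    rw [ContinuousLinearMap.det, LinearMap.coe_toContinuousLinearMap, LinearMap.det_toLin,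
      Matrix.det_fin_two_of]
  have hAp : ∀ p, A p = (a * p.1 + b * p.2, c * p.1 + d * p.2) := fun p => by
    simp [A, Matrix.toLin_finTwoProd_apply]
  have hg : ∀ p, HasFDerivAt g A p := by
    intro p
    have e : g = fun p => A p + (u, v) := by
      funext p
      rw [hAp]
      rfl
    rw [e]
    exact A.hasFDerivAt.add_const _
  have hc : Continuous g := by fun_prop
  have hi : Function.Injective g := by
    intro p q hpq
    have h1 : a * p.1 + b * p.2 + u = a * q.1 + b * q.2 + u := congrArg Prod.fst hpq
    have h2 : c * p.1 + d * p.2 + v = c * q.1 + d * q.2 + v := congrArg Prod.snd hpq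
    refine Prod.ext (mul_left_cancel₀ hJ ?_) (mul_left_cancel₀ hJ ?_)
    · linear_combination d * h1 - b * h2
    · linear_combination a * h2 - c * h1
  have hs : Function.Surjective g := by
    intro p
    refine ⟨((d * (p.1 - u) - b * (p.2 - v)) / (a * d - b * c),
      (a * (p.2 - v) - c * (p.1 - u)) / (a * d - b * c)), Prod.ext ?_ ?_⟩
    · simp only [g]
      field_simp
      ring
    · have e : c * (d * (p.1 - u) - b * (p.2 - v)) + d * (a * (p.2 - v) - c * (p.1 - u))
          = (p.2 - v) * (a * d - b * c) := by ring
      simp only [g]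
      rw [mul_div_assoc', mul_div_assoc', ← add_div, e, mul_div_cancel_right₀ _ hJ]
      ring
  intro k₀ k₁ k₂ k₃ k₄ k₅
  have key := integral_image_eq_integral_abs_det_fderiv_smul volume (hc.measurable mP)
    (fun p _ => (hg p).hasFDerivWithinAt) hi.injOn
    (fun p : ℝ × ℝ => k₀ + k₁ * p.1 + k₂ * p.2 + k₃ * p.1 ^ 2 + k₄ * (p.1 * p.2) + k₅ * p.2 ^ 2)
  rw [image_preimage_eq _ hs, hA] at key
  rw [key]
  have h' := h (k₀ + k₁ * u + k₂ * v + k₃ * u ^ 2 + k₄ * u * v + k₅ * v ^ 2)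
    (k₁ * a + k₂ * c + 2 * k₃ * a * u + k₄ * (a * v + c * u) + 2 * k₅ * c * v)
    (k₁ * b + k₂ * d + 2 * k₃ * b * u + k₄ * (b * v + d * u) + 2 * k₅ * d * v)
    (k₃ * a ^ 2 + k₄ * a * c + k₅ * c ^ 2)
    (2 * k₃ * a * b + k₄ * (a * d + b * c) + 2 * k₅ * c * d)
    (k₃ * b ^ 2 + k₄ * b * d + k₅ * d ^ 2)
  simp only [smul_eq_mul]
  rw [integral_const_mul]
  have e : ∀ p : ℝ × ℝ, k₀ + k₁ * (g p).1 + k₂ * (g p).2 + k₃ * (g p).1 ^ 2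
      + k₄ * ((g p).1 * (g p).2) + k₅ * (g p).2 ^ 2
      = (k₀ + k₁ * u + k₂ * v + k₃ * u ^ 2 + k₄ * u * v + k₅ * v ^ 2)
      + (k₁ * a + k₂ * c + 2 * k₃ * a * u + k₄ * (a * v + c * u) + 2 * k₅ * c * v) * p.1
      + (k₁ * b + k₂ * d + 2 * k₃ * b * u + k₄ * (b * v + d * u) + 2 * k₅ * d * v) * p.2
      + (k₃ * a ^ 2 + k₄ * a * c + k₅ * c ^ 2) * p.1 ^ 2
      + (2 * k₃ * a * b + k₄ * (a * d + b * c) + 2 * k₅ * c * d) * (p.1 * p.2)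
      + (k₃ * b ^ 2 + k₄ * b * d + k₅ * d ^ 2) * p.2 ^ 2 := by
    intro p
    simp only [g]
    ring
  simp only [e]
  rw [h']
  ring

theorem hasMoments_unitTriangle :
    HasMoments {p | 0 < p.1 ∧ 0 < p.2 ∧ p.1 + p.2 < 1} (1 / 2) (1 / 6) (1 / 6) (1 / 12) (1 / 24)
      (1 / 12) := by
  intro a b c d e f
  set T : Set (ℝ × ℝ) := {p | 0 < p.1 ∧ 0 < p.2 ∧ p.1 + p.2 < 1} with hTdef
  have hT : MeasurableSet T := by
    rw [hTdef, ofPred_and, ofPred_and]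
    refine IsOpen.measurableSet ?_
    refine (isOpen_lt ?_ ?_).inter ((isOpen_lt ?_ ?_).inter (isOpen_lt ?_ ?_)) <;> fun_prop
  have bT : Bornology.IsBounded T := by
    refine (Metric.isBounded_Icc (0 : ℝ) 1).prod (Metric.isBounded_Icc (0 : ℝ) 1) |>.subset ?_
    rintro p ⟨h1, h2, h3⟩
    exact ⟨⟨h1.le, by linarith⟩, ⟨h2.le, by linarith⟩⟩
  have hi := integrableOn_quadratic bT a b c d e f
  rw [← integral_indicator hT, Measure.volume_eq_prod,
    integral_prod _ ((integrable_indicator_iff hT).2 hi)]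
  have h1 : ∀ x : ℝ, ∫ y, T.indicator (fun p : ℝ × ℝ =>
      a + b * p.1 + c * p.2 + d * p.1 ^ 2 + e * (p.1 * p.2) + f * p.2 ^ 2) (x, y)
      = (Ioc 0 1).indicator (fun x => (a + b * x + d * x ^ 2) * (1 - x)
        + (c + e * x) * (1 - x) ^ 2 / 2 + f * (1 - x) ^ 3 / 3) x := by
    intro x
    by_cases hx : x ∈ Ioc 0 1
    · have e1 : ∀ y, T.indicator (fun p : ℝ × ℝ =>
          a + b * p.1 + c * p.2 + d * p.1 ^ 2 + e * (p.1 * p.2) + f * p.2 ^ 2) (x, y)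
          = (Ioo 0 (1 - x)).indicator (fun y =>
            a + b * x + c * y + d * x ^ 2 + e * (x * y) + f * y ^ 2) y := by
        intro y
        have h : (x, y) ∈ T ↔ y ∈ Ioo 0 (1 - x) :=
          ⟨fun h => ⟨h.2.1, by linarith [h.2.2]⟩, fun h => ⟨hx.1, h.1, by linarith [h.2]⟩⟩
        by_cases hy : y ∈ Ioo 0 (1 - x)
        · rw [indicator_of_mem hy, indicator_of_mem (h.2 hy)]
        · rw [indicator_of_notMem hy, indicator_of_notMem (mt h.1 hy)]
      simp only [e1]
      rw [integral_indicator measurableSet_Ioo, ← integral_Ioc_eq_integral_Ioo,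
        ← intervalIntegral.integral_of_le (by linarith [hx.2]), indicator_of_mem hx]
      have hd : ∀ y, HasDerivAt (fun y => (a + b * x + d * x ^ 2) * y + (c + e * x) * y ^ 2 / 2
          + f * y ^ 3 / 3) (a + b * x + c * y + d * x ^ 2 + e * (x * y) + f * y ^ 2) y := by
        intro y
        have := (((hasDerivAt_id y).const_mul (a + b * x + d * x ^ 2)).add
          ((((hasDerivAt_id y).pow 2).const_mul (c + e * x)).div_const 2)).add
          ((((hasDerivAt_id y).pow 3).const_mul f).div_const 3)
        refine this.congr_deriv ?_
        simp
        ring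
      rw [intervalIntegral.integral_eq_sub_of_hasDerivAt (fun y _ => hd y)
        (Continuous.intervalIntegrable (by fun_prop) _ _)]
      ring
    · rw [indicator_of_notMem hx]
      refine integral_eq_zero_of_ae (Filter.Eventually.of_forall fun y => ?_)
      refine indicator_of_notMem (fun h => hx ⟨h.1, ?_⟩) _
      linarith [h.2.1, h.2.2]
  simp only [h1]
  rw [integral_indicator measurableSet_Ioc, ← intervalIntegral.integral_of_le zero_le_one]
  have hd : ∀ x ∈ uIcc (0 : ℝ) 1, HasDerivAt (fun x : ℝ => a * (x - x ^ 2 / 2) + b * (x ^ 2 / 2 - x ^ 3 / 3)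
      + d * (x ^ 3 / 3 - x ^ 4 / 4) - c * (1 - x) ^ 3 / 6
      + e * (x ^ 2 / 4 - x ^ 3 / 3 + x ^ 4 / 8) - f * (1 - x) ^ 4 / 12)
      ((a + b * x + d * x ^ 2) * (1 - x) + (c + e * x) * (1 - x) ^ 2 / 2 + f * (1 - x) ^ 3 / 3) x := by
    intro x _
    have i := hasDerivAt_id x
    have j := i.const_sub 1
    have := ((((((i.sub ((i.pow 2).div_const 2)).const_mul a).add
      ((((i.pow 2).div_const 2).sub ((i.pow 3).div_const 3)).const_mul b)).add
      ((((i.pow 3).div_const 3).sub ((i.pow 4).div_const 4)).const_mul d)).sub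
      (((j.pow 3).const_mul c).div_const 6)).add
      (((((i.pow 2).div_const 4).sub ((i.pow 3).div_const 3)).add ((i.pow 4).div_const 8)).const_mul e)).sub
      (((j.pow 4).const_mul f).div_const 12)
    refine this.congr_deriv ?_
    simp
    ring
  rw [intervalIntegral.integral_eq_sub_of_hasDerivAt hd
    (Continuous.intervalIntegrable (by fun_prop) _ _)]
  ring

theorem hasMoments_unitSquare :
    HasMoments (Ioc 0 1 ×ˢ Ioc 0 1) 1 (1 / 2) (1 / 2) (1 / 3) (1 / 4) (1 / 3) := by
  intro a b c d e f
  have hi := integrableOn_quadratic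
    ((Metric.isBounded_Ioc (0 : ℝ) 1).prod (Metric.isBounded_Ioc (0 : ℝ) 1)) a b c d e f
  rw [Measure.volume_eq_prod, setIntegral_prod _ hi]
  have h1 : ∀ x : ℝ, ∫ y in Ioc (0 : ℝ) 1, (a + b * x + c * y + d * x ^ 2 + e * (x * y) + f * y ^ 2)
      = a + c / 2 + f / 3 + (b + e / 2) * x + d * x ^ 2 := by
    intro x
    rw [← intervalIntegral.integral_of_le zero_le_one]
    have hd : ∀ y ∈ uIcc (0 : ℝ) 1, HasDerivAt (fun y => (a + b * x + d * x ^ 2) * y + (c + e * x) * y ^ 2 / 2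
        + f * y ^ 3 / 3) (a + b * x + c * y + d * x ^ 2 + e * (x * y) + f * y ^ 2) y := by
      intro y _
      have := (((hasDerivAt_id y).const_mul (a + b * x + d * x ^ 2)).add
        ((((hasDerivAt_id y).pow 2).const_mul (c + e * x)).div_const 2)).add
        ((((hasDerivAt_id y).pow 3).const_mul f).div_const 3)
      refine this.congr_deriv ?_
      simp
      ring
    rw [intervalIntegral.integral_eq_sub_of_hasDerivAt hd
      (Continuous.intervalIntegrable (by fun_prop) _ _)]
    ring
  simp only [h1]
  rw [← intervalIntegral.integral_of_le zero_le_one]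
  have hd : ∀ x ∈ uIcc (0 : ℝ) 1, HasDerivAt (fun x => (a + c / 2 + f / 3) * x + (b + e / 2) * x ^ 2 / 2
      + d * x ^ 3 / 3) (a + c / 2 + f / 3 + (b + e / 2) * x + d * x ^ 2) x := by
    intro x _
    have := (((hasDerivAt_id x).const_mul (a + c / 2 + f / 3)).add
      ((((hasDerivAt_id x).pow 2).const_mul (b + e / 2)).div_const 2)).add
      ((((hasDerivAt_id x).pow 3).const_mul d).div_const 3)
    refine this.congr_deriv ?_
    simp
    ring
  rw [intervalIntegral.integral_eq_sub_of_hasDerivAt hd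
    (Continuous.intervalIntegrable (by fun_prop) _ _)]
  ring

/-- The right triangle with vertices `0`, `(r / k, 0)` and `(0, r / l)`. -/
def cornerTriangle (k l r : ℝ) : Set (ℝ × ℝ) := {p | 0 < k * p.1 ∧ 0 < l * p.2 ∧ k * p.1 + l * p.2 < r}

theorem measurableSet_cornerTriangle (k l r : ℝ) : MeasurableSet (cornerTriangle k l r) := by
  rw [cornerTriangle, ofPred_and, ofPred_and]
  refine IsOpen.measurableSet ?_
  refine (isOpen_lt ?_ ?_).inter ((isOpen_lt ?_ ?_).inter (isOpen_lt ?_ ?_)) <;> fun_prop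

theorem hasMoments_cornerTriangle {k l r : ℝ} (hk : k ≠ 0) (hl : l ≠ 0) (hr : 0 < r) :
    HasMoments (cornerTriangle k l r) (|r / k * (r / l)| * (1 / 2)) (|r / k * (r / l)| * (r / k / 6))
      (|r / k * (r / l)| * (r / l / 6)) (|r / k * (r / l)| * ((r / k) ^ 2 / 12))
      (|r / k * (r / l)| * (r / k * (r / l) / 24)) (|r / k * (r / l)| * ((r / l) ^ 2 / 12)) := by
  have h := HasMoments.affine (P := cornerTriangle k l r) (a := r / k) (b := 0) (c := 0) (d := r / l)
    (u := 0) (v := 0) (m₀₀ := 1 / 2) (m₁₀ := 1 / 6) (m₀₁ := 1 / 6) (m₂₀ := 1 / 12) (m₁₁ := 1 / 24)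
    (m₀₂ := 1 / 12) (measurableSet_cornerTriangle k l r)
    (by simp only [mul_zero, sub_zero]; positivity) ?_
  · convert h using 1 <;> simp only [mul_zero, zero_mul, sub_zero] <;> ring
  · convert hasMoments_unitTriangle using 1
    ext p
    have e1 : k * (r / k * p.1 + 0 * p.2 + 0) = r * p.1 := by field_simp; ring
    have e2 : l * (0 * p.1 + r / l * p.2 + 0) = r * p.2 := by field_simp; ring
    simp only [cornerTriangle, mem_preimage, mem_ofPred_eq, e1, e2]
    rw [mul_pos_iff_of_pos_left hr, mul_pos_iff_of_pos_left hr, ← mul_add, mul_lt_iff_lt_one_right hr]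

theorem gramDet_affine (j m₀₀ m₁₀ m₀₁ m₂₀ m₁₁ m₀₂ a b c d u v : ℝ) :
    gramDet (j * m₀₀) (j * (a * m₁₀ + b * m₀₁ + u * m₀₀)) (j * (c * m₁₀ + d * m₀₁ + v * m₀₀))
      (j * (a ^ 2 * m₂₀ + 2 * a * b * m₁₁ + b ^ 2 * m₀₂
        + 2 * u * (a * m₁₀ + b * m₀₁) + u ^ 2 * m₀₀))
      (j * (a * c * m₂₀ + (a * d + b * c) * m₁₁ + b * d * m₀₂
        + v * (a * m₁₀ + b * m₀₁) + u * (c * m₁₀ + d * m₀₁) + u * v * m₀₀))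
      (j * (c ^ 2 * m₂₀ + 2 * c * d * m₁₁ + d ^ 2 * m₀₂
        + 2 * v * (c * m₁₀ + d * m₀₁) + v ^ 2 * m₀₀))
      = j ^ 3 * (a * d - b * c) ^ 2 * gramDet m₀₀ m₁₀ m₀₁ m₂₀ m₁₁ m₀₂ := by
  unfold gramDet
  ring

theorem ae_ne_line {a b : ℝ} (hb : b ≠ 0) (r : ℝ) : ∀ᵐ p : ℝ × ℝ, a * p.1 + b * p.2 ≠ r := by
  have hm : MeasurableSet {p : ℝ × ℝ | a * p.1 + b * p.2 = r} :=
    (isClosed_eq (by fun_prop) (by fun_prop)).measurableSet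
  have h : volume {p : ℝ × ℝ | a * p.1 + b * p.2 = r} = 0 := by
    rw [Measure.volume_eq_prod, Measure.measure_prod_null hm]
    refine Filter.Eventually.of_forall fun x => ?_
    refine measure_mono_null (t := {(r - a * x) / b}) ?_ Real.volume_singleton
    intro y hy
    have hy : a * x + b * y = r := hy
    rw [mem_singleton_iff, eq_div_iff hb]
    linarith
  filter_upwards [compl_mem_ae_iff.2 h] with p hp
  exact hp

theorem ae_fst_ne (r : ℝ) : ∀ᵐ p : ℝ × ℝ, p.1 ≠ r :=
  Measure.quasiMeasurePreserving_fst.ae (Measure.ae_ne volume r)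

theorem ae_snd_ne (r : ℝ) : ∀ᵐ p : ℝ × ℝ, p.2 ≠ r :=
  Measure.quasiMeasurePreserving_snd.ae (Measure.ae_ne volume r)

theorem isBounded_cornerTriangle {k l : ℝ} (hk : k ≠ 0) (hl : l ≠ 0) (r : ℝ) :
    Bornology.IsBounded (cornerTriangle k l r) := by
  refine (Metric.isBounded_Icc (-(r / |k|)) (r / |k|)).prod (Metric.isBounded_Icc (-(r / |l|)) (r / |l|))
    |>.subset ?_
  rintro p ⟨h1, h2, h3⟩
  have hk' := abs_pos.2 hk
  have hl' := abs_pos.2 hl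
  refine ⟨abs_le.1 ?_, abs_le.1 ?_⟩
  · rw [le_div_iff₀ hk', ← abs_mul, mul_comm, abs_of_pos h1]
    linarith
  · rw [le_div_iff₀ hl', ← abs_mul, mul_comm, abs_of_pos h2]
    linarith

theorem mem_octaSection_iff {b c t : ℝ} (hb : |b| ≤ t) (hc : |c| ≤ t) (ht : t < 1) (p : ℝ × ℝ) :
    p ∈ octaSection b c t ↔ t - b * p.1 - c * p.2 + |p.1| + |p.2| ≤ 1 := by
  refine ⟨fun h => ?_, fun h => ?_⟩
  · have h : |t - b * p.1 - c * p.2| + |p.1| + |p.2| ≤ 1 := h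
    linarith [le_abs_self (t - b * p.1 - c * p.2)]
  · have h1 : b * p.1 ≤ t * |p.1| := (le_abs_self _).trans (by
      rw [abs_mul]; exact mul_le_mul_of_nonneg_right hb (abs_nonneg _))
    have h2 : c * p.2 ≤ t * |p.2| := (le_abs_self _).trans (by
      rw [abs_mul]; exact mul_le_mul_of_nonneg_right hc (abs_nonneg _))
    have h3 : 0 ≤ t - b * p.1 - c * p.2 := by
      nlinarith [abs_nonneg b]
    change |t - b * p.1 - c * p.2| + |p.1| + |p.2| ≤ 1
    rwa [abs_of_nonneg h3]

theorem octaSection_ae_eq {b c t : ℝ} (hc : 0 < c) (hcb : c < b) (hbt : b < t) (ht : t < 1) :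
    octaSection b c t =ᵐ[volume] (cornerTriangle (1 - b) (1 - c) (1 - t) ∪
      cornerTriangle (-(1 + b)) (1 - c) (1 - t) ∪ cornerTriangle (1 - b) (-(1 + c)) (1 - t) ∪
      cornerTriangle (-(1 + b)) (-(1 + c)) (1 - t) : Set (ℝ × ℝ)) := by
  have hb : 0 < b := hc.trans hcb
  filter_upwards [ae_fst_ne 0, ae_snd_ne 0,
    ae_ne_line (a := 1 - b) (b := 1 - c) (by linarith) (1 - t),
    ae_ne_line (a := -(1 + b)) (b := 1 - c) (by linarith) (1 - t),
    ae_ne_line (a := 1 - b) (b := -(1 + c)) (by linarith) (1 - t),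
    ae_ne_line (a := -(1 + b)) (b := -(1 + c)) (by linarith) (1 - t)] with p hy hz l1 l2 l3 l4
  refine propext ?_
  change p ∈ octaSection b c t ↔ p ∈ (cornerTriangle (1 - b) (1 - c) (1 - t) ∪
      cornerTriangle (-(1 + b)) (1 - c) (1 - t) ∪ cornerTriangle (1 - b) (-(1 + c)) (1 - t) ∪
      cornerTriangle (-(1 + b)) (-(1 + c)) (1 - t) : Set (ℝ × ℝ))
  rw [mem_octaSection_iff (by rw [abs_of_pos hb]; exact hbt.le)
    (by rw [abs_of_pos hc]; linarith) ht]
  simp only [mem_union, cornerTriangle, mem_ofPred_eq]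
  have q1 : 0 < 1 - b := by linarith
  have q2 : 0 < 1 + b := by linarith
  have q3 : 0 < 1 - c := by linarith
  have q4 : 0 < 1 + c := by linarith
  rcases lt_or_gt_of_ne hy with hy | hy <;> rcases lt_or_gt_of_ne hz with hz | hz
  · have a1 := mul_neg_of_pos_of_neg q1 hy
    have a2 := mul_neg_of_pos_of_neg q2 hy
    have a3 := mul_neg_of_pos_of_neg q3 hz
    have a4 := mul_neg_of_pos_of_neg q4 hz
    rw [abs_of_neg hy, abs_of_neg hz]
    constructor
    · intro h
      exact Or.inr ⟨by linarith, by linarith, lt_of_le_of_ne (by linarith) l4⟩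
    · rintro (((⟨_, _, _⟩ | ⟨_, _, _⟩) | ⟨_, _, _⟩) | ⟨_, _, _⟩) <;> linarith
  · have a1 := mul_neg_of_pos_of_neg q1 hy
    have a2 := mul_neg_of_pos_of_neg q2 hy
    have a3 := mul_pos q3 hz
    have a4 := mul_pos q4 hz
    rw [abs_of_neg hy, abs_of_pos hz]
    constructor
    · intro h
      exact Or.inl (Or.inl (Or.inr ⟨by linarith, by linarith, lt_of_le_of_ne (by linarith) l2⟩))
    · rintro (((⟨_, _, _⟩ | ⟨_, _, _⟩) | ⟨_, _, _⟩) | ⟨_, _, _⟩) <;> linarith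
  · have a1 := mul_pos q1 hy
    have a2 := mul_pos q2 hy
    have a3 := mul_neg_of_pos_of_neg q3 hz
    have a4 := mul_neg_of_pos_of_neg q4 hz
    rw [abs_of_pos hy, abs_of_neg hz]
    constructor
    · intro h
      exact Or.inl (Or.inr ⟨by linarith, by linarith, lt_of_le_of_ne (by linarith) l3⟩)
    · rintro (((⟨_, _, _⟩ | ⟨_, _, _⟩) | ⟨_, _, _⟩) | ⟨_, _, _⟩) <;> linarith
  · have a1 := mul_pos q1 hy
    have a2 := mul_pos q2 hy
    have a3 := mul_pos q3 hz
    have a4 := mul_pos q4 hz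
    rw [abs_of_pos hy, abs_of_pos hz]
    constructor
    · intro h
      exact Or.inl (Or.inl (Or.inl ⟨by linarith, by linarith, lt_of_le_of_ne (by linarith) l1⟩))
    · rintro (((⟨_, _, _⟩ | ⟨_, _, _⟩) | ⟨_, _, _⟩) | ⟨_, _, _⟩) <;> linarith

theorem disjoint_cornerTriangle_left {k k' l l' r : ℝ} (hk : 0 < k) (hk' : 0 < k') :
    Disjoint (cornerTriangle k l r) (cornerTriangle (-k') l' r) := by
  refine disjoint_left.2 fun p h h' => ?_
  have h1 := (mul_pos_iff_of_pos_left hk).1 h.1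
  nlinarith [h'.1]

theorem disjoint_cornerTriangle_right {k k' l l' r : ℝ} (hl : 0 < l) (hl' : 0 < l') :
    Disjoint (cornerTriangle k l r) (cornerTriangle k' (-l') r) := by
  refine disjoint_left.2 fun p h h' => ?_
  have h1 := (mul_pos_iff_of_pos_left hl).1 h.2.1
  nlinarith [h'.2.1]

theorem exists_hasMoments_octaSection {b c t : ℝ} (hc : 0 < c) (hcb : c < b) (hbt : b < t)
    (ht : t < 1) :
    ∃ m₀₀ m₁₀ m₀₁ m₂₀ m₁₁ m₀₂, HasMoments (octaSection b c t) m₀₀ m₁₀ m₀₁ m₂₀ m₁₁ m₀₂ ∧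
      m₀₀ = 2 * (1 - t) ^ 2 / ((1 - b ^ 2) * (1 - c ^ 2)) ∧
      gramDet m₀₀ m₁₀ m₀₁ m₂₀ m₁₁ m₀₂ = gramDetA b c t := by
  have q1 : 0 < 1 - b := by linarith
  have q2 : 0 < 1 + b := by linarith
  have q3 : 0 < 1 - c := by linarith
  have q4 : 0 < 1 + c := by linarith
  have q2' : -(1 + b) ≠ 0 := by linarith
  have q4' : -(1 + c) ≠ 0 := by linarith
  have r : 0 < 1 - t := by linarith
  have h1 := hasMoments_cornerTriangle q1.ne' q3.ne' r
  have h2 := hasMoments_cornerTriangle q2' q3.ne' r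
  have h3 := hasMoments_cornerTriangle q1.ne' q4' r
  have h4 := hasMoments_cornerTriangle q2' q4' r
  have b1 := isBounded_cornerTriangle q1.ne' q3.ne' (1 - t)
  have b2 := isBounded_cornerTriangle q2' q3.ne' (1 - t)
  have b3 := isBounded_cornerTriangle q1.ne' q4' (1 - t)
  have b4 := isBounded_cornerTriangle q2' q4' (1 - t)
  have d : Disjoint (cornerTriangle (1 - b) (1 - c) (1 - t)) (cornerTriangle (-(1 + b)) (1 - c) (1 - t)) :=
    disjoint_cornerTriangle_left q1 q2
  have d' : Disjoint (cornerTriangle (1 - b) (1 - c) (1 - t) ∪ cornerTriangle (-(1 + b)) (1 - c) (1 - t))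
      (cornerTriangle (1 - b) (-(1 + c)) (1 - t)) :=
    (disjoint_cornerTriangle_right q3 q4).union_left (disjoint_cornerTriangle_right q3 q4)
  have d'' : Disjoint (cornerTriangle (1 - b) (1 - c) (1 - t) ∪ cornerTriangle (-(1 + b)) (1 - c) (1 - t) ∪
      cornerTriangle (1 - b) (-(1 + c)) (1 - t)) (cornerTriangle (-(1 + b)) (-(1 + c)) (1 - t)) :=
    ((disjoint_cornerTriangle_right q3 q4).union_left (disjoint_cornerTriangle_right q3 q4)).union_left
      (disjoint_cornerTriangle_left q1 q2)
  have h := ((h1.union h2 b1 b2 (measurableSet_cornerTriangle _ _ _) d).union h3 (b1.union b2) b3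
    (measurableSet_cornerTriangle _ _ _) d').union h4 ((b1.union b2).union b3) b4
    (measurableSet_cornerTriangle _ _ _) d''
  refine ⟨_, _, _, _, _, _, h.congr (octaSection_ae_eq hc hcb hbt ht), ?_, ?_⟩
  · simp only [abs_mul, abs_div, abs_neg, abs_of_pos q1, abs_of_pos q2, abs_of_pos q3, abs_of_pos q4,
      abs_of_pos r]
    rw [show 1 - b ^ 2 = (1 - b) * (1 + b) by ring, show 1 - c ^ 2 = (1 - c) * (1 + c) by ring]
    field_simp
    ring
  · simp only [abs_mul, abs_div, abs_neg, abs_of_pos q1, abs_of_pos q2, abs_of_pos q3, abs_of_pos q4,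
      abs_of_pos r, div_neg, gramDet, gramDetA]
    rw [show 1 - b ^ 2 = (1 - b) * (1 + b) by ring, show 1 - c ^ 2 = (1 - c) * (1 + c) by ring]
    field_simp
    ring

/-- The unit square with a right triangular corner removed at the origin and another at `(1, 1)`. -/
def cutSquare (k l r k' l' r' : ℝ) : Set (ℝ × ℝ) :=
  (Ioc 0 1 ×ˢ Ioc 0 1) \ (cornerTriangle k l r ∪ {p | (1 - p.1, 1 - p.2) ∈ cornerTriangle k' l' r'})

theorem cornerTriangle_subset {k l r : ℝ} (hk : 0 < k) (hl : 0 < l) (hrk : r ≤ k) (hrl : r ≤ l) :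
    cornerTriangle k l r ⊆ Ioo 0 1 ×ˢ Ioo 0 1 := by
  rintro p ⟨h1, h2, h3⟩
  refine ⟨⟨(mul_pos_iff_of_pos_left hk).1 h1, ?_⟩, ⟨(mul_pos_iff_of_pos_left hl).1 h2, ?_⟩⟩
  · by_contra! h
    nlinarith
  · by_contra! h
    nlinarith

theorem exists_hasMoments_cutSquare {k l r k' l' r' : ℝ} (hk : 0 < k) (hl : 0 < l) (hr : 0 < r)
    (hrk : r ≤ k) (hrl : r ≤ l) (hk' : 0 < k') (hl' : 0 < l') (hr' : 0 < r') (hrk' : r' ≤ k')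
    (hrl' : r' ≤ l')
    (hd : ∀ x y, 0 < x → 0 < y → k * x + l * y < r → r' ≤ k' * (1 - x) + l' * (1 - y)) :
    ∃ m₀₀ m₁₀ m₀₁ m₂₀ m₁₁ m₀₂, HasMoments (cutSquare k l r k' l' r') m₀₀ m₁₀ m₀₁ m₂₀ m₁₁ m₀₂ ∧
      m₀₀ = 1 - r / k * (r / l) / 2 - r' / k' * (r' / l') / 2 ∧
      gramDet m₀₀ m₁₀ m₀₁ m₂₀ m₁₁ m₀₂ = cornerDet (r / k) (r / l) (r' / k') (r' / l') := by
  have mT : MeasurableSet {p : ℝ × ℝ | (1 - p.1, 1 - p.2) ∈ cornerTriangle k' l' r'} :=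
    (by fun_prop : Measurable fun p : ℝ × ℝ => (1 - p.1, 1 - p.2))
      (measurableSet_cornerTriangle k' l' r')
  have e : (fun p : ℝ × ℝ => (-1 * p.1 + 0 * p.2 + 1, 0 * p.1 + -1 * p.2 + 1)) ⁻¹'
      {p : ℝ × ℝ | (1 - p.1, 1 - p.2) ∈ cornerTriangle k' l' r'} = cornerTriangle k' l' r' := by
    ext p
    simp only [mem_preimage, mem_ofPred_eq]
    ring_nf
  have h1 := hasMoments_cornerTriangle hk.ne' hl.ne' hr
  have h2 := hasMoments_cornerTriangle hk'.ne' hl'.ne' hr'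
  rw [← e] at h2
  have h2 := HasMoments.affine mT (by norm_num) h2
  have s1 := cornerTriangle_subset hk hl hrk hrl
  have s2 : {p : ℝ × ℝ | (1 - p.1, 1 - p.2) ∈ cornerTriangle k' l' r'} ⊆ Ioo 0 1 ×ˢ Ioo 0 1 := by
    intro p hp
    obtain ⟨⟨a1, a2⟩, ⟨a3, a4⟩⟩ := cornerTriangle_subset hk' hl' hrk' hrl' hp
    exact ⟨⟨by linarith, by linarith⟩, ⟨by linarith, by linarith⟩⟩
  have s3 : Ioo (0 : ℝ) 1 ×ˢ Ioo (0 : ℝ) 1 ⊆ Ioc 0 1 ×ˢ Ioc 0 1 :=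
    prod_mono Ioo_subset_Ioc_self Ioo_subset_Ioc_self
  have bS : Bornology.IsBounded (Ioo (0 : ℝ) 1 ×ˢ Ioo (0 : ℝ) 1) :=
    (Metric.isBounded_Ioo 0 1).prod (Metric.isBounded_Ioo 0 1)
  have d : Disjoint (cornerTriangle k l r)
      {p : ℝ × ℝ | (1 - p.1, 1 - p.2) ∈ cornerTriangle k' l' r'} := by
    refine disjoint_left.2 fun p h h' => ?_
    obtain ⟨⟨a1, -⟩, ⟨a2, -⟩⟩ := s1 h
    exact absurd h'.2.2 (not_lt.2 (hd p.1 p.2 a1 a2 h.2.2))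
  have h := hasMoments_unitSquare.diff (h1.union h2 (bS.subset s1) (bS.subset s2) mT d)
    ((Metric.isBounded_Ioc 0 1).prod (Metric.isBounded_Ioc 0 1))
    ((measurableSet_cornerTriangle k l r).union mT) (union_subset (s1.trans s3) (s2.trans s3))
  refine ⟨_, _, _, _, _, _, h, ?_, ?_⟩
  · rw [abs_of_pos (by positivity : 0 < r / k * (r / l)),
      abs_of_pos (by positivity : 0 < r' / k' * (r' / l'))]
    norm_num
    ring
  · rw [abs_of_pos (by positivity : 0 < r / k * (r / l)),
      abs_of_pos (by positivity : 0 < r' / k' * (r' / l')), gramDet, cornerDet]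
    generalize r / k = p
    generalize r / l = q
    generalize r' / k' = p'
    generalize r' / l' = q'
    norm_num
    ring

theorem abs_add_abs_add_abs_le_iff {α β r x y : ℝ} :
    |r - α * x + β * y| + |r + (1 - α) * x - (1 - β) * y| + |1 - x - y| ≤ 1 ↔
      (0 ≤ x ∧ x ≤ 1 ∧ 0 ≤ y ∧ y ≤ 1) ∧ r ≤ α * x + (1 - β) * y ∧ -r ≤ (1 - α) * x + β * y ∧
      r + β - α ≤ (1 - α) * (1 - x) + β * (1 - y) ∧
      -(r + β - α) ≤ α * (1 - x) + (1 - β) * (1 - y) := by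
  constructor
  · intro h
    have a1 := le_abs_self (r - α * x + β * y)
    have a2 := neg_abs_le (r - α * x + β * y)
    have b1 := le_abs_self (r + (1 - α) * x - (1 - β) * y)
    have b2 := neg_abs_le (r + (1 - α) * x - (1 - β) * y)
    have c1 := le_abs_self (1 - x - y)
    have c2 := neg_abs_le (1 - x - y)
    refine ⟨⟨?_, ?_, ?_, ?_⟩, ?_, ?_, ?_, ?_⟩ <;> linarith
  · rintro ⟨⟨_, _, _, _⟩, _, _, _, _⟩
    rcases abs_cases (r - α * x + β * y) with ⟨h1, _⟩ | ⟨h1, _⟩ <;>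
    rcases abs_cases (r + (1 - α) * x - (1 - β) * y) with ⟨h2, _⟩ | ⟨h2, _⟩ <;>
    rcases abs_cases (1 - x - y) with ⟨h3, _⟩ | ⟨h3, _⟩ <;>
    rw [h1, h2, h3] <;> linarith

theorem preimage_octaSection {α β : ℝ} (hN : 2 - α - β ≠ 0) (r : ℝ) :
    (fun p : ℝ × ℝ => ((1 - α) * p.1 + -(1 - β) * p.2 + r, -1 * p.1 + -1 * p.2 + 1)) ⁻¹'
      octaSection ((α + β) / (2 - α - β)) ((β - α) / (2 - α - β)) ((2 * r + β - α) / (2 - α - β)) =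
      {p | (0 ≤ p.1 ∧ p.1 ≤ 1 ∧ 0 ≤ p.2 ∧ p.2 ≤ 1) ∧ r ≤ α * p.1 + (1 - β) * p.2 ∧
        -r ≤ (1 - α) * p.1 + β * p.2 ∧
        r + β - α ≤ (1 - α) * (1 - p.1) + β * (1 - p.2) ∧
        -(r + β - α) ≤ α * (1 - p.1) + (1 - β) * (1 - p.2)} := by
  ext p
  simp only [mem_preimage, octaSection, mem_ofPred_eq]
  rw [← abs_add_abs_add_abs_le_iff]
  have e : (2 * r + β - α) / (2 - α - β)
      - (α + β) / (2 - α - β) * ((1 - α) * p.1 + -(1 - β) * p.2 + r)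
      - (β - α) / (2 - α - β) * (-1 * p.1 + -1 * p.2 + 1) = r - α * p.1 + β * p.2 := by
    field_simp
    ring
  rw [e, show (1 - α) * p.1 + -(1 - β) * p.2 + r = r + (1 - α) * p.1 - (1 - β) * p.2 by ring,
    show -1 * p.1 + -1 * p.2 + 1 = 1 - p.1 - p.2 by ring]

theorem cutSquare_ae_eq {k l r k' l' r' : ℝ} (hk : 0 < k) (hl : 0 < l) (hk' : 0 < k') (hl' : 0 < l') :
    cutSquare k l r k' l' r' =ᵐ[volume] {p | (0 ≤ p.1 ∧ p.1 ≤ 1 ∧ 0 ≤ p.2 ∧ p.2 ≤ 1) ∧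
      r ≤ k * p.1 + l * p.2 ∧ r' ≤ k' * (1 - p.1) + l' * (1 - p.2)} := by
  filter_upwards [ae_fst_ne 0, ae_snd_ne 0, ae_fst_ne 1, ae_snd_ne 1] with p h1 h2 h3 h4
  refine propext ?_
  change p ∈ cutSquare k l r k' l' r' ↔ (0 ≤ p.1 ∧ p.1 ≤ 1 ∧ 0 ≤ p.2 ∧ p.2 ≤ 1) ∧
      r ≤ k * p.1 + l * p.2 ∧ r' ≤ k' * (1 - p.1) + l' * (1 - p.2)
  constructor
  · rintro ⟨⟨⟨a1, a2⟩, ⟨a3, a4⟩⟩, h⟩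
    have a2' := lt_of_le_of_ne a2 h3
    have a4' := lt_of_le_of_ne a4 h4
    rw [mem_union, not_or] at h
    refine ⟨⟨a1.le, a2, a3.le, a4⟩, ?_, ?_⟩
    · by_contra! h'
      exact h.1 ⟨mul_pos hk a1, mul_pos hl a3, h'⟩
    · by_contra! h'
      exact h.2 ⟨mul_pos hk' (sub_pos.2 a2'), mul_pos hl' (sub_pos.2 a4'), h'⟩
  · rintro ⟨⟨a1, a2, a3, a4⟩, a5, a6⟩
    refine ⟨⟨⟨lt_of_le_of_ne a1 h1.symm, a2⟩, ⟨lt_of_le_of_ne a3 h2.symm, a4⟩⟩, ?_⟩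
    rintro (h | h)
    · exact absurd h.2.2 (not_lt.2 a5)
    · exact absurd h.2.2 (not_lt.2 a6)

theorem exists_hasMoments_of_preimage {α β r : ℝ} (hN : 0 < 2 - α - β) {P : Set (ℝ × ℝ)} {n g : ℝ}
    (h : ∃ m₀₀ m₁₀ m₀₁ m₂₀ m₁₁ m₀₂, HasMoments P m₀₀ m₁₀ m₀₁ m₂₀ m₁₁ m₀₂ ∧ m₀₀ = n ∧
      gramDet m₀₀ m₁₀ m₀₁ m₂₀ m₁₁ m₀₂ = g)
    (e : {p | (0 ≤ p.1 ∧ p.1 ≤ 1 ∧ 0 ≤ p.2 ∧ p.2 ≤ 1) ∧ r ≤ α * p.1 + (1 - β) * p.2 ∧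
        -r ≤ (1 - α) * p.1 + β * p.2 ∧
        r + β - α ≤ (1 - α) * (1 - p.1) + β * (1 - p.2) ∧
        -(r + β - α) ≤ α * (1 - p.1) + (1 - β) * (1 - p.2)} =ᵐ[volume] P) :
    ∃ m₀₀ m₁₀ m₀₁ m₂₀ m₁₁ m₀₂, HasMoments
      (octaSection ((α + β) / (2 - α - β)) ((β - α) / (2 - α - β)) ((2 * r + β - α) / (2 - α - β)))
      m₀₀ m₁₀ m₀₁ m₂₀ m₁₁ m₀₂ ∧ m₀₀ = (2 - α - β) * n ∧
      gramDet m₀₀ m₁₀ m₀₁ m₂₀ m₁₁ m₀₂ = (2 - α - β) ^ 5 * g := by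
  obtain ⟨m₀₀, m₁₀, m₀₁, m₂₀, m₁₁, m₀₂, h, rfl, rfl⟩ := h
  have h := h.congr e
  rw [← preimage_octaSection hN.ne'] at h
  have hJ : (1 - α) * -1 - -(1 - β) * -1 = -(2 - α - β) := by ring
  have h := HasMoments.affine (isCompact_octaSection _ _ _).measurableSet
    (by rw [hJ]; linarith) h
  refine ⟨_, _, _, _, _, _, h, ?_, ?_⟩
  · rw [hJ, abs_neg, abs_of_pos hN]
  · rw [gramDet_affine, hJ, abs_neg, abs_of_pos hN]
    ring

theorem exists_hasMoments_octaSection_B {α β r : ℝ} (hα : 0 < α) (hαβ : α < β) (hβ : β < 1 - α)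
    (hr : r ∈ Ioo 0 α) :
    ∃ m₀₀ m₁₀ m₀₁ m₂₀ m₁₁ m₀₂, HasMoments
      (octaSection ((α + β) / (2 - α - β)) ((β - α) / (2 - α - β)) ((2 * r + β - α) / (2 - α - β)))
      m₀₀ m₁₀ m₀₁ m₂₀ m₁₁ m₀₂ ∧
      m₀₀ = (2 - α - β) *
        (1 - r / α * (r / (1 - β)) / 2 - (r + β - α) / (1 - α) * ((r + β - α) / β) / 2) ∧
      gramDet m₀₀ m₁₀ m₀₁ m₂₀ m₁₁ m₀₂ = (2 - α - β) ^ 5 * cornerDetB α β r := by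
  obtain ⟨h0, h1⟩ := hr
  refine exists_hasMoments_of_preimage (by linarith)
    (exists_hasMoments_cutSquare hα (by linarith : 0 < 1 - β) h0 h1.le (by linarith)
      (by linarith : 0 < 1 - α) (by linarith : 0 < β) (by linarith : 0 < r + β - α)
      (by linarith) (by linarith) fun x y hx hy h => ?_) ?_
  · by_contra! h'
    have a1 : α * β * y ≤ (1 - α) * (1 - β) * y := by
      refine mul_le_mul_of_nonneg_right ?_ hy.le
      nlinarith
    nlinarith
  · refine Filter.EventuallyEq.trans (Filter.EventuallyEq.of_eq (Set.ext fun p => ?_))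
      (cutSquare_ae_eq hα (by linarith) (by linarith) (by linarith)).symm
    simp only [mem_ofPred_eq]
    refine ⟨fun ⟨a, b1, b2, b3, b4⟩ => ⟨a, b1, b3⟩, fun ⟨a, b1, b3⟩ => ⟨a, b1, ?_, b3, ?_⟩⟩ <;>
    obtain ⟨a1, a2, a3, a4⟩ := a
    · nlinarith
    · have c1 := mul_nonneg hα.le (sub_nonneg.2 a2)
      have c2 := mul_nonneg (by linarith : 0 ≤ 1 - β) (sub_nonneg.2 a4)
      linarith

theorem exists_hasMoments_octaSection_C {α β r : ℝ} (hα : 0 < α) (hαβ : α < β) (hβ : β < 1 - α)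
    (hr : r ∈ Ioo 0 ((β - α) / 2)) :
    ∃ m₀₀ m₁₀ m₀₁ m₂₀ m₁₁ m₀₂, HasMoments
      (octaSection ((α + β) / (2 - α - β)) ((β - α) / (2 - α - β)) ((2 * -r + β - α) / (2 - α - β)))
      m₀₀ m₁₀ m₀₁ m₂₀ m₁₁ m₀₂ ∧
      m₀₀ = (2 - α - β) *
        (1 - r / (1 - α) * (r / β) / 2 - (β - α - r) / (1 - α) * ((β - α - r) / β) / 2) ∧
      gramDet m₀₀ m₁₀ m₀₁ m₂₀ m₁₁ m₀₂ = (2 - α - β) ^ 5 * cornerDetC α β r := by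
  obtain ⟨h0, h1⟩ := hr
  refine exists_hasMoments_of_preimage (by linarith)
    (exists_hasMoments_cutSquare (by linarith : 0 < 1 - α) (by linarith : 0 < β) h0 (by linarith)
      (by linarith) (by linarith : 0 < 1 - α) (by linarith : 0 < β) (by linarith : 0 < β - α - r)
      (by linarith) (by linarith) fun x y hx hy h => ?_) ?_
  · linarith
  · refine Filter.EventuallyEq.trans (Filter.EventuallyEq.of_eq (Set.ext fun p => ?_))
      (cutSquare_ae_eq (by linarith) (by linarith) (by linarith) (by linarith)).symm
    simp only [mem_ofPred_eq]
    refine ⟨fun ⟨a, b1, b2, b3, b4⟩ => ⟨a, by linarith, by linarith⟩,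
      fun ⟨a, b1, b3⟩ => ⟨a, ?_, by linarith, by linarith, ?_⟩⟩ <;>
    obtain ⟨a1, a2, a3, a4⟩ := a
    · have c1 := mul_nonneg hα.le a1
      have c2 := mul_nonneg (by linarith : 0 ≤ 1 - β) a3
      linarith
    · have c1 := mul_nonneg hα.le (sub_nonneg.2 a2)
      have c2 := mul_nonneg (by linarith : 0 ≤ 1 - β) (sub_nonneg.2 a4)
      linarith

theorem planeDist_eq_lintegral (b c t : ℝ) :
    planeDist ![b, c, t] = ∫⁻ s, ENNReal.ofReal |s - t| * volume (octaSection b c s) := by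
  have hS : MeasurableSet {p : ℝ × ℝ × ℝ | |p.1 - b * p.2.1 - c * p.2.2| + |p.2.1| + |p.2.2| ≤ 1} :=
    (isClosed_le (by fun_prop) (by fun_prop)).measurableSet
  have hf : Measurable (octa.indicator fun W : ℝ × ℝ × ℝ =>
      ENNReal.ofReal |W.1 + b * W.2.1 + c * W.2.2 - t|) :=
    Measurable.indicator (by fun_prop) measurableSet_octa
  have h1 : planeDist ![b, c, t] = ∫⁻ w : ℝ × ℝ, ∫⁻ x : ℝ, (octa.indicator fun W : ℝ × ℝ × ℝ =>
      ENNReal.ofReal |W.1 + b * W.2.1 + c * W.2.2 - t|) (x, w) := by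
    rw [← lintegral_prod_symm _ hf.aemeasurable, ← Measure.volume_eq_prod,
      lintegral_indicator measurableSet_octa]
    rfl
  have h2 : ∀ w : ℝ × ℝ, ∫⁻ x : ℝ, (octa.indicator fun W : ℝ × ℝ × ℝ =>
      ENNReal.ofReal |W.1 + b * W.2.1 + c * W.2.2 - t|) (x, w)
      = ∫⁻ s : ℝ, {p : ℝ × ℝ × ℝ | |p.1 - b * p.2.1 - c * p.2.2| + |p.2.1| + |p.2.2| ≤ 1}.indicator
        (fun p => ENNReal.ofReal |p.1 - t|) (s, w) := by
    intro w
    rw [← lintegral_sub_right_eq_self _ (b * w.1 + c * w.2)]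
    refine lintegral_congr fun s => ?_
    by_cases hs : |s - b * w.1 - c * w.2| + |w.1| + |w.2| ≤ 1
    · rw [indicator_of_mem, indicator_of_mem (by exact hs)]
      · congr 2
        ring
      · change |s - (b * w.1 + c * w.2)| + |w.1| + |w.2| ≤ 1
        rwa [← sub_sub]
    · rw [indicator_of_notMem, indicator_of_notMem (by exact hs)]
      change ¬ |s - (b * w.1 + c * w.2)| + |w.1| + |w.2| ≤ 1
      rwa [← sub_sub]
  have hg : Measurable ({p : ℝ × ℝ × ℝ | |p.1 - b * p.2.1 - c * p.2.2| + |p.2.1| + |p.2.2| ≤ 1}.indicator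
        (fun p => ENNReal.ofReal |p.1 - t|)) := Measurable.indicator (by fun_prop) hS
  rw [h1, lintegral_congr h2, ← lintegral_prod_symm _ hg.aemeasurable,
    lintegral_prod _ hg.aemeasurable]
  refine lintegral_congr fun s => ?_
  have h3 : ∀ w : ℝ × ℝ, {p : ℝ × ℝ × ℝ | |p.1 - b * p.2.1 - c * p.2.2| + |p.2.1| + |p.2.2| ≤ 1}.indicator
        (fun p => ENNReal.ofReal |p.1 - t|) (s, w)
      = (octaSection b c s).indicator (fun _ => ENNReal.ofReal |s - t|) w := by
    intro w
    by_cases hs : |s - b * w.1 - c * w.2| + |w.1| + |w.2| ≤ 1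
    · rw [indicator_of_mem (by exact hs), indicator_of_mem (by exact hs)]
    · rw [indicator_of_notMem (by exact hs), indicator_of_notMem (by exact hs)]
  rw [lintegral_congr h3, lintegral_indicator (isCompact_octaSection b c s).measurableSet,
    setLIntegral_const]

theorem volume_octaSection_neg (b c s : ℝ) :
    volume (octaSection b c (-s)) = volume (octaSection b c s) := by
  rw [← Measure.measure_neg volume (octaSection b c s)]
  congr 1
  ext p
  change |-s - b * p.1 - c * p.2| + |p.1| + |p.2| ≤ 1 ↔
    |s - b * -p.1 - c * -p.2| + |-p.1| + |-p.2| ≤ 1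
  rw [abs_neg, abs_neg, ← abs_neg (s - b * -p.1 - c * -p.2)]
  ring_nf

theorem volume_octaSection_eq_zero {b c s : ℝ} (hb : |b| ≤ 1) (hc : |c| ≤ 1) (hs : 1 < |s|) :
    volume (octaSection b c s) = 0 := by
  have h : octaSection b c s = ∅ := by
    refine eq_empty_of_forall_notMem fun p hp => ?_
    have hp : |s - b * p.1 - c * p.2| + |p.1| + |p.2| ≤ 1 := hp
    have h1 : |b * p.1| ≤ |p.1| := by
      rw [abs_mul]
      exact mul_le_of_le_one_left (abs_nonneg _) hb
    have h2 : |c * p.2| ≤ |p.2| := by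
      rw [abs_mul]
      exact mul_le_of_le_one_left (abs_nonneg _) hc
    have h3 : |s| ≤ |s - b * p.1 - c * p.2| + |b * p.1| + |c * p.2| := by
      have := abs_add_three (s - b * p.1 - c * p.2) (b * p.1) (c * p.2)
      rwa [show s - b * p.1 - c * p.2 + b * p.1 + c * p.2 = s by ring] at this
    linarith
  rw [h, measure_empty]

theorem measurable_volume_octaSection (b c : ℝ) :
    Measurable fun s => volume (octaSection b c s) := by
  have hS : MeasurableSet {p : ℝ × ℝ × ℝ | |p.1 - b * p.2.1 - c * p.2.2| + |p.2.1| + |p.2.2| ≤ 1} :=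
    (isClosed_le (by fun_prop) (by fun_prop)).measurableSet
  exact measurable_measure_prodMk_left hS

theorem planeDist_eq_lintegral_Ioo {b c t : ℝ} (hb : |b| ≤ 1) (hc : |c| ≤ 1) (ht : 0 ≤ t) :
    planeDist ![b, c, t]
      = ∫⁻ s in Ioo 0 1, ENNReal.ofReal (2 * max s t) * volume (octaSection b c s) := by
  have hm := measurable_volume_octaSection b c
  have h1 : planeDist ![b, c, t]
      = ∫⁻ s in Ioo (-1) 1, ENNReal.ofReal |s - t| * volume (octaSection b c s) := by
    rw [planeDist_eq_lintegral, ← lintegral_indicator measurableSet_Ioo]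
    refine lintegral_congr_ae ?_
    filter_upwards [Measure.ae_ne volume (1 : ℝ), Measure.ae_ne volume (-1 : ℝ)] with s h1 h2
    by_cases hs : s ∈ Ioo (-1) 1
    · rw [indicator_of_mem hs]
    · rw [indicator_of_notMem hs, volume_octaSection_eq_zero hb hc, mul_zero]
      by_contra! h
      obtain ⟨h3, h4⟩ := abs_le.1 h
      exact hs ⟨lt_of_le_of_ne h3 h2.symm, lt_of_le_of_ne h4 h1⟩
  have h2 : ∫⁻ s in Ioo (-1) 0, ENNReal.ofReal |s - t| * volume (octaSection b c s)
      = ∫⁻ s in Ioo 0 1, ENNReal.ofReal |-s - t| * volume (octaSection b c s) := by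
    have h := (Measure.measurePreserving_neg (volume : Measure ℝ)).setLIntegral_comp_preimage_emb
      (Homeomorph.neg ℝ).measurableEmbedding
      (fun s => ENNReal.ofReal |-s - t| * volume (octaSection b c s)) (Ioo 0 1)
    simpa [volume_octaSection_neg] using h
  rw [h1, lintegral_Ioo_split _ (by norm_num : (-1 : ℝ) < 0) one_pos, h2,
    ← lintegral_add_left (by fun_prop)]
  refine setLIntegral_congr_fun measurableSet_Ioo fun s hs => ?_
  rw [← add_mul, ← ENNReal.ofReal_add (abs_nonneg _) (abs_nonneg _)]
  congr 2
  have hs := hs.1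
  rw [← abs_neg, neg_sub, sub_neg_eq_add, add_comm t s, abs_of_nonneg (by linarith)]
  rcases le_total s t with h | h
  · rw [abs_of_nonpos (by linarith), max_eq_right h]
    ring
  · rw [abs_of_nonneg (by linarith), max_eq_left h]
    ring

theorem integral_max_mul_sq {k t : ℝ} (hk : 0 ≤ k) (hk1 : k ≤ 1) (ht : 0 ≤ t) (ht1 : t ≤ 1) :
    ∫ s in (0 : ℝ)..1, 2 * max s t * max (k - s) 0 ^ 2
      = 2 / 3 * t * k ^ 3 + max (k - t) 0 ^ 4 / 6 := by
  have h := integral_eq_of_hasDerivAt_off_countable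
    (fun s => -(2 / 3) * max s t * max (k - s) 0 ^ 3 - max (k - max s t) 0 ^ 4 / 6)
    (fun s => 2 * max s t * max (k - s) 0 ^ 2) (a := 0) (b := 1) (s := {t, k})
    (by simp) (by fun_prop) ?_ (Continuous.intervalIntegrable (by fun_prop) _ _)
  · rw [h, max_eq_right (by linarith : k - 1 ≤ 0), max_eq_left ht1, max_eq_right ht,
      max_eq_right (by linarith : k - 1 ≤ 0), max_eq_left (by linarith : 0 ≤ k - 0)]
    ring
  · rintro s ⟨-, hs⟩
    simp only [mem_insert_iff, mem_singleton_iff, not_or] at hs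
    rcases lt_or_gt_of_ne hs.1 with h1 | h1 <;> rcases lt_or_gt_of_ne hs.2 with h2 | h2
    · have h := (((hasDerivAt_id s).const_sub k).pow 3).const_mul (-(2 / 3) * t) |>.sub_const
        (max (k - t) 0 ^ 4 / 6)
      refine (h.congr_deriv (g' := 2 * max s t * max (k - s) 0 ^ 2) ?_).congr_of_eventuallyEq ?_
      · rw [max_eq_right h1.le, max_eq_left (by linarith)]
        simp
        ring
      · filter_upwards [Iio_mem_nhds h1, Iio_mem_nhds h2] with x x1 x2
        have x1 : x < t := x1
        have x2 : x < k := x2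
        rw [max_eq_right x1.le, max_eq_left (by linarith : 0 ≤ k - x)]
        simp
    · refine ((hasDerivAt_const s (-(max (k - t) 0 ^ 4 / 6))).congr_deriv
        (g' := 2 * max s t * max (k - s) 0 ^ 2) ?_).congr_of_eventuallyEq ?_
      · rw [max_eq_right (by linarith : k - s ≤ 0)]
        simp
      · filter_upwards [Iio_mem_nhds h1, Ioi_mem_nhds h2] with x x1 x2
        have x1 : x < t := x1
        have x2 : k < x := x2
        rw [max_eq_right x1.le, max_eq_right (by linarith : k - x ≤ 0)]
        simp
    · have h := (((hasDerivAt_id s).mul (((hasDerivAt_id s).const_sub k).pow 3)).const_mul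
        (-(2 / 3) : ℝ)).sub ((((hasDerivAt_id s).const_sub k).pow 4).div_const 6)
      refine (h.congr_deriv (g' := 2 * max s t * max (k - s) 0 ^ 2) ?_).congr_of_eventuallyEq ?_
      · rw [max_eq_left h1.le, max_eq_left (by linarith)]
        simp
        ring
      · filter_upwards [Ioi_mem_nhds h1, Iio_mem_nhds h2] with x x1 x2
        have x1 : t < x := x1
        have x2 : x < k := x2
        rw [max_eq_left x1.le, max_eq_left (by linarith : 0 ≤ k - x)]
        simp
        ring
    · refine ((hasDerivAt_const s (0 : ℝ)).congr_deriv
        (g' := 2 * max s t * max (k - s) 0 ^ 2) ?_).congr_of_eventuallyEq ?_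
      · rw [max_eq_right (by linarith : k - s ≤ 0)]
        simp
      · filter_upwards [Ioi_mem_nhds h1, Ioi_mem_nhds h2] with x x1 x2
        have x1 : t < x := x1
        have x2 : k < x := x2
        rw [max_eq_left x1.le, max_eq_right (by linarith : k - x ≤ 0)]
        simp

theorem HasMoments.volume_eq {P : Set (ℝ × ℝ)} {m₀₀ m₁₀ m₀₁ m₂₀ m₁₁ m₀₂ : ℝ}
    (h : HasMoments P m₀₀ m₁₀ m₀₁ m₂₀ m₁₁ m₀₂) (hP : IsCompact P) :
    0 ≤ m₀₀ ∧ volume P = ENNReal.ofReal m₀₀ := by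
  have h1 := h 1 0 0 0 0 0
  simp only [zero_mul, add_zero, one_mul, setIntegral_const, smul_eq_mul, mul_one] at h1
  rw [← h1]
  exact ⟨measureReal_nonneg, by rw [Measure.real, ENNReal.ofReal_toReal hP.measure_ne_top]⟩

/-- The area of the projection to the last two coordinates of the section of the octahedron by the
plane `x + b y + c z = s`, for `0 < c < b < 1` and `0 < s < 1`. -/
noncomputable def sectionArea (b c s : ℝ) : ℝ :=
  2 / ((1 - b ^ 2) * (1 - c ^ 2)) * (1 - s) ^ 2
    - 2 * b / ((1 - b ^ 2) * (b ^ 2 - c ^ 2)) * max (b - s) 0 ^ 2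
    + 2 * c / ((1 - c ^ 2) * (b ^ 2 - c ^ 2)) * max (c - s) 0 ^ 2

theorem chart_params {b : ℝ} (hb : 0 < 1 + b) (c r : ℝ) :
    2 - (b - c) / (1 + b) - (b + c) / (1 + b) = 2 / (1 + b) ∧
    ((b - c) / (1 + b) + (b + c) / (1 + b)) / (2 / (1 + b)) = b ∧
    ((b + c) / (1 + b) - (b - c) / (1 + b)) / (2 / (1 + b)) = c ∧
    (2 * (r / (1 + b)) + (b + c) / (1 + b) - (b - c) / (1 + b)) / (2 / (1 + b)) = r + c := by
  refine ⟨?_, ?_, ?_, ?_⟩ <;> field_simp <;> ring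

theorem volume_octaSection {b c s : ℝ} (hc : 0 < c) (hcb : c < b) (hb : b < 1) (hs : s ∈ Ioo 0 1)
    (hsb : s ≠ b) (hsc : s ≠ c) :
    0 ≤ sectionArea b c s ∧ volume (octaSection b c s) = ENNReal.ofReal (sectionArea b c s) := by
  suffices h : ∃ m₀₀ m₁₀ m₀₁ m₂₀ m₁₁ m₀₂, HasMoments (octaSection b c s) m₀₀ m₁₀ m₀₁ m₂₀ m₁₁ m₀₂ ∧
      m₀₀ = sectionArea b c s by
    obtain ⟨_, _, _, _, _, _, h, h'⟩ := h
    rw [← h']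
    exact h.volume_eq (isCompact_octaSection b c s)
  have q1 : 0 < 1 + b := by linarith
  have q2 : 0 < 1 - b := by linarith
  have q3 : 0 < 1 + c := by linarith
  have q4 : 0 < 1 - c := by linarith
  have q5 : 0 < b + c := by linarith
  have q6 : 0 < b - c := by linarith
  have hα : 0 < (b - c) / (1 + b) := by positivity
  have hαβ : (b - c) / (1 + b) < (b + c) / (1 + b) := by
    rw [div_lt_div_iff_of_pos_right q1]
    linarith
  have hβ : (b + c) / (1 + b) < 1 - (b - c) / (1 + b) := by
    rw [lt_sub_iff_add_lt, ← add_div, div_lt_one q1]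
    linarith
  rcases lt_or_gt_of_ne hsb with h1 | h1
  · rcases lt_or_gt_of_ne hsc with h2 | h2
    · have hr : (c - s) / (1 + b) ∈ Ioo 0 (((b + c) / (1 + b) - (b - c) / (1 + b)) / 2) := by
        refine ⟨div_pos (by linarith) q1, ?_⟩
        rw [← sub_div, div_div, mul_comm, ← div_div, div_lt_div_iff_of_pos_right q1]
        linarith [hs.1]
      obtain ⟨m₀₀, m₁₀, m₀₁, m₂₀, m₁₁, m₀₂, h, h', -⟩ := exists_hasMoments_octaSection_C hα hαβ hβ hr
      obtain ⟨e1, e2, e3, e4⟩ := chart_params q1 c (-(c - s))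
      rw [← neg_div, e1, e2, e3, e4, show -(c - s) + c = s by ring] at h
      refine ⟨_, _, _, _, _, _, h, ?_⟩
      rw [h', e1, sectionArea, max_eq_left (by linarith), max_eq_left (by linarith),
        show 1 - b ^ 2 = (1 - b) * (1 + b) by ring, show 1 - c ^ 2 = (1 - c) * (1 + c) by ring,
        show b ^ 2 - c ^ 2 = (b - c) * (b + c) by ring,
        show 1 - (b - c) / (1 + b) = (1 + c) / (1 + b) by field_simp; ring,
        show (b + c) / (1 + b) - (b - c) / (1 + b) - (c - s) / (1 + b) = (c + s) / (1 + b) by ring]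
      field_simp
      ring
    · have hr : (s - c) / (1 + b) ∈ Ioo 0 ((b - c) / (1 + b)) := by
        refine ⟨div_pos (by linarith) q1, ?_⟩
        rw [div_lt_div_iff_of_pos_right q1]
        linarith
      obtain ⟨m₀₀, m₁₀, m₀₁, m₂₀, m₁₁, m₀₂, h, h', -⟩ := exists_hasMoments_octaSection_B hα hαβ hβ hr
      obtain ⟨e1, e2, e3, e4⟩ := chart_params q1 c (s - c)
      rw [e1, e2, e3, e4, show s - c + c = s by ring] at h
      refine ⟨_, _, _, _, _, _, h, ?_⟩
      rw [h', e1, sectionArea, max_eq_left (by linarith), max_eq_right (by linarith),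
        show 1 - b ^ 2 = (1 - b) * (1 + b) by ring, show 1 - c ^ 2 = (1 - c) * (1 + c) by ring,
        show b ^ 2 - c ^ 2 = (b - c) * (b + c) by ring,
        show 1 - (b - c) / (1 + b) = (1 + c) / (1 + b) by field_simp; ring,
        show 1 - (b + c) / (1 + b) = (1 - c) / (1 + b) by field_simp; ring,
        show (s - c) / (1 + b) + (b + c) / (1 + b) - (b - c) / (1 + b) = (s + c) / (1 + b) by ring]
      field_simp
      ring
  · obtain ⟨m₀₀, m₁₀, m₀₁, m₂₀, m₁₁, m₀₂, h, h', -⟩ := exists_hasMoments_octaSection hc hcb h1 hs.2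
    refine ⟨_, _, _, _, _, _, h, ?_⟩
    rw [h', sectionArea, max_eq_right (by linarith), max_eq_right (by linarith)]
    ring

/-- The closed form of the integral over the octahedron of
`|x + b y + c z - t|`, for `0 < c < b < 1` and `0 < t < 1`. -/
noncomputable def meanDist (b c t : ℝ) : ℝ :=
  4 / 3 * t + (2 / ((1 - b ^ 2) * (1 - c ^ 2)) * (1 - t) ^ 4
    - 2 * b / ((1 - b ^ 2) * (b ^ 2 - c ^ 2)) * max (b - t) 0 ^ 4
    + 2 * c / ((1 - c ^ 2) * (b ^ 2 - c ^ 2)) * max (c - t) 0 ^ 4) / 6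

theorem planeDist_eq {b c t : ℝ} (hc : 0 < c) (hcb : c < b) (hb : b < 1) (ht : t ∈ Ioo 0 1) :
    0 ≤ meanDist b c t ∧ planeDist ![b, c, t] = ENNReal.ofReal (meanDist b c t) := by
  have hb0 := hc.trans hcb
  have hc1 := hcb.trans hb
  have hae : ∀ᵐ s ∂(volume.restrict (Ioo (0 : ℝ) 1)), 0 ≤ sectionArea b c s ∧
      volume (octaSection b c s) = ENNReal.ofReal (sectionArea b c s) := by
    filter_upwards [ae_restrict_mem measurableSet_Ioo, ae_restrict_of_ae (Measure.ae_ne volume b),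
      ae_restrict_of_ae (Measure.ae_ne volume c)] with s h1 h2 h3
    exact volume_octaSection hc hcb hb h1 h2 h3
  have hcont : Continuous fun s => 2 * max s t * sectionArea b c s := by
    unfold sectionArea
    fun_prop
  have hnn : 0 ≤ᵐ[volume.restrict (Ioo (0 : ℝ) 1)] fun s => 2 * max s t * sectionArea b c s := by
    filter_upwards [hae] with s hs
    exact mul_nonneg (mul_nonneg (by norm_num) (ht.1.le.trans (le_max_right _ _))) hs.1
  have hint : ∫ s in Ioo (0 : ℝ) 1, 2 * max s t * sectionArea b c s = meanDist b c t := by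
    rw [← integral_Ioc_eq_integral_Ioo, ← intervalIntegral.integral_of_le zero_le_one]
    have e : ∀ s ∈ uIcc (0 : ℝ) 1, 2 * max s t * sectionArea b c s
        = 2 / ((1 - b ^ 2) * (1 - c ^ 2)) * (2 * max s t * max (1 - s) 0 ^ 2)
          - 2 * b / ((1 - b ^ 2) * (b ^ 2 - c ^ 2)) * (2 * max s t * max (b - s) 0 ^ 2)
          + 2 * c / ((1 - c ^ 2) * (b ^ 2 - c ^ 2)) * (2 * max s t * max (c - s) 0 ^ 2) := by
      intro s hs
      rw [uIcc_of_le zero_le_one] at hs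
      rw [sectionArea, max_eq_left (by linarith [hs.2] : 0 ≤ 1 - s)]
      ring
    rw [intervalIntegral.integral_congr e, intervalIntegral.integral_add,
      intervalIntegral.integral_sub, intervalIntegral.integral_const_mul,
      intervalIntegral.integral_const_mul, intervalIntegral.integral_const_mul,
      integral_max_mul_sq zero_le_one le_rfl ht.1.le ht.2.le,
      integral_max_mul_sq hb0.le hb.le ht.1.le ht.2.le,
      integral_max_mul_sq hc.le hc1.le ht.1.le ht.2.le,
      max_eq_left (by linarith [ht.2] : 0 ≤ 1 - t), meanDist]
    · have q1 : 1 - b ^ 2 ≠ 0 := by nlinarith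
      have q2 : 1 - c ^ 2 ≠ 0 := by nlinarith
      have q3 : b ^ 2 - c ^ 2 ≠ 0 := by nlinarith
      have e : 2 / ((1 - b ^ 2) * (1 - c ^ 2)) - 2 * b / ((1 - b ^ 2) * (b ^ 2 - c ^ 2)) * b ^ 3
          + 2 * c / ((1 - c ^ 2) * (b ^ 2 - c ^ 2)) * c ^ 3 = 2 := by
        field_simp
        ring
      linear_combination 2 / 3 * t * e
    all_goals exact Continuous.intervalIntegrable (by fun_prop) _ _
  rw [← hint]
  refine ⟨integral_nonneg_of_ae hnn, ?_⟩
  rw [ofReal_integral_eq_lintegral_ofReal _ hnn,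
    planeDist_eq_lintegral_Ioo (by rw [abs_of_pos hb0]; exact hb.le)
      (by rw [abs_of_pos hc]; exact hc1.le) ht.1.le]
  · refine lintegral_congr_ae ?_
    filter_upwards [hae] with s hs
    rw [hs.2, ENNReal.ofReal_mul (mul_nonneg (by norm_num) (ht.1.le.trans (le_max_right _ _)))]
  · exact (hcont.continuousOn.integrableOn_compact isCompact_Icc).mono_set Ioo_subset_Icc_self

theorem sectionWeight_of_hasMoments {b c t m₀₀ m₁₀ m₀₁ m₂₀ m₁₁ m₀₂ : ℝ} (hc : 0 < c) (hcb : c < b)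
    (hb : b < 1) (ht : t ∈ Ioo 0 1)
    (h : HasMoments (octaSection b c t) m₀₀ m₁₀ m₀₁ m₂₀ m₁₁ m₀₂) :
    0 ≤ meanDist b c t * gramDet m₀₀ m₁₀ m₀₁ m₂₀ m₁₁ m₀₂ ∧ sectionWeight b c t
      = ENNReal.ofReal (6 * (meanDist b c t * gramDet m₀₀ m₁₀ m₀₁ m₂₀ m₁₁ m₀₂)) := by
  obtain ⟨h1, h2⟩ := planeDist_eq hc hcb hb ht
  obtain ⟨h3, h4⟩ := sectionMoment_eq h
  refine ⟨mul_nonneg h1 h3, ?_⟩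
  rw [sectionWeight, h2, h4, ← ENNReal.ofReal_mul h1]
  ring_nf

theorem sectionWeight_eq_A {b c t : ℝ} (hc : 0 < c) (hcb : c < b) (hbt : b < t) (ht : t < 1) :
    sectionWeight b c t = ENNReal.ofReal (6 * (meanDistA b c t * gramDetA b c t)) := by
  obtain ⟨_, _, _, _, _, _, h, -, h'⟩ := exists_hasMoments_octaSection hc hcb hbt ht
  rw [(sectionWeight_of_hasMoments hc hcb (hbt.trans ht) ⟨by linarith, ht⟩ h).2, h', meanDist,
    max_eq_right (by linarith), max_eq_right (by linarith), meanDistA]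
  have q1 : 1 - b ^ 2 ≠ 0 := by nlinarith
  have q2 : 1 - c ^ 2 ≠ 0 := by nlinarith
  congr 3
  field_simp
  ring

theorem sectionWeight_eq_B {α β r : ℝ} (hα : 0 < α) (hαβ : α < β) (hβ : β < 1 - α)
    (hr : r ∈ Ioo 0 α) :
    0 ≤ meanDistB α β r * cornerDetB α β r ∧
      sectionWeight ((α + β) / (2 - α - β)) ((β - α) / (2 - α - β)) ((2 * r + β - α) / (2 - α - β))
        = ENNReal.ofReal (12 * (2 - α - β) ^ 4 * (meanDistB α β r * cornerDetB α β r)) := by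
  have hN : 0 < 2 - α - β := by linarith
  obtain ⟨h0, h1⟩ := hr
  obtain ⟨_, _, _, _, _, _, h, -, h'⟩ := exists_hasMoments_octaSection_B hα hαβ hβ ⟨h0, h1⟩
  obtain ⟨h2, h3⟩ := sectionWeight_of_hasMoments (div_pos (by linarith) hN)
    ((div_lt_div_iff_of_pos_right hN).2 (by linarith)) ((div_lt_one hN).2 (by linarith))
    ⟨div_pos (by linarith) hN, (div_lt_one hN).2 (by linarith)⟩ h
  have e : meanDist ((α + β) / (2 - α - β)) ((β - α) / (2 - α - β)) ((2 * r + β - α) / (2 - α - β))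
      = 2 / (2 - α - β) * meanDistB α β r := by
    have q1 : 0 < 1 - α := by linarith
    have q2 : 0 < 1 - β := by linarith
    have q3 : 0 < β := by linarith
    have q4 : 0 < 1 - α - β := by linarith
    rw [meanDist, ← sub_div, ← sub_div, max_eq_left (div_nonneg (by linarith) hN.le),
      max_eq_right (div_nonpos_of_nonpos_of_nonneg (by linarith) hN.le), meanDistB,
      show 1 - ((α + β) / (2 - α - β)) ^ 2 = 4 * (1 - α - β) / (2 - α - β) ^ 2 by
        field_simp; ring,
      show 1 - ((β - α) / (2 - α - β)) ^ 2 = 4 * ((1 - α) * (1 - β)) / (2 - α - β) ^ 2 by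
        field_simp; ring,
      show ((α + β) / (2 - α - β)) ^ 2 - ((β - α) / (2 - α - β)) ^ 2
        = 4 * (α * β) / (2 - α - β) ^ 2 by field_simp; ring]
    field_simp
    ring
  rw [e, h'] at h2 h3
  constructor
  · have h4 : 0 ≤ 2 * (2 - α - β) ^ 4 * (meanDistB α β r * cornerDetB α β r) := by
      refine h2.trans_eq ?_
      field_simp
    exact nonneg_of_mul_nonneg_right h4 (by positivity)
  · rw [h3]
    congr 1
    field_simp
    ring

theorem sectionWeight_eq_C {α β r : ℝ} (hα : 0 < α) (hαβ : α < β) (hβ : β < 1 - α)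
    (hr : r ∈ Ioo 0 ((β - α) / 2)) :
    0 ≤ meanDistC α β r * cornerDetC α β r ∧
      sectionWeight ((α + β) / (2 - α - β)) ((β - α) / (2 - α - β)) ((2 * -r + β - α) / (2 - α - β))
        = ENNReal.ofReal (12 * (2 - α - β) ^ 4 * (meanDistC α β r * cornerDetC α β r)) := by
  have hN : 0 < 2 - α - β := by linarith
  obtain ⟨h0, h1⟩ := hr
  obtain ⟨_, _, _, _, _, _, h, -, h'⟩ := exists_hasMoments_octaSection_C hα hαβ hβ ⟨h0, h1⟩
  obtain ⟨h2, h3⟩ := sectionWeight_of_hasMoments (div_pos (by linarith) hN)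
    ((div_lt_div_iff_of_pos_right hN).2 (by linarith)) ((div_lt_one hN).2 (by linarith))
    ⟨div_pos (by linarith) hN, (div_lt_one hN).2 (by linarith)⟩ h
  have e : meanDist ((α + β) / (2 - α - β)) ((β - α) / (2 - α - β)) ((2 * -r + β - α) / (2 - α - β))
      = 2 / (2 - α - β) * meanDistC α β r := by
    have q1 : 0 < 1 - α := by linarith
    have q2 : 0 < 1 - β := by linarith
    have q3 : 0 < β := by linarith
    have q4 : 0 < 1 - α - β := by linarith
    rw [meanDist, ← sub_div, ← sub_div, max_eq_left (div_nonneg (by linarith) hN.le),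
      max_eq_left (div_nonneg (by linarith) hN.le), meanDistC,
      show 1 - ((α + β) / (2 - α - β)) ^ 2 = 4 * (1 - α - β) / (2 - α - β) ^ 2 by
        field_simp; ring,
      show 1 - ((β - α) / (2 - α - β)) ^ 2 = 4 * ((1 - α) * (1 - β)) / (2 - α - β) ^ 2 by
        field_simp; ring,
      show ((α + β) / (2 - α - β)) ^ 2 - ((β - α) / (2 - α - β)) ^ 2
        = 4 * (α * β) / (2 - α - β) ^ 2 by field_simp; ring]
    field_simp
    ring
  rw [e, h'] at h2 h3
  constructor
  · have h4 : 0 ≤ 2 * (2 - α - β) ^ 4 * (meanDistC α β r * cornerDetC α β r) := by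
      refine h2.trans_eq ?_
      field_simp
    exact nonneg_of_mul_nonneg_right h4 (by positivity)
  · rw [h3]
    congr 1
    field_simp
    ring

theorem lintegral_Ioo_subst {u v a b : ℝ} {f f' h : ℝ → ℝ}
    (hd : ∀ x ∈ Ioo u v, HasDerivAt f (f' x) x)
    (hf : ∀ x ∈ Ioo u v, f x ∈ Ioo a b ∧ h (f x) = x)
    (hh : ∀ y ∈ Ioo a b, h y ∈ Ioo u v ∧ f (h y) = y) (g : ℝ → ENNReal) :
    ∫⁻ y in Ioo a b, g y = ∫⁻ x in Ioo u v, ENNReal.ofReal |f' x| * g (f x) := by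
  have e : f '' Ioo u v = Ioo a b := by
    refine Subset.antisymm ?_ fun y hy => ⟨h y, (hh y hy).1, (hh y hy).2⟩
    rintro _ ⟨x, hx, rfl⟩
    exact (hf x hx).1
  rw [← e]
  refine lintegral_image_eq_lintegral_abs_deriv_mul measurableSet_Ioo
    (fun x hx => (hd x hx).hasDerivWithinAt) (fun x hx y hy hxy => ?_) g
  rw [← (hf x hx).2, hxy, (hf y hy).2]

theorem measurable_lintegral_Ioo {X : Type*} [MeasurableSpace X] {u v : X → ℝ} (hu : Measurable u)
    (hv : Measurable v) {g : X → ℝ → ENNReal} (hg : Measurable fun p : X × ℝ => g p.1 p.2) :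
    Measurable fun x => ∫⁻ y in Ioo (u x) (v x), g x y := by
  have hS : MeasurableSet {p : X × ℝ | u p.1 < p.2 ∧ p.2 < v p.1} := by
    rw [ofPred_and]
    exact (measurableSet_lt (hu.comp measurable_fst) measurable_snd).inter
      (measurableSet_lt measurable_snd (hv.comp measurable_fst))
  have h := (hg.indicator hS).lintegral_prod_right' (ν := (volume : Measure ℝ))
  convert h using 2 with x
  rw [← lintegral_indicator measurableSet_Ioo]
  rfl

theorem lintegral_sectionWeight_A :
    ∫⁻ b in Ioo (0 : ℝ) 1, ∫⁻ c in Ioo 0 b, ∫⁻ t in Ioo b 1, sectionWeight b c t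
      = ENNReal.ofReal (6 * (5139122 / 18225 / 48 - 3857 / 135 / 48 * Real.pi ^ 2)) := by
  rw [ENNReal.ofReal_mul (by norm_num), ← lintegral_A, ← lintegral_const_mul' _ _ ENNReal.ofReal_ne_top]
  refine setLIntegral_congr_fun measurableSet_Ioo fun b hb => ?_
  rw [← lintegral_const_mul' _ _ ENNReal.ofReal_ne_top]
  refine setLIntegral_congr_fun measurableSet_Ioo fun c hc => ?_
  rw [← lintegral_const_mul' _ _ ENNReal.ofReal_ne_top]
  refine setLIntegral_congr_fun measurableSet_Ioo fun t ht => ?_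
  rw [sectionWeight_eq_A hc.1 hc.2 ht.1 ht.2, ENNReal.ofReal_mul (by norm_num)]

theorem lintegral_sectionWeight_chart {α β : ℝ} (hα : 0 < α) (hαβ : α < β) (hβ : β < 1 - α) :
    ENNReal.ofReal (4 / (2 - α - β) ^ 3) * ∫⁻ t in Ioo 0 ((α + β) / (2 - α - β)),
        sectionWeight ((α + β) / (2 - α - β)) ((β - α) / (2 - α - β)) t
      = ENNReal.ofReal 96 * ((∫⁻ r in Ioo 0 α, ENNReal.ofReal (meanDistB α β r * cornerDetB α β r))
        + ∫⁻ r in Ioo 0 ((β - α) / 2), ENNReal.ofReal (meanDistC α β r * cornerDetC α β r)) := by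
  have hN : 0 < 2 - α - β := by linarith
  have hB := lintegral_Ioo_subst (u := 0) (v := α) (a := (β - α) / (2 - α - β))
    (b := (α + β) / (2 - α - β)) (f := fun r => (2 * r + β - α) / (2 - α - β))
    (f' := fun _ => 2 / (2 - α - β)) (h := fun t => (t * (2 - α - β) - β + α) / 2)
    (fun r _ => by
      have h := ((((hasDerivAt_id r).const_mul 2).add_const β).sub_const α).div_const (2 - α - β)
      exact h.congr_deriv (by simp))
    (fun r hr => ⟨⟨(div_lt_div_iff_of_pos_right hN).2 (by linarith [hr.1]),
      (div_lt_div_iff_of_pos_right hN).2 (by linarith [hr.2])⟩, by field_simp; ring⟩)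
    (fun t ht => ⟨⟨by linarith [(div_lt_iff₀ hN).1 ht.1], by linarith [(lt_div_iff₀ hN).1 ht.2]⟩,
      by field_simp; ring⟩)
    (sectionWeight ((α + β) / (2 - α - β)) ((β - α) / (2 - α - β)))
  have hC := lintegral_Ioo_subst (u := 0) (v := (β - α) / 2) (a := 0)
    (b := (β - α) / (2 - α - β)) (f := fun r => (2 * -r + β - α) / (2 - α - β))
    (f' := fun _ => -(2 / (2 - α - β))) (h := fun t => -((t * (2 - α - β) - β + α) / 2))
    (fun r _ => by
      have h := (((((hasDerivAt_id r).neg).const_mul 2).add_const β).sub_const α).div_const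
        (2 - α - β)
      exact h.congr_deriv (by simp [neg_div]))
    (fun r hr => ⟨⟨div_pos (by linarith [hr.2]) hN,
      (div_lt_div_iff_of_pos_right hN).2 (by linarith [hr.1])⟩, by field_simp; ring⟩)
    (fun t ht => ⟨⟨by linarith [(lt_div_iff₀ hN).1 ht.2], by linarith [mul_pos ht.1 hN]⟩,
      by field_simp; ring⟩)
    (sectionWeight ((α + β) / (2 - α - β)) ((β - α) / (2 - α - β)))
  rw [lintegral_Ioo_split _ (div_pos (by linarith : 0 < β - α) hN)
    ((div_lt_div_iff_of_pos_right hN).2 (by linarith : β - α < α + β)), hB, hC, mul_add, mul_add,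
    add_comm]
  have e : ∀ x : ℝ, 4 / (2 - α - β) ^ 3 * (2 / (2 - α - β) * (12 * (2 - α - β) ^ 4 * x)) = 96 * x := by
    intro x
    field_simp
    ring
  congr 1
  · rw [← lintegral_const_mul' _ _ ENNReal.ofReal_ne_top,
      ← lintegral_const_mul' _ _ ENNReal.ofReal_ne_top]
    refine setLIntegral_congr_fun measurableSet_Ioo fun r hr => ?_
    rw [(sectionWeight_eq_B hα hαβ hβ hr).2, abs_of_pos (by positivity),
      ← ENNReal.ofReal_mul (by positivity), ← ENNReal.ofReal_mul (by positivity),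
      ← ENNReal.ofReal_mul (by norm_num), e]
  · rw [← lintegral_const_mul' _ _ ENNReal.ofReal_ne_top,
      ← lintegral_const_mul' _ _ ENNReal.ofReal_ne_top]
    refine setLIntegral_congr_fun measurableSet_Ioo fun r hr => ?_
    rw [(sectionWeight_eq_C hα hαβ hβ hr).2, abs_neg, abs_of_pos (by positivity),
      ← ENNReal.ofReal_mul (by positivity), ← ENNReal.ofReal_mul (by positivity),
      ← ENNReal.ofReal_mul (by norm_num), e]

theorem lintegral_sectionWeight_BC :
    ∫⁻ b in Ioo (0 : ℝ) 1, ∫⁻ c in Ioo 0 b, ∫⁻ t in Ioo 0 b, sectionWeight b c t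
      = ENNReal.ofReal
        (96 * (-61702559 / 218700 / 768 + 104320327 / 3648645 / 768 * Real.pi ^ 2)) := by
  have hW : Measurable fun p : (ℝ × ℝ) × ℝ =>
      sectionWeight p.1.1 (p.1.1 - (1 + p.1.1) * p.1.2) p.2 := by
    have h := measurable_sectionWeight.comp (by fun_prop : Measurable fun p : (ℝ × ℝ) × ℝ =>
      (p.1.1, p.1.1 - (1 + p.1.1) * p.1.2, p.2))
    exact h
  have hG : Measurable fun p : ℝ × ℝ => ENNReal.ofReal (1 + p.1) *
      ∫⁻ t in Ioo 0 p.1, sectionWeight p.1 (p.1 - (1 + p.1) * p.2) t :=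
    Measurable.mul (by fun_prop) (measurable_lintegral_Ioo measurable_const measurable_fst hW)
  have h1 : ∫⁻ b in Ioo (0 : ℝ) 1, ∫⁻ c in Ioo 0 b, ∫⁻ t in Ioo 0 b, sectionWeight b c t
      = ∫⁻ b in Ioo (0 : ℝ) 1, ∫⁻ α in Ioo 0 (b / (1 + b)), ENNReal.ofReal (1 + b) *
        ∫⁻ t in Ioo 0 b, sectionWeight b (b - (1 + b) * α) t := by
    refine setLIntegral_congr_fun measurableSet_Ioo fun b hb => ?_
    have hb1 : 0 < 1 + b := by linarith [hb.1]
    have h := lintegral_Ioo_subst (u := 0) (v := b / (1 + b)) (a := 0) (b := b)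
      (f := fun α => b - (1 + b) * α) (f' := fun _ => -(1 + b)) (h := fun c => (b - c) / (1 + b))
      (fun α _ => by
        have h := ((hasDerivAt_id α).const_mul (1 + b)).const_sub b
        exact h.congr_deriv (by simp))
      (fun α hα => ⟨⟨by linarith [(lt_div_iff₀ hb1).1 hα.2], by linarith [mul_pos hb1 hα.1]⟩,
        by field_simp; ring⟩)
      (fun c hc => ⟨⟨div_pos (by linarith [hc.2]) hb1,
        (div_lt_div_iff_of_pos_right hb1).2 (by linarith [hc.1])⟩, by field_simp; ring⟩)
      (fun c => ∫⁻ t in Ioo 0 b, sectionWeight b c t)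
    rw [h]
    simp only [abs_neg, abs_of_pos hb1]
  have h2 := lintegral_region_swap (s := Ioo (0 : ℝ) 1) (t := Ioo (0 : ℝ) (1 / 2))
    (u := fun b => Ioo 0 (b / (1 + b))) (v := fun α => Ioo (α / (1 - α)) 1) measurableSet_Ioo
    measurableSet_Ioo (fun _ => measurableSet_Ioo) (fun _ => measurableSet_Ioo) (by
      have e : {p : ℝ × ℝ | p.1 ∈ Ioo (0 : ℝ) 1 ∧ p.2 ∈ Ioo 0 (p.1 / (1 + p.1))}
          = Ioo 0 1 ×ˢ univ ∩ {p : ℝ × ℝ | 0 < p.2} ∩ {p : ℝ × ℝ | p.2 < p.1 / (1 + p.1)} := by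
        ext p
        simp [and_assoc]
      rw [e]
      exact ((measurableSet_Ioo.prod MeasurableSet.univ).inter
        (measurableSet_lt measurable_const measurable_snd)).inter
        (measurableSet_lt measurable_snd (by fun_prop)))
    (fun b α => by
      constructor
      · rintro ⟨⟨h1, h2⟩, ⟨h3, h4⟩⟩
        rw [lt_div_iff₀ (by linarith)] at h4
        have h5 : α < 1 / 2 := by nlinarith
        exact ⟨⟨h3, h5⟩, ⟨by rw [div_lt_iff₀ (by linarith)]; linarith, h2⟩⟩
      · rintro ⟨⟨h1, h2⟩, ⟨h3, h4⟩⟩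
        have h5 : 0 < b := (div_pos h1 (by linarith)).trans h3
        rw [div_lt_iff₀ (by linarith)] at h3
        exact ⟨⟨h5, h4⟩, ⟨h1, by rw [lt_div_iff₀ (by linarith)]; linarith⟩⟩) hG
  rw [h1, h2, ENNReal.ofReal_mul (by norm_num), ← lintegral_BC
    (fun α β h1 h2 h3 r hr => (sectionWeight_eq_B h1 h2 h3 hr).1)
    (fun α β h1 h2 h3 r hr => (sectionWeight_eq_C h1 h2 h3 hr).1),
    ← lintegral_const_mul' _ _ ENNReal.ofReal_ne_top]
  refine setLIntegral_congr_fun measurableSet_Ioo fun α hα => ?_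
  obtain ⟨hα0, hα1⟩ := hα
  have hα2 : 0 < 1 - α := by linarith
  have h := lintegral_Ioo_subst (u := α) (v := 1 - α) (a := α / (1 - α)) (b := 1)
    (f := fun β => (α + β) / (2 - α - β)) (f' := fun β => 2 / (2 - α - β) ^ 2)
    (h := fun b => 2 * b / (1 + b) - α)
    (fun β hβ => by
      have hN : 2 - α - β ≠ 0 := by linarith [hβ.2]
      have h := ((hasDerivAt_id β).const_add α).div ((hasDerivAt_id β).const_sub (2 - α)) hN
      refine h.congr_deriv ?_
      simp
      ring)
    (fun β hβ => by
      obtain ⟨h1, h2⟩ := hβ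
      have hN : 0 < 2 - α - β := by linarith
      refine ⟨⟨?_, (div_lt_one hN).2 (by linarith)⟩, ?_⟩
      · rw [div_lt_div_iff₀ hα2 hN]
        nlinarith
      · have e : 1 + (α + β) / (2 - α - β) = 2 / (2 - α - β) := by
          field_simp
          ring
        rw [e]
        field_simp
        ring)
    (fun b hb => by
      obtain ⟨h1, h2⟩ := hb
      have hb0 : 0 < b := (div_pos hα0 hα2).trans h1
      rw [div_lt_iff₀ hα2] at h1
      have hb1 : 0 < 1 + b := by linarith
      refine ⟨⟨?_, ?_⟩, ?_⟩
      · rw [lt_sub_iff_add_lt, lt_div_iff₀ hb1]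
        linarith
      · rw [sub_lt_sub_iff_right, div_lt_one hb1]
        linarith
      · have e : 2 - α - (2 * b / (1 + b) - α) = 2 / (1 + b) := by
          field_simp
          ring
        rw [e]
        field_simp
        ring)
    (fun b => ENNReal.ofReal (1 + b) * ∫⁻ t in Ioo 0 b, sectionWeight b (b - (1 + b) * α) t)
  rw [h, ← lintegral_const_mul' _ _ ENNReal.ofReal_ne_top]
  refine setLIntegral_congr_fun measurableSet_Ioo fun β hβ => ?_
  have hN : 0 < 2 - α - β := by linarith [hβ.2]
  rw [← lintegral_sectionWeight_chart hα0 hβ.1 hβ.2, ← mul_assoc,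
    ← ENNReal.ofReal_mul (abs_nonneg _), abs_of_pos (by positivity),
    show 1 + (α + β) / (2 - α - β) = 2 / (2 - α - β) by field_simp; ring,
    show (α + β) / (2 - α - β) - 2 / (2 - α - β) * α = (β - α) / (2 - α - β) by ring]
  congr 2
  field_simp
  norm_num

theorem lintegral_sectionWeight :
    ∫⁻ b in Ioo (0 : ℝ) 1, ∫⁻ c in Ioo 0 b, ∫⁻ t in Ioo 0 1, sectionWeight b c t
      = ENNReal.ofReal
          (96 * (-61702559 / 218700 / 768 + 104320327 / 3648645 / 768 * Real.pi ^ 2))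
        + ENNReal.ofReal (6 * (5139122 / 18225 / 48 - 3857 / 135 / 48 * Real.pi ^ 2)) := by
  have hW : Measurable fun p : (ℝ × ℝ) × ℝ => sectionWeight p.1.1 p.1.2 p.2 := by
    have h := measurable_sectionWeight.comp (by fun_prop : Measurable fun p : (ℝ × ℝ) × ℝ =>
      (p.1.1, p.1.2, p.2))
    exact h
  have h1 := measurable_lintegral_Ioo (u := fun _ : ℝ × ℝ => (0 : ℝ)) (v := fun p : ℝ × ℝ => p.1)
    (g := fun p t => sectionWeight p.1 p.2 t)
    measurable_const measurable_fst hW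
  have h2 := measurable_lintegral_Ioo (u := fun _ : ℝ => (0 : ℝ)) (v := fun b : ℝ => b)
    (g := fun b c => ∫⁻ t in Ioo 0 b, sectionWeight b c t) measurable_const measurable_id h1
  rw [← lintegral_sectionWeight_A, ← lintegral_sectionWeight_BC, ← lintegral_add_left h2]
  refine setLIntegral_congr_fun measurableSet_Ioo fun b hb => ?_
  have h3 : Measurable fun c => ∫⁻ t in Ioo 0 b, sectionWeight b c t :=
    h1.comp (measurable_const.prodMk measurable_id)
  rw [← lintegral_add_left h3]
  exact lintegral_congr fun c => lintegral_Ioo_split _ hb.1 hb.2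

theorem octa_integral_value :
    (8 * (ENNReal.ofReal
          (96 * (-61702559 / 218700 / 768 + 104320327 / 3648645 / 768 * Real.pi ^ 2))
        + ENNReal.ofReal (6 * (5139122 / 18225 / 48 - 3857 / 135 / 48 * Real.pi ^ 2)))).toReal
      = (4 / 3) ^ 5 * (19297 * Real.pi ^ 2 / 3843840 - 6619 / 184320) := by
  have h1 := Real.pi_gt_d20
  have h2 := Real.pi_lt_d20
  have h3 : 3.1415926535897 ^ 2 < Real.pi ^ 2 := by gcongr; linarith
  have h4 : Real.pi ^ 2 < 3.1415926535898 ^ 2 := by gcongr; linarith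
  rw [← ENNReal.ofReal_add (by linarith) (by linarith), ENNReal.toReal_mul,
    ENNReal.toReal_ofReal (by linarith), ENNReal.toReal_ofNat]
  ring

end

/-- The mean volume of a random tetrahedron in a regular octahedron, normalized by the
volume of the octahedron, equals `19297π²/3843840 − 6619/184320`.  Here
`O = conv(±e₁,±e₂,±e₃)` has volume `4/3`, and the normalized mean is the iterated
integral of the hull volume divided by `vol(O)⁵` (four factors normalize the uniform
distribution of the four points, one more normalizes the volume). -/
theorem stmt_11 :
    (∫ x₀ in convexHull ℝ ((Set.range fun i => EuclideanSpace.single i (1:ℝ)) ∪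
          (Set.range fun i : Fin 3 => -EuclideanSpace.single i (1:ℝ))),
      ∫ x₁ in convexHull ℝ ((Set.range fun i => EuclideanSpace.single i (1:ℝ)) ∪
          (Set.range fun i : Fin 3 => -EuclideanSpace.single i (1:ℝ))),
      ∫ x₂ in convexHull ℝ ((Set.range fun i => EuclideanSpace.single i (1:ℝ)) ∪
          (Set.range fun i : Fin 3 => -EuclideanSpace.single i (1:ℝ))),
      ∫ x₃ in convexHull ℝ ((Set.range fun i => EuclideanSpace.single i (1:ℝ)) ∪
          (Set.range fun i : Fin 3 => -EuclideanSpace.single i (1:ℝ))),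
        (volume (convexHull ℝ {x₀, x₁, x₂, x₃})).toReal)
      / (volume (convexHull ℝ ((Set.range fun i => EuclideanSpace.single i (1:ℝ)) ∪
          (Set.range fun i : Fin 3 => -EuclideanSpace.single i (1:ℝ))))).toReal ^ 5
      = 19297 * Real.pi ^ 2 / 3843840 - 6619 / 184320 := by
  rw [convexHull_octahedron, integral_volume_convexHull, lintegral_tetraVol,
    lintegral_octaKernel_eq, lintegral_sectionWeight, octa_integral_value, volume_octahedron,
    ENNReal.toReal_ofReal (by norm_num)]
  field_simp
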